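/- Let R_0 → R_1 → ⋯ → R_n be a finite sequence of local ring homomorphisms f_i : R_{i-1} → R_i between complete noetherian local domains, with R_0 of mixed characteristic (0,p). Fix absolute integral closures R_i⁺ of each R_i and liftings f_i⁺ : R_{i-1}⁺ → R_i⁺ of each f_i (which may be given in advance). Then there exist, for each i, an R_i⁺-algebra C_i which is a (big) Cohen-Macaulay R_i-algebra, and ring homomorphisms C_{i-1} → C_i, such that all squares in the resulting ladder diagram commute: the square formed by R_{i-1}⁺ → R_i⁺ (given by f_i⁺), R_{i-1}⁺ → C_{i-1}, R_i⁺ → C_i, and C_{i-1} → C_i commutes for every i. Moreover, for each i such that R_i has characteristic p, C_i may be taken to be a perfect ring (Frobenius x ↦ x^p bijective on C_i). -/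

import Mathlib

/-- A finite sequence `y` of elements of a commutative ring `B` is a regular sequence on `B`:
for each `i`, multiplication by `y i` is injective on `B/(y_1,…,y_{i-1})B`,
and `B ≠ (y_1,…,y_m)B`. -/
def IsRegSeq {B : Type*} [CommRing B] {m : ℕ} (y : Fin m → B) : Prop :=
  (∀ i : Fin m, ∀ b : B,
      y i * b ∈ Ideal.span (y '' {j : Fin m | j < i}) →
        b ∈ Ideal.span (y '' {j : Fin m | j < i})) ∧
  Ideal.span (Set.range y) ≠ ⊤

/-- A `B`-algebra (given by a ring hom `φ : R →+* B`) is Cohen-Macaulay with respect to a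
sequence `x` of elements of `R` if `x` becomes a regular sequence in `B`. -/
def IsCMwrt {R B : Type*} [CommRing R] [CommRing B] (φ : R →+* B)
    {d : ℕ} (x : Fin d → R) : Prop :=
  IsRegSeq fun i => φ (x i)

/-- `x` is a system of parameters of the noetherian local ring `R`: `d` is the Krull dimension,
all `x i` lie in the maximal ideal, and they generate an ideal whose radical is the maximal
ideal. -/
def IsSOP (R : Type*) [CommRing R] [IsLocalRing R] {d : ℕ} (x : Fin d → R) : Prop :=
  (d : WithBot ℕ∞) = ringKrullDim R ∧
  (∀ i, x i ∈ IsLocalRing.maximalIdeal R) ∧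
  (Ideal.span (Set.range x)).radical = IsLocalRing.maximalIdeal R

/-- `B` (via the structure map `φ`) is a big Cohen-Macaulay `R`-algebra: it is Cohen-Macaulay
with respect to every system of parameters of `R`. -/
def IsBigCM {R B : Type*} [CommRing R] [IsLocalRing R] [CommRing B] (φ : R →+* B) : Prop :=
  ∀ (d : ℕ) (x : Fin d → R), IsSOP R x → IsCMwrt φ x

/-- `A` (as an `R`-algebra) is an absolute integral closure of the domain `R`:
it is a domain containing `R`, integral over `R`, and absolutely integrally closed
(every monic polynomial of positive degree has a root); equivalently, it is the
integral closure of `R` in an algebraic closure of its fraction field. -/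
structure IsAbsIntClosure (R A : Type*) [CommRing R] [CommRing A] [Algebra R A] : Prop where
  isDomain : IsDomain A
  injective : Function.Injective (algebraMap R A)
  isIntegral : Algebra.IsIntegral R A
  monic_root : ∀ P : Polynomial A, P.Monic → 0 < P.degree → ∃ a : A, P.IsRoot a

/-- `B` is `π^{1/p^∞}`-almost Cohen-Macaulay with respect to `x`, where `π : ℕ → B` is a
compatible system of `p`-th power roots. -/
def IsAlmostCMwrt {R B : Type*} [CommRing R] [CommRing B] (φ : R →+* B)
    (π : ℕ → B) {d : ℕ} (x : Fin d → R) : Prop :=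
  (∀ i : Fin d, ∀ b : B,
      φ (x i) * b ∈ Ideal.span ((fun j => φ (x j)) '' {j : Fin d | j < i}) →
        ∀ e : ℕ, π e * b ∈ Ideal.span ((fun j => φ (x j)) '' {j : Fin d | j < i})) ∧
  ¬ Ideal.span (Set.range π) ≤ Ideal.span (Set.range fun j => φ (x j))

set_option linter.unusedSectionVars false
set_option linter.overlappingInstances false

section

/-- `M` is derived complete along `a`. -/
def DComplete {R : Type*} [CommRing R] (a : R) (M : Type*) [AddCommGroup M] [Module R M] : Prop :=
  Function.Bijective fun (e : ℕ → M) (n : ℕ) => e n - a • e (n + 1)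

namespace DComplete

variable {R M N P : Type*} [CommRing R] [AddCommGroup M] [Module R M] [AddCommGroup N] [Module R N]
  [AddCommGroup P] [Module R P] {a b : R}

theorem eq_zero (h : DComplete a M) {e : ℕ → M} (he : ∀ n, e n = a • e (n + 1)) (n : ℕ) :
    e n = 0 := by
  have : e = 0 := h.1 (by funext n; simp [← he n])
  simp [this]

theorem exists_eq (h : DComplete a M) (d : ℕ → M) : ∃ e : ℕ → M, ∀ n, e n = d n + a • e (n + 1) := by
  obtain ⟨e, he⟩ := h.2 d
  exact ⟨e, fun n => by rw [← he]; simp⟩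

theorem of_exists (h1 : ∀ e : ℕ → M, (∀ n, e n = a • e (n + 1)) → e 0 = 0)
    (h2 : ∀ d : ℕ → M, ∃ e : ℕ → M, ∀ n, e n = d n + a • e (n + 1)) : DComplete a M := by
  constructor
  · intro e e' hee
    have h3 : ∀ n, (e - e') n = a • (e - e') (n + 1) := fun n => by
      have := congrFun hee n
      simp only [Pi.sub_apply, smul_sub] at this ⊢
      linear_combination (norm := module) this
    funext n
    have := h1 (fun k => (e - e') (n + k)) (fun k => h3 (n + k))
    simpa [sub_eq_zero] using this
  · intro d
    obtain ⟨e, he⟩ := h2 d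
    exact ⟨e, by funext n; simp only; rw [he n]; simp⟩

theorem of_isAdicComplete (I : Ideal R) [hI : IsAdicComplete I M] (ha : a ∈ I) :
    DComplete a M := by
  have hmem : ∀ (n : ℕ) (m : M), a ^ n • m ∈ (I ^ n • ⊤ : Submodule R M) := fun n m =>
    Submodule.smul_mem_smul (Ideal.pow_mem_pow ha n) trivial
  refine of_exists (fun e he => ?_) fun d => ?_
  · have h1 : ∀ n, e 0 = a ^ n • e n := fun n => by
      induction n with
      | zero => simp
      | succ n ih => rw [ih, he n, smul_smul, pow_succ]
    refine hI.toIsHausdorff.haus _ fun n => ?_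
    rw [SModEq.zero, h1 n]
    exact hmem n _
  · have h1 : ∀ n, ∃ L : M, ∀ m, ∑ k ∈ Finset.range m, a ^ k • d (n + k) ≡ L
        [SMOD (I ^ m • ⊤ : Submodule R M)] := fun n => by
      refine hI.toIsPrecomplete.prec fun {m m'} hmm => ?_
      rw [SModEq.comm, SModEq.sub_mem, ← Finset.sum_sdiff_eq_sub (Finset.range_subset_range.2 hmm)]
      refine sum_mem fun k hk => ?_
      have hk' : m ≤ k := by simpa using (Finset.mem_sdiff.1 hk).2
      exact Submodule.smul_mono_left (Ideal.pow_le_pow_right hk') (hmem k _)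
    choose L hL using h1
    refine ⟨L, fun n => ?_⟩
    rw [← sub_eq_zero]
    refine hI.toIsHausdorff.haus _ fun m => ?_
    rw [SModEq.zero]
    have h2 := SModEq.sub_mem.1 (hL n (m + 1))
    have h3 := SModEq.sub_mem.1 (hL (n + 1) m)
    have h4 : (I ^ (m + 1) • ⊤ : Submodule R M) ≤ I ^ m • ⊤ :=
      Submodule.smul_mono_left (Ideal.pow_le_pow_right (Nat.le_succ m))
    have h5 := sub_mem (Submodule.smul_mem _ a h3) (h4 h2)
    convert h5 using 1
    rw [Finset.sum_range_succ']
    have h6 : ∑ k ∈ Finset.range m, a ^ (k + 1) • d (n + (k + 1)) =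
        a • ∑ k ∈ Finset.range m, a ^ k • d (n + 1 + k) := by
      rw [Finset.smul_sum]
      refine Finset.sum_congr rfl fun k _ => ?_
      rw [smul_smul, ← pow_succ']
      congr 2; ring
    rw [h6]
    simp only [pow_zero, one_smul, add_zero]
    module

theorem bijective_sub (h : DComplete a M) (T : M →ₗ[R] M) :
    Function.Bijective fun m => m - a • T m := by
  constructor
  · intro m m' hm
    have h3 : (m - m') = a • T (m - m') := by
      simp only [map_sub, smul_sub] at hm ⊢
      linear_combination (norm := module) hm
    have := h.eq_zero (e := fun k => (T ^ k) (m - m')) (fun n => by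
      conv_lhs => rw [h3]
      rw [map_smul, pow_succ]; rfl) 0
    simpa [sub_eq_zero] using this
  · intro d
    obtain ⟨e, he⟩ := h.exists_eq (fun k => (T ^ k) d)
    have key : e 1 = T (e 0) := by
      have := h.eq_zero (e := fun k => e (k + 1) - T (e k)) (fun n => by
        have h1 := he (n + 1)
        have h2 := congrArg T (he n)
        simp only [map_add, map_smul, pow_succ', Module.End.mul_apply] at h1 h2
        simp only [smul_sub]
        linear_combination (norm := module) h1 - h2) 0
      simpa [sub_eq_zero] using this
    refine ⟨e 0, ?_⟩
    have := he 0
    simp only [zero_add, key, pow_zero, Module.End.one_apply] at this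
    exact sub_eq_of_eq_add this

theorem pi {ι : Type*} {M : ι → Type*} [∀ i, AddCommGroup (M i)] [∀ i, Module R (M i)]
    (h : ∀ i, DComplete a (M i)) : DComplete a (∀ i, M i) := by
  refine of_exists (fun e he => ?_) (fun d => ?_)
  · funext i
    exact (h i).eq_zero (e := fun n => e n i) (fun n => congrFun (he n) i) 0
  · choose e he using fun i => (h i).exists_eq (fun n => d n i)
    exact ⟨fun n i => e i n, fun n => funext fun i => he i n⟩

/-- The shift on sequences. -/
def shift (R M : Type*) [CommRing R] [AddCommGroup M] [Module R M] : (ℕ → M) →ₗ[R] (ℕ → M) :=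
  LinearMap.funLeft R M (fun n => n + 1)

theorem iff_bijective : DComplete a M ↔ Function.Bijective fun e : ℕ → M => e - a • shift R M e :=
  Iff.rfl

theorem mul_right (h : DComplete a M) (b : R) : DComplete (a * b) M := by
  have := (pi (fun _ : ℕ => h)).bijective_sub (b • shift R M)
  simpa [iff_bijective, mul_smul] using this

theorem add (ha : DComplete a M) (hb : DComplete b M) : DComplete (a + b) M := by
  have h1 := (iff_bijective.1 ha)
  let f : (ℕ → M) →ₗ[R] (ℕ → M) := LinearMap.id - a • shift R M
  let A := (LinearEquiv.ofBijective f h1)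
  have h2 := (pi (fun _ : ℕ => hb)).bijective_sub ((A.symm : _ →ₗ[R] _) ∘ₗ shift R M)
  have h3 := A.bijective.comp h2
  rw [iff_bijective]
  convert h3 using 1
  funext e
  simp only [Function.comp, map_sub, map_smul, LinearMap.comp_apply, LinearEquiv.coe_coe,
    LinearEquiv.apply_symm_apply]
  change _ = (e - a • shift R M e) - _
  rw [add_smul]; abel

theorem of_pow {k : ℕ} (h : DComplete (a ^ k) M) : DComplete a M := by
  have h2 := (pi (fun _ : ℕ => h)).bijective_sub (shift R M ^ k)
  set s : Module.End R (ℕ → M) := a • shift R M with hs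
  have e1 : (1 - s) * (∑ i ∈ Finset.range k, s ^ i) = 1 - s ^ k := mul_neg_geom_sum s k
  have e2 : (∑ i ∈ Finset.range k, s ^ i) * (1 - s) = 1 - s ^ k := geom_sum_mul_neg s k
  have e3 : (fun m => m - a ^ k • (shift R M ^ k) m) = ⇑(1 - s ^ k) := by
    funext m; simp [hs, smul_pow]
  have e4 : (fun e : ℕ → M => e - a • shift R M e) = ⇑(1 - s) := by
    funext m; simp [hs]
  rw [iff_bijective, e4]
  rw [e3] at h2
  constructor
  · have := h2.1
    rw [← e2] at this
    exact Function.Injective.of_comp (f := ⇑(∑ i ∈ Finset.range k, s ^ i)) this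
  · have := h2.2
    rw [← e1] at this
    exact Function.Surjective.of_comp (g := ⇑(∑ i ∈ Finset.range k, s ^ i)) this

theorem zero : DComplete (0 : R) M := by
  rw [iff_bijective]; simp only [zero_smul, sub_zero]; exact Function.bijective_id

theorem of_mem_radical {s : Set R} (h : ∀ x ∈ s, DComplete x M)
    (ha : a ∈ (Ideal.span s).radical) : DComplete a M := by
  obtain ⟨n, hn⟩ := ha
  refine of_pow (k := n) ?_
  refine Submodule.span_induction (p := fun x _ => DComplete x M) (fun x hx => h x hx) zero
    (fun x y _ _ => add) (fun x y _ hy => ?_) hn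
  rw [smul_eq_mul, mul_comm]; exact hy.mul_right x

theorem of_exact (f : M →ₗ[R] N) (g : P →ₗ[R] M) (hf : Function.Surjective f)
    (hfg : LinearMap.ker f ≤ LinearMap.range g) (hgf : ∀ x, f (g x) = 0)
    (hM : DComplete a M) (hP : DComplete a P) : DComplete a N := by
  refine of_exists (fun e he => ?_) (fun d => ?_)
  · choose E hE using fun n => hf (e n)
    have : ∀ n, ∃ y, g y = E n - a • E (n + 1) := fun n => hfg (by simp [hE, ← he])
    choose y hy using this
    obtain ⟨z, hz⟩ := hP.exists_eq y
    have := hM.eq_zero (e := fun n => E n - g (z n)) (fun n => by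
      simp only [smul_sub]; rw [hz n, map_add, hy, map_smul]; abel) 0
    rw [← hE, sub_eq_zero.1 this, hgf]
  · choose D hD using fun n => hf (d n)
    obtain ⟨e, he⟩ := hM.exists_eq D
    exact ⟨fun n => f (e n), fun n => by simp only; rw [he n]; simp [hD]⟩

theorem quotient {I : Ideal R} (hI : I.FG) (h : DComplete a R) : DComplete a (R ⧸ I) := by
  obtain ⟨n, s, hs⟩ := Submodule.fg_iff_exists_fin_generating_family.1 hI
  refine of_exact (Submodule.mkQ I) (Fintype.linearCombination R s) (Submodule.mkQ_surjective I)
    ?_ ?_ h (pi fun _ => h)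
  · rw [Submodule.ker_mkQ, Fintype.range_linearCombination, hs]
  · intro x
    have : Fintype.linearCombination R s x ∈ I := by
      rw [← hs, ← Fintype.range_linearCombination]; exact ⟨x, rfl⟩
    exact Ideal.Quotient.eq_zero_iff_mem.2 this

theorem of_ringHom {S : Type*} [CommRing S] (f : R →+* S) (a : R) (M : Type*) [AddCommGroup M]
    [Module R M] [Module S M] (hs : ∀ (r : R) (m : M), r • m = f r • m) :
    DComplete a M ↔ DComplete (f a) M := by
  unfold DComplete; simp only [hs]

/-- The ideal-theoretic form of uniqueness. -/
theorem mem_of_forall {I : Ideal R} (hI : I.FG) (h : DComplete a R) {e : ℕ → R}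
    (he : ∀ n, e n - a * e (n + 1) ∈ I) : e 0 ∈ I := by
  have := (h.quotient hI).eq_zero (e := fun n => Ideal.Quotient.mk I (e n)) (fun n => by
    have := Ideal.Quotient.eq.2 (he n)
    rw [this, map_mul]; rfl) 0
  exact Ideal.Quotient.eq_zero_iff_mem.1 this

end DComplete

end

section

open IsLocalRing

/-- The sequence `l` is weakly regular modulo the ideal `I`. -/
def RegMod {C : Type*} [CommRing C] (I : Ideal C) : List C → Prop
  | [] => True
  | r :: rs => (∀ b, r * b ∈ I → b ∈ I) ∧ RegMod (I ⊔ Ideal.span {r}) rs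

namespace RegMod

variable {C : Type*} [CommRing C] {I : Ideal C} {a b r s x z : C} {l rs : List C}

theorem append {l₁ l₂ : List C} :
    RegMod I (l₁ ++ l₂) ↔ RegMod I l₁ ∧ RegMod (I ⊔ Ideal.ofList l₁) l₂ := by
  induction l₁ generalizing I with
  | nil => simp [RegMod]
  | cons r rs ih => simp [RegMod, ih, and_assoc, sup_assoc]

theorem mem_sup_span {I : Ideal C} {a x : C} : x ∈ I ⊔ Ideal.span {a} ↔ ∃ c, x - a * c ∈ I := by
  rw [Submodule.mem_sup]
  constructor
  · rintro ⟨i, hi, y, hy, rfl⟩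
    obtain ⟨c, rfl⟩ := Ideal.mem_span_singleton.1 hy
    exact ⟨c, by simpa using hi⟩
  · rintro ⟨c, hc⟩
    exact ⟨_, hc, a * c, Ideal.mem_span_singleton.2 ⟨c, rfl⟩, by ring⟩

theorem comm_left (ha : ∀ c, a * c ∈ I → c ∈ I)
    (hb : ∀ c, b * c ∈ I ⊔ Ideal.span {a} → c ∈ I ⊔ Ideal.span {a}) (c : C)
    (hc : a * c ∈ I ⊔ Ideal.span {b}) : c ∈ I ⊔ Ideal.span {b} := by
  obtain ⟨d, hd⟩ := mem_sup_span.1 hc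
  have h1 : b * d ∈ I ⊔ Ideal.span {a} := by
    refine mem_sup_span.2 ⟨c, ?_⟩
    have := I.neg_mem hd
    rwa [neg_sub] at this
  obtain ⟨e, he⟩ := mem_sup_span.1 (hb d h1)
  refine mem_sup_span.2 ⟨e, ha _ ?_⟩
  have := I.add_mem hd (I.mul_mem_left b he)
  convert this using 1; ring

theorem swap_right (hI : I.FG) (hdc : DComplete a C) (ha : ∀ c, a * c ∈ I → c ∈ I)
    (hb : ∀ c, b * c ∈ I ⊔ Ideal.span {a} → c ∈ I ⊔ Ideal.span {a}) (c : C)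
    (hc : b * c ∈ I) : c ∈ I := by
  have step : ∀ c : {c // b * c ∈ I}, ∃ d : {c // b * c ∈ I}, c.1 - a * d.1 ∈ I := by
    rintro ⟨c, hc⟩
    obtain ⟨d, hd⟩ := mem_sup_span.1 (hb c (Ideal.mem_sup_left hc))
    refine ⟨⟨d, ha _ ?_⟩, hd⟩
    have := I.sub_mem hc (I.mul_mem_left b hd)
    convert this using 1; ring
  choose f hf using step
  exact hdc.mem_of_forall hI (e := fun k => (f^[k] ⟨c, hc⟩).1) (fun k => by
    rw [Function.iterate_succ_apply']; exact hf _)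

theorem perm {l' : List C} (h : l.Perm l') (hI : I.FG) (hdc : ∀ a ∈ l, DComplete a C)
    (hl : RegMod I l) : RegMod I l' := by
  induction h generalizing I with
  | nil => trivial
  | cons x _ ih =>
    exact ⟨hl.1, ih (Submodule.FG.sup hI (Submodule.fg_span_singleton x)) (fun a ha => hdc a (by simp [ha])) hl.2⟩
  | swap x y l =>
    refine ⟨swap_right hI (hdc y (by simp)) hl.1 hl.2.1, comm_left hl.1 hl.2.1, ?_⟩
    have := hl.2.2
    rwa [sup_assoc, sup_comm (Ideal.span {y}), ← sup_assoc] at this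
  | trans h₁ h₂ ih₁ ih₂ => exact ih₂ hI (fun a ha => hdc a (h₁.mem_iff.2 ha)) (ih₁ hI hdc hl)

/-- Only the entries in front of `w` need to be complete for moving `w` to the front. -/
theorem move_front {w : C} (hI : I.FG) (hdc : ∀ a ∈ l, DComplete a C)
    (hl : RegMod I (l ++ [w])) : RegMod I (w :: l) := by
  induction l generalizing I with
  | nil => exact hl
  | cons x l ih =>
    have h1 := ih (Submodule.FG.sup hI (Submodule.fg_span_singleton x)) (fun a ha => hdc a (by simp [ha])) hl.2
    refine ⟨swap_right hI (hdc x (by simp)) hl.1 h1.1, comm_left hl.1 h1.1, ?_⟩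
    have := h1.2
    rwa [sup_assoc, sup_comm (Ideal.span {x}), ← sup_assoc] at this

theorem mem_of_pow_mul (h : ∀ c, a * c ∈ I → c ∈ I) (n : ℕ) (c : C) (hc : a ^ n * c ∈ I) :
    c ∈ I := by
  induction n with
  | zero => simpa using hc
  | succ n ih => exact ih (h _ (by rwa [← mul_assoc, ← pow_succ']))

theorem pow_head (ha : ∀ c, a * c ∈ I → c ∈ I) (k : ℕ) (h : RegMod (I ⊔ Ideal.span {a}) rs) :
    RegMod (I ⊔ Ideal.span {a ^ k}) rs := by
  induction rs generalizing I with
  | nil => trivial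
  | cons r rs ih =>
    have ha' := comm_left ha h.1
    refine ⟨?_, ?_⟩
    · clear ih
      induction k with
      | zero => intro b _; simp
      | succ k ihk =>
        intro b hb
        obtain ⟨c, hc⟩ := mem_sup_span.1 hb
        have h1 : b ∈ I ⊔ Ideal.span {a} := h.1 b (mem_sup_span.2 ⟨a ^ k * c, by
          convert hc using 1; ring⟩)
        obtain ⟨b', hb'⟩ := mem_sup_span.1 h1
        have h2 : r * b' - a ^ k * c ∈ I := ha _ (by
          have := I.sub_mem hc (I.mul_mem_left r hb')
          convert this using 1; ring)
        obtain ⟨d, hd⟩ := mem_sup_span.1 (ihk b' (mem_sup_span.2 ⟨c, h2⟩))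
        refine mem_sup_span.2 ⟨d, ?_⟩
        have := I.add_mem hb' (I.mul_mem_left a hd)
        convert this using 1; ring
    · have := ih (I := I ⊔ Ideal.span {r}) ha' (by
        have := h.2
        rwa [sup_assoc, sup_comm (Ideal.span {a}), ← sup_assoc] at this)
      rwa [sup_assoc, sup_comm (Ideal.span {r}), ← sup_assoc] at this

theorem pow_cons (h : RegMod I (a :: rs)) (k : ℕ) : RegMod I (a ^ k :: rs) :=
  ⟨mem_of_pow_mul h.1 k, pow_head h.1 k h.2⟩

theorem map_pow (h : RegMod I l) (k : ℕ) : RegMod I (l.map (· ^ k)) := by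
  induction l generalizing I with
  | nil => trivial
  | cons a l ih => exact ⟨mem_of_pow_mul h.1 k, ih (pow_cons h k).2⟩

theorem root_head {k : ℕ} (hk : k ≠ 0) (hs : ∀ c, s * c ∈ I → c ∈ I)
    (h : RegMod (I ⊔ Ideal.span {s ^ k}) rs) : RegMod (I ⊔ Ideal.span {s}) rs := by
  induction rs generalizing I with
  | nil => trivial
  | cons r rs ih =>
    obtain ⟨k, rfl⟩ := Nat.exists_eq_add_one_of_ne_zero hk
    refine ⟨fun b hb => ?_, ?_⟩
    · obtain ⟨c, hc⟩ := mem_sup_span.1 hb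
      have h1 : s ^ k * b ∈ I ⊔ Ideal.span {s ^ (k + 1)} := h.1 _ (mem_sup_span.2 ⟨c, by
        have := I.mul_mem_left (s ^ k) hc
        convert this using 1; ring⟩)
      obtain ⟨d, hd⟩ := mem_sup_span.1 h1
      exact mem_sup_span.2 ⟨d, mem_of_pow_mul hs k _ (by convert hd using 1; ring)⟩
    · have hsk := comm_left (mem_of_pow_mul hs (k + 1)) h.1
      have hs' : ∀ c, s * c ∈ I ⊔ Ideal.span {r} → c ∈ I ⊔ Ideal.span {r} := fun c hc =>
        hsk c (by rw [pow_succ, mul_assoc]; exact Ideal.mul_mem_left _ _ hc)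
      have := ih (I := I ⊔ Ideal.span {r}) hs' (by
        have := h.2
        rwa [sup_assoc, sup_comm (Ideal.span {s ^ (k + 1)}), ← sup_assoc] at this)
      rwa [sup_assoc, sup_comm (Ideal.span {r}), ← sup_assoc] at this

theorem root_cons {k : ℕ} (hk : k ≠ 0) (h : RegMod I (s ^ k :: rs)) : RegMod I (s :: rs) := by
  have hs : ∀ c, s * c ∈ I → c ∈ I := fun c hc => h.1 c (by
    obtain ⟨k, rfl⟩ := Nat.exists_eq_add_one_of_ne_zero hk
    rw [pow_succ, mul_assoc]; exact I.mul_mem_left _ hc)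
  exact ⟨hs, root_head hk hs h.2⟩

theorem exchange_last {n : ℕ} (h : RegMod I (l ++ [x]))
    (hx : x ^ n ∈ I ⊔ Ideal.ofList l ⊔ Ideal.span {z}) : RegMod I (l ++ [z]) := by
  rw [append] at h ⊢
  refine ⟨h.1, fun b hb => mem_of_pow_mul h.2.1 n b ?_, trivial⟩
  obtain ⟨c, hc⟩ := mem_sup_span.1 hx
  have h1 := Ideal.mul_mem_left _ b hc
  have h2 := Ideal.mul_mem_left _ c hb
  have := Ideal.add_mem _ h1 h2
  convert this using 1; ring

/-- A sequence that is regular modulo `I` and along which the ring is complete generates an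
ideal whose powers have closed intersection. -/
theorem mem_of_forall_pow {c : C} (hI : I.FG) (hdc : ∀ a ∈ l, DComplete a C) (hl : RegMod I l)
    (hc : ∀ n : ℕ, c ∈ I ⊔ Ideal.ofList l ^ n) : c ∈ I := by
  induction l generalizing I with
  | nil => simpa using hc 1
  | cons x l ih =>
    have h1 : ∀ m : ℕ, c ∈ I ⊔ Ideal.span {x ^ m} := fun m => by
      refine ih (Submodule.FG.sup hI (Submodule.fg_span_singleton (x ^ m))) (fun a ha => hdc a (by simp [ha])) (pow_cons hl m).2
        (fun n => ?_)
      have h2 : Ideal.ofList (x :: l) ^ (m + n) ≤ Ideal.span {x ^ m} ⊔ Ideal.ofList l ^ n := by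
        rw [Ideal.ofList_cons, ← Ideal.span_singleton_pow]
        exact Ideal.sup_pow_add_le_pow_sup_pow
      rw [sup_assoc]
      exact (sup_le_sup_left h2 I) (hc (m + n))
    choose e he using fun m => mem_sup_span.1 (h1 m)
    have := (hdc x (by simp)).mem_of_forall hI (e := e) (fun n => mem_of_pow_mul hl.1 n _ (by
      have := I.sub_mem (he (n + 1)) (he n)
      convert this using 1; ring))
    have h0 := he 0
    have := I.add_mem h0 this
    convert this using 1; ring

theorem comap_sup_span {B : Type*} [CommRing B] {f : C →+* B} (hf : Function.Surjective f)
    (J : Ideal B) (r : C) :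
    (J ⊔ Ideal.span {f r}).comap f = J.comap f ⊔ Ideal.span {r} := by
  ext x
  rw [Ideal.mem_comap, mem_sup_span, mem_sup_span, hf.exists]
  simp only [Ideal.mem_comap, map_sub, map_mul]

theorem map_iff_comap {B : Type*} [CommRing B] {f : C →+* B} (hf : Function.Surjective f)
    {J : Ideal B} : RegMod J (l.map f) ↔ RegMod (J.comap f) l := by
  induction l generalizing J with
  | nil => exact Iff.rfl
  | cons r l ih =>
    rw [List.map_cons, RegMod, RegMod, ih, comap_sup_span hf, hf.forall]
    simp only [Ideal.mem_comap, map_mul]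

theorem quotient (h : RegMod I l) : RegMod (⊥ : Ideal (C ⧸ I)) (l.map (Ideal.Quotient.mk I)) := by
  rwa [map_iff_comap Ideal.Quotient.mk_surjective, ← RingHom.ker_eq_comap_bot, Ideal.mk_ker]

theorem ofList_comap {B : Type*} [CommRing B] {f : C →+* B} (hf : Function.Surjective f)
    (J : Ideal B) :
    (J ⊔ Ideal.ofList (l.map f)).comap f = J.comap f ⊔ Ideal.ofList l := by
  induction l generalizing J with
  | nil => simp
  | cons r l ih =>
    rw [List.map_cons, Ideal.ofList_cons, Ideal.ofList_cons, ← sup_assoc, ih, comap_sup_span hf,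
      sup_assoc]

end RegMod

/-- Prime avoidance: lengthening two sequences simultaneously. -/
theorem exists_radical_sup_span_eq {E : Type*} [CommRing E] [IsNoetherianRing E] [IsLocalRing E]
    {I J : Ideal E} {a b : E}
    (ha : (I ⊔ Ideal.span {a}).radical = maximalIdeal E)
    (hb : (J ⊔ Ideal.span {b}).radical = maximalIdeal E)
    (hI : I.radical ≠ maximalIdeal E) (hJ : J.radical ≠ maximalIdeal E) :
    ∃ w, (I ⊔ Ideal.span {w}).radical = maximalIdeal E ∧
      (J ⊔ Ideal.span {w}).radical = maximalIdeal E := by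
  have aux : ∀ (I : Ideal E) (a : E), (I ⊔ Ideal.span {a}).radical = maximalIdeal E →
      ∀ w ∈ maximalIdeal E, (∀ P ∈ I.minimalPrimes, w ∉ P) →
      (I ⊔ Ideal.span {w}).radical = maximalIdeal E := by
    intro I a ha w hwm hw
    have hIm : I ≤ maximalIdeal E := by
      rw [← ha]; exact le_sup_left.trans Ideal.le_radical
    have ham : a ∈ maximalIdeal E := by
      rw [← ha]; exact Ideal.le_radical (Ideal.mem_sup_right (Ideal.mem_span_singleton_self a))
    refine le_antisymm ?_ ?_
    · rw [(maximalIdeal.isMaximal E).isPrime.radical_le_iff, sup_le_iff,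
        Ideal.span_singleton_le_iff_mem]
      exact ⟨hIm, hwm⟩
    · rw [Ideal.radical_eq_sInf]
      refine le_sInf ?_
      rintro P ⟨hP, hPp⟩
      obtain ⟨P₀, hP₀, hle⟩ := Ideal.exists_minimalPrimes_le (I := I) (J := P)
        (le_sup_left.trans hP)
      have hP₀p : P₀.IsPrime := hP₀.1.1
      have hne : P₀ < P := lt_of_le_of_ne hle (fun h => hw P₀ hP₀ (h ▸ hP
        (Ideal.mem_sup_right (Ideal.mem_span_singleton_self w))))
      by_contra hcon
      have hlt : P < maximalIdeal E := lt_of_le_of_ne (le_maximalIdeal hPp.ne_top)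
        (fun h => hcon h.ge)
      have hmin : maximalIdeal E ∈ (P₀ ⊔ Ideal.span {a}).minimalPrimes := by
        refine ⟨⟨inferInstance, sup_le (le_maximalIdeal hP₀p.ne_top)
          ((Ideal.span_singleton_le_iff_mem _).2 ham)⟩, ?_⟩
        rintro K ⟨hK, hKl⟩ -
        rw [← ha]
        exact hK.radical_le_iff.2 ((sup_le_sup_right hP₀.1.2 _).trans hKl)
      have hht := Ideal.map_height_le_one_of_mem_minimalPrimes hmin
      have : IsLocalRing (E ⧸ P₀) := .of_surjective' (Ideal.Quotient.mk P₀)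
        Ideal.Quotient.mk_surjective
      have hp1 : (P.map (Ideal.Quotient.mk P₀)).IsPrime :=
        Ideal.isPrime_map_quotientMk_of_isPrime hle
      have hp2 : ((maximalIdeal E).map (Ideal.Quotient.mk P₀)).IsPrime :=
        Ideal.isPrime_map_quotientMk_of_isPrime (le_maximalIdeal hP₀p.ne_top)
      have hcm : ∀ K : Ideal E, P₀ ≤ K →
          (K.map (Ideal.Quotient.mk P₀)).comap (Ideal.Quotient.mk P₀) = K := fun K hK => by
        rw [Ideal.comap_map_of_surjective _ Ideal.Quotient.mk_surjective, ← RingHom.ker_eq_comap_bot,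
          Ideal.mk_ker, sup_eq_left.2 hK]
      have l1 : (⊥ : Ideal (E ⧸ P₀)) < P.map (Ideal.Quotient.mk P₀) := by
        refine lt_of_le_of_ne bot_le (fun h => hne.ne ?_)
        rw [← hcm P hle, ← h, ← RingHom.ker_eq_comap_bot, Ideal.mk_ker]
      have l2 : P.map (Ideal.Quotient.mk P₀) < (maximalIdeal E).map (Ideal.Quotient.mk P₀) := by
        refine lt_of_le_of_ne (Ideal.map_mono hlt.le) (fun h => hlt.ne ?_)
        rw [← hcm P hle, h, hcm _ (le_maximalIdeal hP₀p.ne_top)]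
      have b1 : (⊥ : Ideal (E ⧸ P₀)).height + 1 ≤ (P.map (Ideal.Quotient.mk P₀)).height :=
        Ideal.height_add_one_le_of_lt_of_isPrime l1
      have b2 : (P.map (Ideal.Quotient.mk P₀)).height + 1 ≤
          ((maximalIdeal E).map (Ideal.Quotient.mk P₀)).height :=
        Ideal.height_add_one_le_of_lt_of_isPrime l2
      have b3 : ((2 : ℕ) : ℕ∞) ≤ ((1 : ℕ) : ℕ∞) := by
        calc ((2 : ℕ) : ℕ∞) ≤ (⊥ : Ideal (E ⧸ P₀)).height + 1 + 1 := by
              rw [add_assoc]; exact le_add_left (by norm_num)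
          _ ≤ _ := (add_le_add_left b1 1).trans (b2.trans hht)
      norm_cast at b3
  have hav : ∃ w ∈ maximalIdeal E, (∀ P ∈ I.minimalPrimes, w ∉ P) ∧
      (∀ P ∈ J.minimalPrimes, w ∉ P) := by
    by_contra! hcon
    have hfin : (I.minimalPrimes ∪ J.minimalPrimes).Finite :=
      (I.finite_minimalPrimes_of_isNoetherianRing E).union
        (J.finite_minimalPrimes_of_isNoetherianRing E)
    have hp : ∀ P ∈ hfin.toFinset, P.IsPrime := fun P hP => by
      rcases hfin.mem_toFinset.1 hP with h | h <;> exact h.1.1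
    have hsub : ((maximalIdeal E : Ideal E) : Set E) ⊆
        ⋃ P ∈ (hfin.toFinset : Set (Ideal E)), ((id P : Ideal E) : Set E) := fun w hw => by
      simp only [Set.mem_iUnion, Set.Finite.coe_toFinset, id]
      by_cases h : ∀ P ∈ I.minimalPrimes, w ∉ P
      · obtain ⟨P, hP, hwP⟩ := hcon w hw h
        exact ⟨P, Or.inr hP, hwP⟩
      · push Not at h
        obtain ⟨P, hP, hwP⟩ := h
        exact ⟨P, Or.inl hP, hwP⟩
    obtain ⟨P, hP, hle⟩ := (Ideal.subset_union_prime (f := id) ⊥ ⊥ (fun P hP _ _ => hp P hP)).1 hsub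
    have hPm : P = maximalIdeal E := le_antisymm (le_maximalIdeal (hp P hP).ne_top) hle
    have key : ∀ (K : Ideal E) (c : E), (K ⊔ Ideal.span {c}).radical = maximalIdeal E →
        P ∈ K.minimalPrimes → K.radical = maximalIdeal E := fun K c hc hPK => by
      have hKm : K ≤ maximalIdeal E := by rw [← hc]; exact le_sup_left.trans Ideal.le_radical
      refine le_antisymm ((maximalIdeal.isMaximal E).isPrime.radical_le_iff.2 hKm) ?_
      rw [Ideal.radical_eq_sInf]
      refine le_sInf ?_
      rintro Q ⟨hQ, hQp⟩
      rw [← hPm]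
      exact hPK.2 ⟨hQp, hQ⟩ (hPm ▸ le_maximalIdeal hQp.ne_top)
    rcases hfin.mem_toFinset.1 hP with h | h
    · exact hI (key I a ha h)
    · exact hJ (key J b hb h)
  obtain ⟨w, hw, h1, h2⟩ := hav
  exact ⟨w, aux I a ha w hw h1, aux J b hb w hw h2⟩

/-- Regularity of one system of parameters implies regularity of all of them. -/
theorem RegMod.of_radical_eq {E C : Type*} [CommRing E] [IsNoetherianRing E] [IsLocalRing E]
    [CommRing C] (φ : E →+* C) (hdc : ∀ a ∈ maximalIdeal E, DComplete (φ a) C) {n : ℕ}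
    (hn : ∀ z : List E, (Ideal.ofList z).radical = maximalIdeal E → n ≤ z.length)
    (x y : List E) (hxn : x.length = n) (hyn : y.length = n)
    (hx : (Ideal.ofList x).radical = maximalIdeal E)
    (hy : (Ideal.ofList y).radical = maximalIdeal E) (hreg : RegMod ⊥ (x.map φ)) :
    RegMod ⊥ (y.map φ) := by
  suffices H : ∀ (d : ℕ) (u x y : List E), x.length = d → y.length = d → u.length + d = n →
      (Ideal.ofList (u ++ x)).radical = maximalIdeal E →
      (Ideal.ofList (u ++ y)).radical = maximalIdeal E →
      RegMod (Ideal.ofList (u.map φ)) (x.map φ) → RegMod (Ideal.ofList (u.map φ)) (y.map φ) from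
    by simpa using H n [] x y hxn hyn (by simp) (by simpa) (by simpa) (by simpa)
  clear hreg hx hy hxn hyn x y
  intro d
  induction d with
  | zero =>
    intro u x y hx hy _ _ _ _
    rw [List.length_eq_zero_iff.1 hy]; trivial
  | succ d ih =>
    intro u x y hx hy hud hxr hyr hreg
    obtain ⟨x, a, rfl⟩ : ∃ x' a, x = x' ++ [a] :=
      ⟨x.dropLast, x.getLast (by rintro rfl; simp at hx), (List.dropLast_append_getLast _).symm⟩
    obtain ⟨y, b, rfl⟩ : ∃ y' b, y = y' ++ [b] :=
      ⟨y.dropLast, y.getLast (by rintro rfl; simp at hy), (List.dropLast_append_getLast _).symm⟩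
    simp only [List.length_append, List.length_singleton, Nat.add_right_cancel_iff] at hx hy
    have hxr' : (Ideal.ofList (u ++ x) ⊔ Ideal.span {a}).radical = maximalIdeal E := by
      rw [← hxr]; simp [sup_assoc]
    have hyr' : (Ideal.ofList (u ++ y) ⊔ Ideal.span {b}).radical = maximalIdeal E := by
      rw [← hyr]; simp [sup_assoc]
    obtain ⟨w, hwx, hwy⟩ := exists_radical_sup_span_eq hxr' hyr'
      (fun h => by have := hn _ h; simp at this; omega)
      (fun h => by have := hn _ h; simp at this; omega)
    have memx : ∀ c ∈ u ++ x, DComplete (φ c) C := fun c hc => hdc c (by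
      rw [← hwx]; exact Ideal.le_radical (Ideal.mem_sup_left (Ideal.subset_span hc)))
    have memy : ∀ c ∈ u ++ y, DComplete (φ c) C := fun c hc => hdc c (by
      rw [← hwy]; exact Ideal.le_radical (Ideal.mem_sup_left (Ideal.subset_span hc)))
    have memw : DComplete (φ w) C := hdc w (by
      rw [← hwy]; exact Ideal.le_radical (Ideal.mem_sup_right (Ideal.subset_span rfl)))
    have hfg : (Ideal.ofList (u.map φ)).FG := by
      classical exact ⟨(u.map φ).toFinset, by simp [Ideal.ofList]⟩
    have mapmem : ∀ (l : List E) (c : E), (Ideal.ofList l).radical = maximalIdeal E →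
        c ∈ maximalIdeal E → ∃ k, φ c ^ k ∈ Ideal.ofList (l.map φ) := fun l c hl hc => by
      rw [← hl] at hc
      obtain ⟨k, hk⟩ := hc
      exact ⟨k, by rw [← _root_.map_pow, ← Ideal.map_ofList]; exact Ideal.mem_map_of_mem φ hk⟩
    have ham : a ∈ maximalIdeal E := by
      rw [← hxr']; exact Ideal.le_radical (Ideal.mem_sup_right (Ideal.subset_span rfl))
    have hwm : w ∈ maximalIdeal E := by
      rw [← hwx]; exact Ideal.le_radical (Ideal.mem_sup_right (Ideal.subset_span rfl))
    have r1 : RegMod (Ideal.ofList (u.map φ)) (x.map φ ++ [φ w]) := by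
      obtain ⟨k, hk⟩ := mapmem (u ++ x ++ [w]) a (by rw [← hwx]; simp [sup_assoc]) ham
      exact RegMod.exchange_last (x := φ a) (n := k) (by simpa using hreg)
        (by simpa [sup_assoc] using hk)
    have r2 := r1.perm (l' := φ w :: x.map φ) (List.perm_append_singleton _ _) hfg
      (fun c hc => by
        simp only [List.mem_append, List.mem_map, List.mem_singleton] at hc
        rcases hc with ⟨e, he, rfl⟩ | rfl
        · exact memx e (by simp [he])
        · exact memw)
    have r3 : RegMod (Ideal.ofList (u.map φ) ⊔ Ideal.span {φ w}) (y.map φ) := by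
      have := ih (u ++ [w]) x y hx hy (by simp; omega)
        (by rw [← hwx]; simp [sup_assoc, sup_comm])
        (by rw [← hwy]; simp [sup_assoc, sup_comm])
        (by simpa using r2.2)
      simpa using this
    have r4 : RegMod (Ideal.ofList (u.map φ)) (φ w :: y.map φ) := ⟨r2.1, r3⟩
    have r5 := r4.perm (l' := y.map φ ++ [φ w]) (List.perm_append_singleton _ _).symm hfg
      (fun c hc => by
        simp only [List.mem_cons, List.mem_map] at hc
        rcases hc with rfl | ⟨e, he, rfl⟩
        · exact memw
        · exact memy e (by simp [he]))
    obtain ⟨k, hk⟩ := mapmem (u ++ y ++ [b]) w (by rw [← hyr']; simp [sup_assoc]) hwm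
    rw [List.map_append, List.map_singleton]
    exact RegMod.exchange_last (x := φ w) (n := k) r5 (by simpa [sup_assoc] using hk)

end

section

open MvPolynomial in
/-- Substituting a fresh variable for `X v`. -/
noncomputable def MvPolynomial.freshHom {σ T : Type*} [CommRing T] [DecidableEq σ] (v : σ) :
    MvPolynomial σ T →+* Polynomial (MvPolynomial σ T) :=
  eval₂Hom (Polynomial.C.comp C) fun u => if u = v then Polynomial.X else Polynomial.C (X u)

namespace Triangular

theorem monic_mul_mem {D : Type*} [CommRing D] {I : Ideal D} {f b : Polynomial D} (hf : f.Monic)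
    (h : f * b ∈ I.map Polynomial.C) : b ∈ I.map Polynomial.C := by
  have key : ∀ g : Polynomial D, g ∈ I.map Polynomial.C ↔ g.map (Ideal.Quotient.mk I) = 0 := by
    intro g
    rw [Ideal.mem_map_C_iff, Polynomial.ext_iff]
    simp [Ideal.Quotient.eq_zero_iff_mem]
  rw [key] at h ⊢
  rw [Polynomial.map_mul] at h
  exact (hf.map _).mul_right_eq_zero_iff.1 h

theorem one_mem_of_monic {D : Type*} [CommRing D] {I : Ideal D} {f : Polynomial D} (hf : f.Monic)
    (hd : 0 < f.natDegree) (h : (1 : Polynomial D) ∈ I.map Polynomial.C ⊔ Ideal.span {f}) :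
    (1 : D) ∈ I := by
  obtain ⟨c, hc⟩ := RegMod.mem_sup_span.1 h
  have h1 : (1 - f * c).map (Ideal.Quotient.mk I) = 0 := by
    rw [Ideal.mem_map_C_iff] at hc
    ext k
    rw [Polynomial.coeff_map, Ideal.Quotient.eq_zero_iff_mem.2 (hc k), Polynomial.coeff_zero]
  by_contra hI
  have : Nontrivial (D ⧸ I) := Ideal.Quotient.nontrivial_iff.2 fun h => hI (h ▸ trivial)
  rw [Polynomial.map_sub, Polynomial.map_one, Polynomial.map_mul, sub_eq_zero] at h1
  have h2 := (hf.map (Ideal.Quotient.mk I)).eq_one_of_isUnit (IsUnit.of_mul_eq_one _ h1.symm)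
  have h3 := hf.natDegree_map (Ideal.Quotient.mk I)
  rw [h2, Polynomial.natDegree_one] at h3
  omega

variable {σ T : Type*} [CommRing T]

open MvPolynomial

theorem eval_freshHom [DecidableEq σ] (v : σ) (b : MvPolynomial σ T) :
    (freshHom v b).eval (X v) = b := by
  have : (Polynomial.evalRingHom (X v : MvPolynomial σ T)).comp (freshHom v) = RingHom.id _ := by
    ext u
    · simp [freshHom]
    · by_cases h : u = v <;> simp [freshHom, h]
  exact DFunLike.congr_fun this b

theorem freshHom_of_mem [DecidableEq σ] {v : σ} {s : Set σ} (hs : v ∉ s) {b : MvPolynomial σ T}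
    (hb : b ∈ supported T s) : freshHom v b = Polynomial.C b := by
  rw [supported_eq_adjoin_X] at hb
  induction hb using Algebra.adjoin_induction with
  | mem x hx =>
    obtain ⟨u, hu, rfl⟩ := hx
    have : u ≠ v := fun h => hs (h ▸ hu)
    simp [freshHom, this]
  | algebraMap r => simp [freshHom, MvPolynomial.algebraMap_eq]
  | add x y _ _ h1 h2 => rw [map_add, h1, h2, map_add]
  | mul x y _ _ h1 h2 => rw [map_mul, h1, h2, map_mul]

theorem freshHom_eval [DecidableEq σ] {v : σ} {s : Set σ} (hs : v ∉ s)
    {f : Polynomial (MvPolynomial σ T)} (hf : ∀ n, f.coeff n ∈ supported T s) :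
    freshHom v (f.eval (X v)) = f := by
  rw [Polynomial.eval_eq_sum_range, map_sum]
  conv_rhs => rw [f.as_sum_range_C_mul_X_pow]
  refine Finset.sum_congr rfl fun n _ => ?_
  rw [map_mul, freshHom_of_mem hs (hf n), map_pow]
  simp [freshHom]

variable [LinearOrder σ]

/-- A family of elements `e v` such that `e v` is, modulo `I`, a monic polynomial in `X v`
with coefficients in smaller variables. -/
structure IsTriangular (I : Ideal T) (e : σ → MvPolynomial σ T) : Prop where
  exists_monic : ∀ v, ∃ f : Polynomial (MvPolynomial σ T), f.Monic ∧ 0 < f.natDegree ∧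
    (∀ n, f.coeff n ∈ supported T {u | u < v}) ∧ e v - f.eval (X v) ∈ I.map C

theorem IsTriangular.mono {I J : Ideal T} (hIJ : I ≤ J) {e : σ → MvPolynomial σ T}
    (h : IsTriangular I e) : IsTriangular J e := by
  refine ⟨fun v => ?_⟩
  obtain ⟨f, h1, h2, h3, h4⟩ := h.exists_monic v
  exact ⟨f, h1, h2, h3, Ideal.map_mono hIJ h4⟩

theorem sup_span_congr {P : Type*} [CommRing P] {I : Ideal P} {a b : P} (h : a - b ∈ I) :
    I ⊔ Ideal.span {a} = I ⊔ Ideal.span {b} := by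
  have aux : ∀ a b : P, a - b ∈ I → I ⊔ Ideal.span {a} ≤ I ⊔ Ideal.span {b} := fun a b h =>
    sup_le le_sup_left ((Ideal.span_singleton_le_iff_mem _).2
      (RegMod.mem_sup_span.2 ⟨1, by simpa using h⟩))
  exact le_antisymm (aux a b h) (aux b a (by rw [← neg_sub]; exact neg_mem h))

theorem sup_image_insert {P : Type*} [CommRing P] (I : Ideal P) (e : σ → P) (v : σ) (J : Finset σ) :
    I ⊔ Ideal.span (e '' (insert v J : Finset σ)) = I ⊔ Ideal.span (e '' J) ⊔ Ideal.span {e v} := by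
  rw [Finset.coe_insert, Set.image_insert_eq, Ideal.span_insert, sup_comm (Ideal.span {e v}),
    sup_assoc]

theorem sup_image_congr {P : Type*} [CommRing P] {I : Ideal P} {e g : σ → P}
    (h : ∀ v, e v - g v ∈ I) (J : Finset σ) :
    I ⊔ Ideal.span (e '' J) = I ⊔ Ideal.span (g '' J) := by
  induction J using Finset.induction_on with
  | empty => simp
  | insert v J _ ih =>
    rw [sup_image_insert, sup_image_insert, ih]
    exact sup_span_congr (Ideal.mem_sup_left (h v))

theorem map_freshHom_le (I : Ideal T) {g : σ → MvPolynomial σ T} {v : σ} {J : Finset σ}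
    (hg : ∀ u ∈ J, g u ∈ supported T {w | w < v}) :
    (I.map C ⊔ Ideal.span (g '' J)).map (freshHom v) ≤
      (I.map C ⊔ Ideal.span (g '' J)).map Polynomial.C := by
  rw [Ideal.map_sup, Ideal.map_map, Ideal.map_span, sup_le_iff, Ideal.map_le_iff_le_comap,
    Ideal.span_le]
  constructor
  · intro r hr
    rw [Ideal.mem_comap]
    have : (freshHom v).comp C r = Polynomial.C (C r : MvPolynomial σ T) := by simp [freshHom]
    rw [this]
    exact Ideal.mem_map_of_mem _ (Ideal.mem_sup_left (Ideal.mem_map_of_mem _ hr))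
  · rintro _ ⟨_, ⟨u, hu, rfl⟩, rfl⟩
    rw [freshHom_of_mem (s := {w | w < v}) (by simp) (hg u hu)]
    exact Ideal.mem_map_of_mem _ (Ideal.mem_sup_right (Ideal.subset_span ⟨u, hu, rfl⟩))

theorem IsTriangular.exists_normal {I : Ideal T} {e : σ → MvPolynomial σ T}
    (h : IsTriangular I e) : ∃ f : σ → Polynomial (MvPolynomial σ T),
      (∀ v, (f v).Monic) ∧ (∀ v, 0 < (f v).natDegree) ∧
      (∀ v n, (f v).coeff n ∈ supported T {u | u < v}) ∧
      (∀ J : Finset σ, I.map C ⊔ Ideal.span (e '' J) =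
        I.map C ⊔ Ideal.span ((fun v => (f v).eval (X v)) '' J)) ∧
      (∀ u v, u < v → (f u).eval (X u) ∈ supported T {w | w < v}) ∧
      ∀ v, e v - (f v).eval (X v) ∈ I.map C := by
  choose f h1 h2 h3 h4 using h.exists_monic
  refine ⟨f, h1, h2, h3, fun J => sup_image_congr h4 J, fun u v huv => ?_, h4⟩
  rw [Polynomial.eval_eq_sum_range]
  refine sum_mem fun n _ => mul_mem (supported_mono (fun w (hw : w < u) => hw.trans huv) (h3 u n))
    (pow_mem ?_ _)
  rw [supported_eq_adjoin_X]
  exact Algebra.subset_adjoin ⟨u, huv, rfl⟩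

theorem IsTriangular.mul_mem {I : Ideal T} {e : σ → MvPolynomial σ T} (h : IsTriangular I e)
    {J : Finset σ} {v : σ} (hJ : ∀ u ∈ J, u < v) {b : MvPolynomial σ T}
    (hb : e v * b ∈ I.map C ⊔ Ideal.span (e '' J)) : b ∈ I.map C ⊔ Ideal.span (e '' J) := by
  obtain ⟨f, h1, h2, h3, h4, h5, h6⟩ := h.exists_normal
  rw [h4] at hb ⊢
  have h7 : (f v).eval (X v) * b ∈
      I.map C ⊔ Ideal.span ((fun v => (f v).eval (X v)) '' J) := by
    have := sub_mem hb (Ideal.mem_sup_left (Ideal.mul_mem_right b _ (h6 v)))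
    convert this using 1; ring
  have h8 := Ideal.mem_map_of_mem (freshHom v) h7
  have h9 := map_freshHom_le I (fun u hu => h5 u v (hJ u hu)) h8
  rw [map_mul, freshHom_eval (s := {w | w < v}) (by simp) (h3 v)] at h9
  have h10 := Ideal.mem_map_of_mem (Polynomial.evalRingHom (X v)) (monic_mul_mem (h1 v) h9)
  rw [Ideal.map_map] at h10
  simp only [Polynomial.coe_evalRingHom, eval_freshHom] at h10
  convert h10
  have : (Polynomial.evalRingHom (X v : MvPolynomial σ T)).comp Polynomial.C = RingHom.id _ := by
    refine RingHom.ext fun x => by simp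
  rw [this, Ideal.map_id]

theorem IsTriangular.one_mem {I : Ideal T} {e : σ → MvPolynomial σ T} (h : IsTriangular I e)
    {J : Finset σ} (hb : (1 : MvPolynomial σ T) ∈ I.map C ⊔ Ideal.span (e '' J)) :
    (1 : T) ∈ I := by
  induction J using Finset.induction_on_max with
  | empty =>
    rw [Finset.coe_empty, Set.image_empty, Ideal.span_empty, sup_bot_eq] at hb
    simpa using mem_map_C_iff.1 hb 0
  | insert v J hJ ih =>
    refine ih ?_
    obtain ⟨f, h1, h2, h3, h4, h5, h6⟩ := h.exists_normal
    rw [h4, sup_image_insert] at hb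
    rw [h4]
    have h8 := Ideal.mem_map_of_mem (freshHom v) hb
    rw [Ideal.map_sup, Ideal.map_span, Set.image_singleton,
      freshHom_eval (s := {w | w < v}) (by simp) (h3 v), map_one] at h8
    exact one_mem_of_monic (h1 v) (h2 v)
      (sup_le_sup_right (map_freshHom_le I (fun u hu => h5 u v (hJ u hu))) _ h8)

theorem IsTriangular.C_mul_mem_finset {I : Ideal T} {r : T} {e : σ → MvPolynomial σ T}
    (hr : ∀ b, r * b ∈ I → b ∈ I) (h : IsTriangular (I ⊔ Ideal.span {r}) e) (J : Finset σ)
    (b : MvPolynomial σ T) (hb : C r * b ∈ I.map C ⊔ Ideal.span (e '' J)) :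
    b ∈ I.map C ⊔ Ideal.span (e '' J) := by
  induction J using Finset.induction_on_max generalizing b with
  | empty =>
    rw [Finset.coe_empty, Set.image_empty, Ideal.span_empty, sup_bot_eq, mem_map_C_iff] at hb ⊢
    exact fun m => hr _ (by simpa using hb m)
  | insert v J hJ ih =>
    rw [sup_image_insert] at hb ⊢
    refine RegMod.comm_left ih (fun c hc => ?_) b hb
    have key : I.map C ⊔ Ideal.span (e '' J) ⊔ Ideal.span {(C r : MvPolynomial σ T)} =
        (I ⊔ Ideal.span {r}).map C ⊔ Ideal.span (e '' J) := by
      rw [Ideal.map_sup, Ideal.map_span, Set.image_singleton, sup_right_comm]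
    rw [key] at hc ⊢
    exact h.mul_mem hJ hc

theorem exists_finset_of_mem {P : Type*} [CommRing P] (I : Ideal P) (e : σ → P) {b : P}
    (hb : b ∈ I ⊔ Ideal.span (Set.range e)) :
    ∃ J : Finset σ, b ∈ I ⊔ Ideal.span (e '' J) := by
  obtain ⟨x, hx, y, hy, rfl⟩ := Submodule.mem_sup.1 hb
  obtain ⟨J, hJ⟩ := Finsupp.mem_ideal_span_range_iff_exists_finsupp.1 hy
  refine ⟨J.support, add_mem (Ideal.mem_sup_left hx) (Ideal.mem_sup_right ?_)⟩
  rw [← hJ]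
  exact sum_mem fun u hu => Ideal.mul_mem_left _ _ (Ideal.subset_span ⟨u, hu, rfl⟩)

theorem IsTriangular.C_mul_mem {I : Ideal T} {r : T} {e : σ → MvPolynomial σ T}
    (hr : ∀ b, r * b ∈ I → b ∈ I) (h : IsTriangular (I ⊔ Ideal.span {r}) e)
    (b : MvPolynomial σ T) (hb : C r * b ∈ I.map C ⊔ Ideal.span (Set.range e)) :
    b ∈ I.map C ⊔ Ideal.span (Set.range e) := by
  obtain ⟨J, hJ⟩ := exists_finset_of_mem _ e hb
  exact (sup_le_sup_left (Ideal.span_mono (Set.image_subset_range _ _)) _ :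
    I.map C ⊔ Ideal.span (e '' J) ≤ _) (C_mul_mem_finset hr h J b hJ)

/-- Regular sequences survive dividing a polynomial ring by a triangular system. -/
theorem IsTriangular.regMod {I : Ideal T} {l : List T} {e : σ → MvPolynomial σ T}
    (hl : RegMod I l) (h : ∀ r ∈ l.head?, IsTriangular (I ⊔ Ideal.span {r}) e) :
    RegMod (I.map C ⊔ Ideal.span (Set.range e)) (l.map C) := by
  induction l generalizing I with
  | nil => trivial
  | cons r l ih =>
    refine ⟨C_mul_mem hl.1 (h r (by simp)), ?_⟩
    have := ih hl.2 (fun s _ => (h r (by simp)).mono le_sup_left)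
    rwa [Ideal.map_sup, Ideal.map_span, Set.image_singleton, sup_right_comm] at this

theorem IsTriangular.one_mem_of_range {I : Ideal T} {e : σ → MvPolynomial σ T}
    (h : IsTriangular I e)
    (hb : (1 : MvPolynomial σ T) ∈ I.map C ⊔ Ideal.span (Set.range e)) : (1 : T) ∈ I := by
  obtain ⟨J, hJ⟩ := exists_finset_of_mem _ e hb
  exact h.one_mem hJ

end Triangular

end

section

namespace PerfectedRegular

variable {N M : Type*} [CommRing N] [CommRing M] (p : ℕ) [Fact p.Prime] [CharP N p] [CharP M p]

theorem pow_mem_ofList_map {l : List N} {b : N} (hb : b ∈ Ideal.ofList l) (k : ℕ) :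
    b ^ p ^ k ∈ Ideal.ofList (l.map (· ^ p ^ k)) := by
  have := Ideal.mem_map_of_mem (iterateFrobenius N p k) hb
  rw [Ideal.map_ofList, iterateFrobenius_def] at this
  convert this using 3
  ext x; rw [iterateFrobenius_def]

variable (i : N →+* M) [IsPRadical i p]

theorem exists_of_mem {l : List N} {b : M} (hb : b ∈ Ideal.ofList (l.map i)) :
    ∃ m, ∀ k ≥ m, ∃ c, i c = b ^ p ^ k ∧ c ∈ Ideal.ofList (l.map (· ^ p ^ k)) := by
  rw [Ideal.ofList] at hb
  induction hb using Submodule.span_induction with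
  | mem x hx =>
    obtain ⟨y, hy, rfl⟩ := List.mem_map.1 hx
    exact ⟨0, fun k _ => ⟨y ^ p ^ k, by simp, Ideal.subset_span
      (List.mem_map.2 ⟨y, hy, rfl⟩)⟩⟩
  | zero => exact ⟨0, fun k _ => ⟨0, by simp [(Fact.out : p.Prime).ne_zero], zero_mem _⟩⟩
  | add x y _ _ hx hy =>
    obtain ⟨m, hm⟩ := hx
    obtain ⟨m', hm'⟩ := hy
    refine ⟨max m m', fun k hk => ?_⟩
    obtain ⟨c, hc, hc'⟩ := hm k (le_of_max_le_left hk)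
    obtain ⟨d, hd, hd'⟩ := hm' k (le_of_max_le_right hk)
    exact ⟨c + d, by rw [map_add, hc, hd, add_pow_char_pow], add_mem hc' hd'⟩
  | smul a x _ hx =>
    obtain ⟨m, hm⟩ := hx
    obtain ⟨n, d, hd⟩ := IsPRadical.pow_mem i p a
    refine ⟨max m n, fun k hk => ?_⟩
    obtain ⟨c, hc, hc'⟩ := hm k (le_of_max_le_left hk)
    refine ⟨d ^ p ^ (k - n) * c, ?_, Ideal.mul_mem_left _ _ hc'⟩
    rw [map_mul, map_pow, hd, hc, smul_eq_mul, mul_pow, ← pow_mul, ← pow_add,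
      Nat.add_sub_cancel' (le_of_max_le_right hk)]

theorem mem_of_exists [PerfectRing M p] {l : List N} {b : M} {k : ℕ} {c : N} (h : i c = b ^ p ^ k)
    (hc : c ∈ Ideal.ofList (l.map (· ^ p ^ k))) : b ∈ Ideal.ofList (l.map i) := by
  have h1 := Ideal.mem_map_of_mem i hc
  have h2 : (Ideal.ofList (l.map (· ^ p ^ k))).map i =
      (Ideal.ofList (l.map i)).map (iterateFrobeniusEquiv M p k) := by
    rw [Ideal.map_ofList]
    erw [Ideal.map_ofList]
    congr 1
    simp [iterateFrobenius_def]
  rw [h2, h, ← iterateFrobeniusEquiv_def] at h1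
  exact (Ideal.mem_map_of_equiv _ _).1 h1 |>.elim fun x hx =>
    (iterateFrobeniusEquiv M p k).injective hx.2 ▸ hx.1

theorem one_mem [PerfectRing M p] {l : List N} (h : (1 : M) ∈ Ideal.ofList (l.map i)) :
    (1 : N) ∈ Ideal.ofList l := by
  obtain ⟨m, hm⟩ := exists_of_mem p i h
  obtain ⟨c, hc, hc'⟩ := hm m le_rfl
  have h2 : c - 1 ∈ pNilradical N p := IsPRadical.ker_le (i := i) (p := p) (by
    rw [RingHom.mem_ker, map_sub, hc, map_one, one_pow, sub_self])
  obtain ⟨s, hs⟩ := mem_pNilradical.1 h2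
  rw [sub_pow_char_pow, one_pow, sub_eq_zero] at hs
  rw [← hs]
  have := pow_mem_ofList_map p hc' s
  have hle : Ideal.ofList ((l.map (· ^ p ^ m)).map (· ^ p ^ s)) ≤ Ideal.ofList l := by
    refine Ideal.span_le.2 fun x hx => ?_
    obtain ⟨y, hy, rfl⟩ := List.mem_map.1 hx
    obtain ⟨z, hz, rfl⟩ := List.mem_map.1 hy
    simp only [← pow_mul]
    exact Ideal.pow_mem_of_mem _ (Ideal.subset_span (s := {r | r ∈ l}) hz) _
      (mul_pos (pow_pos (Fact.out : p.Prime).pos _) (pow_pos (Fact.out : p.Prime).pos _))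
  exact hle this

theorem regMod [PerfectRing M p] {l₀ l : List N} (h : RegMod ⊥ (l₀ ++ l)) :
    RegMod (Ideal.ofList (l₀.map i)) (l.map i) := by
  induction l generalizing l₀ with
  | nil => trivial
  | cons r l ih =>
    refine ⟨fun b hb => ?_, ?_⟩
    · obtain ⟨m, hm⟩ := exists_of_mem p i hb
      obtain ⟨n, b1, hb1⟩ := IsPRadical.pow_mem i p b
      obtain ⟨c, hc, hc'⟩ := hm (m + n) (by omega)
      have h1 : c - r ^ p ^ (m + n) * b1 ^ p ^ m ∈ pNilradical N p :=
        IsPRadical.ker_le (i := i) (p := p) (by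
          rw [RingHom.mem_ker, map_sub, hc, map_mul, map_pow, map_pow, hb1, mul_pow, ← pow_mul,
            ← pow_add, add_comm m n, sub_self])
      obtain ⟨s, hs⟩ := mem_pNilradical.1 h1
      rw [sub_pow_char_pow, sub_eq_zero, mul_pow, ← pow_mul, ← pow_mul, ← pow_add,
        ← pow_add] at hs
      have h2 := pow_mem_ofList_map p hc' s
      have h3 : (l₀.map (· ^ p ^ (m + n))).map (· ^ p ^ s) = l₀.map (· ^ p ^ (m + n + s)) := by
        simp [pow_add, pow_mul]
      rw [hs, h3] at h2
      have h5 := RegMod.map_pow h (p ^ (m + n + s))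
      rw [List.map_append, RegMod.append, List.map_cons, bot_sup_eq] at h5
      have h4 := h5.2.1 (b1 ^ p ^ (m + s)) h2
      refine mem_of_exists p i (k := m + n + s) (c := b1 ^ p ^ (m + s)) ?_ h4
      rw [map_pow, hb1, ← pow_mul, ← pow_add]
      congr 2; ring
    · have := ih (l₀ := l₀ ++ [r]) (by simpa using h)
      simpa using this

end PerfectedRegular

end

section

open MvPolynomial WittVector

namespace Andre

/-- Witt vectors with all components in a given subring. -/
noncomputable def wittSubring (p : ℕ) [Fact p.Prime] {P : Type*} [CommRing P] (S : Subring P) :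
    Subring (WittVector p P) :=
  (WittVector.map S.subtype).range

theorem mem_wittSubring {p : ℕ} [Fact p.Prime] {P : Type*} [CommRing P] {S : Subring P}
    {x : WittVector p P} : x ∈ wittSubring p S ↔ ∀ n, x.coeff n ∈ S := by
  constructor
  · rintro ⟨y, rfl⟩ n
    rw [map_coeff]
    exact (y.coeff n).2
  · intro h
    refine ⟨WittVector.mk p fun n => ⟨x.coeff n, h n⟩, ?_⟩
    ext n
    rw [map_coeff]
    rfl

theorem teichmuller_mem {p : ℕ} [Fact p.Prime] {P : Type*} [CommRing P] {S : Subring P} {x : P}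
    (hx : x ∈ S) : teichmuller p x ∈ wittSubring p S :=
  ⟨teichmuller p ⟨x, hx⟩, by rw [map_teichmuller]; rfl⟩

theorem coeff_sub_mem {p : ℕ} [Fact p.Prime] {P : Type*} [CommRing P] {I : Ideal P}
    {x y : WittVector p P}
    (h : WittVector.map (Ideal.Quotient.mk I) x = WittVector.map (Ideal.Quotient.mk I) y) (n : ℕ) :
    x.coeff n - y.coeff n ∈ I := by
  rw [← Ideal.Quotient.eq, ← map_coeff, h, map_coeff]

variable (p : ℕ) [Fact p.Prime] {T : Type*} [CommRing T] (t : T) {ι : Type*} [LinearOrder ι]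
  (F : ι → Polynomial (MvPolynomial ι (WittVector p T)))

/-- Substitute Teichmüller lifts of the variables `X (j, 0)`. -/
noncomputable def subst : MvPolynomial ι (WittVector p T) →+*
    WittVector p (MvPolynomial (ι ×ₗ ℕ) T) :=
  eval₂Hom (WittVector.map C) fun j => teichmuller p (X (toLex (j, 0)))

noncomputable def value (i : ι) : WittVector p (MvPolynomial (ι ×ₗ ℕ) T) :=
  ((F i).map (subst p)).eval (teichmuller p (X (toLex (i, 0))))

noncomputable def correction (i : ι) : WittVector p (MvPolynomial (ι ×ₗ ℕ) T) :=
  WittVector.mk p fun n => X (toLex (i, n + 1))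

/-- Equations expressing `value i + [t] * correction i = p * correction i`. -/
noncomputable def relation (v : ι ×ₗ ℕ) : MvPolynomial (ι ×ₗ ℕ) T :=
  match (ofLex v).2 with
  | 0 => (value p F (ofLex v).1 + teichmuller p (C t) * correction p (ofLex v).1).coeff 0
  | n + 1 => X v ^ p -
      (value p F (ofLex v).1 + teichmuller p (C t) * correction p (ofLex v).1).coeff (n + 1)

theorem subst_mem {s : Set ι} {q : MvPolynomial ι (WittVector p T)}
    (hq : q ∈ supported (WittVector p T) s) :
    subst p q ∈ wittSubring p
      (supported T {u : ι ×ₗ ℕ | (ofLex u).1 ∈ s ∧ (ofLex u).2 = 0}).toSubring := by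
  rw [supported_eq_adjoin_X] at hq
  induction hq using Algebra.adjoin_induction with
  | mem x hx =>
    obtain ⟨j, hj, rfl⟩ := hx
    rw [subst, coe_eval₂Hom, eval₂_X]
    exact teichmuller_mem (Algebra.subset_adjoin ⟨toLex (j, 0), ⟨hj, rfl⟩, rfl⟩)
  | algebraMap r =>
    rw [subst, MvPolynomial.algebraMap_eq, coe_eval₂Hom, eval₂_C, mem_wittSubring]
    intro n
    rw [map_coeff]
    exact Subalgebra.algebraMap_mem _ _
  | add x y _ _ h1 h2 => rw [map_add]; exact add_mem h1 h2
  | mul x y _ _ h1 h2 => rw [map_mul]; exact mul_mem h1 h2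

variable {p F}

theorem value_mem {i : ι} (hF : ∀ n, (F i).coeff n ∈ supported (WittVector p T) {j | j < i}) :
    value p F i ∈ wittSubring p
      (supported T {u : ι ×ₗ ℕ | (ofLex u).1 ≤ i ∧ (ofLex u).2 = 0}).toSubring := by
  rw [value, Polynomial.eval_eq_sum_range]
  have hX : (X (toLex (i, 0)) : MvPolynomial (ι ×ₗ ℕ) T) ∈
      (supported T {u : ι ×ₗ ℕ | (ofLex u).1 ≤ i ∧ (ofLex u).2 = 0}).toSubring :=
    Algebra.subset_adjoin ⟨toLex (i, 0), ⟨le_refl i, rfl⟩, rfl⟩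
  have hle : (supported T {u : ι ×ₗ ℕ | (ofLex u).1 ∈ {j | j < i} ∧ (ofLex u).2 = 0}) ≤
      supported T {u : ι ×ₗ ℕ | (ofLex u).1 ≤ i ∧ (ofLex u).2 = 0} :=
    supported_mono (fun u hu => ⟨le_of_lt hu.1, hu.2⟩)
  refine sum_mem fun n _ => mul_mem ?_ (pow_mem (teichmuller_mem hX) n)
  rw [Polynomial.coeff_map, mem_wittSubring]
  exact fun m => hle (mem_wittSubring.1 (subst_mem p (hF n)) m)

theorem coeff_add_sub_mem (i : ι) (n : ℕ) :
    (value p F i + teichmuller p (C t) * correction p i).coeff n - (value p F i).coeff n ∈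
      (Ideal.span {t}).map (C : T →+* MvPolynomial (ι ×ₗ ℕ) T) := by
  refine coeff_sub_mem ?_ n
  have : Ideal.Quotient.mk ((Ideal.span {t}).map (C : T →+* MvPolynomial (ι ×ₗ ℕ) T)) (C t) = 0 :=
    Ideal.Quotient.eq_zero_iff_mem.2 (Ideal.mem_map_of_mem _ (Ideal.mem_span_singleton_self t))
  rw [map_add, map_mul, map_teichmuller, this, teichmuller_zero, zero_mul, add_zero]

theorem isTriangular [Nontrivial T] (hm : ∀ i, (F i).Monic) (hd : ∀ i, 0 < (F i).natDegree)
    (hF : ∀ i n, (F i).coeff n ∈ supported (WittVector p T) {j | j < i}) :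
    Triangular.IsTriangular (Ideal.span {t}) (relation p t F) := by
  refine ⟨fun v => ?_⟩
  obtain ⟨⟨i, n⟩, rfl⟩ := toLex.surjective v
  rcases n with _ | n
  · refine ⟨((F i).map (subst p)).map WittVector.constantCoeff, ((hm i).map _).map _, ?_, fun n => ?_, ?_⟩
    · rw [Polynomial.map_map, (hm i).natDegree_map]
      exact hd i
    · rw [Polynomial.coeff_map, Polynomial.coeff_map]
      refine supported_mono ?_ (mem_wittSubring.1 (subst_mem p (hF i n)) 0)
      rintro u ⟨hu, -⟩
      exact Prod.Lex.lt_iff.2 (Or.inl hu)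
    · have h := coeff_add_sub_mem (p := p) (F := F) t i 0
      have h2 : (value p F i).coeff 0 =
          (((F i).map (subst p)).map WittVector.constantCoeff).eval (X (toLex (i, 0))) := by
        have := Polynomial.eval₂_at_apply (p := (F i).map (subst p)) WittVector.constantCoeff
          (teichmuller p (X (toLex (i, 0)) : MvPolynomial (ι ×ₗ ℕ) T))
        rw [← Polynomial.eval_map] at this
        rw [value, ← constantCoeff_apply, ← this, constantCoeff_apply, teichmuller_coeff_zero]
      rw [← h2]
      exact h
  · refine ⟨Polynomial.X ^ p - Polynomial.C ((value p F i).coeff (n + 1)),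
      Polynomial.monic_X_pow_sub_C _ (Fact.out : p.Prime).ne_zero, ?_, fun m => ?_, ?_⟩
    · rw [Polynomial.natDegree_X_pow_sub_C]
      exact (Fact.out : p.Prime).pos
    · have h1 : (value p F i).coeff (n + 1) ∈ supported T {u | u < toLex (i, n + 1)} := by
        refine supported_mono ?_ (mem_wittSubring.1 (value_mem (hF i)) (n + 1))
        rintro u ⟨hu, hu'⟩
        refine Prod.Lex.lt_iff.2 ?_
        rcases hu.lt_or_eq with h | h
        · exact Or.inl h
        · exact Or.inr ⟨h, by rw [hu']; exact Nat.succ_pos n⟩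
      rw [Polynomial.coeff_sub, Polynomial.coeff_X_pow, Polynomial.coeff_C]
      refine sub_mem ?_ ?_
      · split_ifs; exacts [one_mem _, zero_mem _]
      · split_ifs; exacts [h1, zero_mem _]
    · have h := coeff_add_sub_mem (p := p) (F := F) t i (n + 1)
      rw [← neg_mem_iff] at h
      convert h using 1
      simp only [Polynomial.eval_sub, Polynomial.eval_pow, Polynomial.eval_X, Polynomial.eval_C]
      change X (toLex (i, n + 1)) ^ p - (value p F i + teichmuller p (C t) * correction p i).coeff
        (n + 1) - _ = _
      ring

end Andre

end

section

open MvPolynomial WittVector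

namespace Andre

universe u

/-- Over a perfect ring `T` of characteristic `p` with an element `t`, any triangular family of
monic equations over `𝕎 T / (p - [t])` becomes solvable after an extension preserving regular
sequences starting with `t`. -/
theorem exists_extension (p : ℕ) [Fact p.Prime] {T : Type u} [CommRing T] [Nontrivial T] [CharP T p]
    (t : T) (ht : (1 : T) ∉ Ideal.span {t}) {ι : Type u} [LinearOrder ι]
    (F : ι → Polynomial (MvPolynomial ι (WittVector p T)))
    (hm : ∀ i, (F i).Monic) (hd : ∀ i, 0 < (F i).natDegree)
    (hF : ∀ i n, (F i).coeff n ∈ supported (WittVector p T) {j | j < i}) :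
    ∃ (T' : Type u) (_ : CommRing T') (_ : CharP T' p) (_ : PerfectRing T' p) (φ : T →+* T'),
      (∀ l, RegMod ⊥ (t :: l) → RegMod ⊥ ((t :: l).map φ)) ∧
      (∀ l, (1 : T') ∈ Ideal.ofList ((t :: l).map φ) → (1 : T) ∈ Ideal.ofList (t :: l)) ∧
      ∃ y : ι → T', ∀ i, (p : WittVector p T') - teichmuller p (φ t) ∣
        ((F i).map (eval₂Hom (WittVector.map φ) fun j => teichmuller p (y j))).eval
          (teichmuller p (y i)) := by
  have tri := isTriangular t hm hd hF
  let 𝔞 : Ideal (MvPolynomial (ι ×ₗ ℕ) T) := Ideal.span (Set.range (relation p t F))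
  let N := MvPolynomial (ι ×ₗ ℕ) T ⧸ 𝔞
  have hone : ∀ I : Ideal T, Ideal.span {t} ≤ I → (1 : T) ∉ I →
      (1 : N) ∉ I.map ((Ideal.Quotient.mk 𝔞).comp C) := by
    intro I hI h1 h
    apply h1
    refine (tri.mono hI).one_mem_of_range ?_
    rw [← Ideal.map_map, ← map_one (Ideal.Quotient.mk 𝔞),
      ← Ideal.mem_comap, Ideal.comap_map_of_surjective _ Ideal.Quotient.mk_surjective,
      ← RingHom.ker_eq_comap_bot, Ideal.mk_ker] at h
    exact h
  have hN : Nontrivial N := by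
    refine ⟨⟨1, 0, fun h => hone _ le_rfl ht (h ▸ zero_mem _)⟩⟩
  have hchar : CharP N p := by
    rw [CharP.charP_iff_prime_eq_zero (Fact.out : p.Prime)]
    have : (p : T) = 0 := CharP.cast_eq_zero T p
    have h2 := congrArg ((Ideal.Quotient.mk 𝔞).comp C) this
    rwa [map_natCast, map_zero] at h2
  let π : T →+* N := (Ideal.Quotient.mk 𝔞).comp C
  let i : N →+* PerfectClosure N p := PerfectClosure.of N p
  have : IsPRadical i p := PerfectClosure.isPRadical N p
  refine ⟨PerfectClosure N p, inferInstance, inferInstance, inferInstance, i.comp π, ?_, ?_, ?_⟩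
  · intro l hl
    have h1 := Triangular.IsTriangular.regMod (e := relation p t F) hl (by simpa using tri)
    rw [Ideal.map_bot, bot_sup_eq] at h1
    have h2 : RegMod (⊥ : Ideal N) ([] ++ (t :: l).map π) := by
      have := RegMod.quotient (I := 𝔞) h1
      simpa [π, List.map_map] using this
    have h3 := PerfectedRegular.regMod p i h2
    simpa [Ideal.ofList] using h3
  · intro l hl
    by_contra h
    have h2 : (1 : N) ∈ Ideal.ofList ((t :: l).map π) :=
      PerfectedRegular.one_mem p i (by simpa using hl)
    refine hone _ ?_ h (by rw [Ideal.map_ofList]; exact h2)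
    rw [Ideal.ofList_cons]
    exact le_sup_left
  · refine ⟨fun j => i (Ideal.Quotient.mk 𝔞 (X (toLex (j, 0)))), fun k => ?_⟩
    let ψ : MvPolynomial (ι ×ₗ ℕ) T →+* PerfectClosure N p := i.comp (Ideal.Quotient.mk 𝔞)
    have hrel : ∀ v, ψ (relation p t F v) = 0 := fun v => by
      have : Ideal.Quotient.mk 𝔞 (relation p t F v) = 0 :=
        Ideal.Quotient.eq_zero_iff_mem.2 (Ideal.subset_span ⟨v, rfl⟩)
      simp [ψ, this]
    have hw : WittVector.map ψ (value p F k + teichmuller p (C t) * correction p k) =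
        WittVector.map ψ (correction p k) * (p : WittVector p (PerfectClosure N p)) := by
      rw [← verschiebung_frobenius]
      ext n
      rw [map_coeff]
      rcases n with _ | n
      · rw [verschiebung_coeff_zero]
        exact hrel (toLex (k, 0))
      · rw [verschiebung_coeff_succ, coeff_frobenius_charP, map_coeff]
        have := hrel (toLex (k, n + 1))
        change ψ (X (toLex (k, n + 1)) ^ p - (value p F k + teichmuller p (C t) *
          correction p k).coeff (n + 1)) = 0 at this
        rw [map_sub, sub_eq_zero, map_pow] at this
        exact this.symm
    rw [map_add, map_mul, map_teichmuller] at hw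
    have hv : WittVector.map ψ (value p F k) = ((F k).map (eval₂Hom (WittVector.map (i.comp π))
        fun j => teichmuller p (ψ (X (toLex (j, 0)))))).eval
          (teichmuller p (ψ (X (toLex (k, 0))))) := by
      rw [value, ← map_teichmuller p ψ, ← Polynomial.eval₂_at_apply, ← Polynomial.eval_map,
        Polynomial.map_map]
      congr 2
      refine MvPolynomial.ringHom_ext (fun a => ?_) fun j => ?_
      · simp only [subst, RingHom.comp_apply, coe_eval₂Hom, eval₂_C]
        ext n
        simp [map_coeff, ψ, π]
      · simp only [subst, RingHom.comp_apply, coe_eval₂Hom, eval₂_X, map_teichmuller]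
    refine ⟨WittVector.map ψ (correction p k), ?_⟩
    change ((F k).map (eval₂Hom (WittVector.map (i.comp π))
        fun j => teichmuller p (ψ (X (toLex (j, 0)))))).eval
          (teichmuller p (ψ (X (toLex (k, 0))))) = _
    rw [← hv]
    have : (i.comp π) t = ψ (C t) := rfl
    rw [this]
    linear_combination hw

end Andre

end

section

open WittVector


namespace Untilt

variable (p : ℕ) [Fact p.Prime] {T : Type*} [CommRing T] [CharP T p] [PerfectRing T p] (t : T)

theorem comap_constantCoeff_bot :
    (⊥ : Ideal T).comap (constantCoeff : WittVector p T →+* T) = Ideal.span {(p : WittVector p T)} := by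
  rw [← RingHom.ker_eq_comap_bot, ker_constantCoeff]

theorem constantCoeff_surjective : Function.Surjective (constantCoeff : WittVector p T →+* T) :=
  fun x => ⟨teichmuller p x, by simp [constantCoeff]⟩

theorem map_constantCoeff (l : List T) :
    (l.map (teichmuller p)).map (constantCoeff : WittVector p T →+* T) = l := by
  simp [Function.comp_def, constantCoeff]

theorem mul_p_injective (b : WittVector p T) (h : (p : WittVector p T) * b = 0) : b = 0 := by
  rw [mul_comm, ← verschiebung_frobenius] at h
  have h2 : frobenius b = 0 := verschiebung_injective p T (by rw [h, map_zero])
  exact (frobenius_bijective p T).1 (by rw [h2, map_zero])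

/-- The untilt of a perfect ring determined by the equation `p = [t]`. -/
abbrev _root_.Untilt : Type _ := WittVector p T ⧸ Ideal.span {(p : WittVector p T) - teichmuller p t}

noncomputable abbrev mk : WittVector p T →+* Untilt p t := Ideal.Quotient.mk _

theorem mk_p : mk p t (teichmuller p t) = p := by
  rw [← map_natCast (mk p t), eq_comm]
  exact Ideal.Quotient.eq.2 (Ideal.mem_span_singleton_self _)

theorem dcomplete_witt : DComplete (p : WittVector p T) (WittVector p T) :=
  DComplete.of_isAdicComplete (Ideal.span {(p : WittVector p T)}) (Ideal.mem_span_singleton_self _)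

theorem dcomplete : DComplete (p : Untilt p t) (Untilt p t) := by
  have := (dcomplete_witt (T := T) p).quotient
    (I := Ideal.span {(p : WittVector p T) - teichmuller p t}) (Submodule.fg_span_singleton _)
  rw [DComplete.of_ringHom (mk p t) _ _ (fun r m => by rw [Algebra.smul_def]; rfl)] at this
  simpa using this

variable {t} {p}

theorem regMod_witt {l : List T} (h : RegMod ⊥ (t :: l)) :
    RegMod ⊥ ((p : WittVector p T) :: teichmuller p t :: l.map (teichmuller p)) := by
  refine ⟨fun b hb => mul_p_injective p b hb, ?_⟩
  rw [bot_sup_eq, ← comap_constantCoeff_bot, ← List.map_cons,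
    ← RegMod.map_iff_comap (constantCoeff_surjective p), map_constantCoeff]
  exact h

theorem span_sup_span : Ideal.span {(p : WittVector p T) - teichmuller p t} ⊔ Ideal.span {(p : WittVector p T)} =
    Ideal.span {(p : WittVector p T)} ⊔ Ideal.span {teichmuller p t} := by
  apply le_antisymm <;> refine sup_le ?_ ?_ <;> rw [Ideal.span_singleton_le_iff_mem]
  · exact sub_mem (Ideal.mem_sup_left (Ideal.mem_span_singleton_self _))
      (Ideal.mem_sup_right (Ideal.mem_span_singleton_self _))
  · exact Ideal.mem_sup_left (Ideal.mem_span_singleton_self _)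
  · exact Ideal.mem_sup_right (Ideal.mem_span_singleton_self _)
  · have := sub_mem (Ideal.mem_sup_right (S := Ideal.span {(p : WittVector p T) - teichmuller p t})
      (Ideal.mem_span_singleton_self (p : WittVector p T)))
      (Ideal.mem_sup_left (Ideal.mem_span_singleton_self ((p : WittVector p T) - teichmuller p t)))
    rwa [sub_sub_cancel] at this

theorem regMod {l : List T} (h : RegMod ⊥ (t :: l)) :
    RegMod (⊥ : Ideal (Untilt p t)) ((p : Untilt p t) :: (l.map (teichmuller p)).map (mk p t)) := by
  obtain ⟨h1, h2, h3⟩ := regMod_witt (p := p) h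
  have : RegMod (Ideal.span {(p : WittVector p T) - teichmuller p t})
      ((p : WittVector p T) :: l.map (teichmuller p)) := by
    refine ⟨fun b hb => ?_, ?_⟩
    · have := RegMod.comm_left (I := ⊥) (a := (p : WittVector p T)) (b := p - teichmuller p t) h1
        (fun c hc => ?_) b (by rwa [bot_sup_eq])
      · rwa [bot_sup_eq] at this
      · refine h2 c ?_
        rw [sub_mul, bot_sup_eq] at hc
        rw [bot_sup_eq]
        have := sub_mem (Ideal.mul_mem_right c _ (Ideal.mem_span_singleton_self (p : WittVector p T))) hc
        rwa [sub_sub_cancel] at this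
    · rwa [span_sup_span, ← bot_sup_eq (Ideal.span {(p : WittVector p T)})]
  have := this.quotient
  simpa using this

theorem one_mem {l : List T}
    (h : (1 : Untilt p t) ∈ Ideal.ofList ((p : Untilt p t) :: (l.map (teichmuller p)).map (mk p t))) :
    (1 : T) ∈ Ideal.ofList (t :: l) := by
  have hc := RegMod.ofList_comap (f := mk p t) Ideal.Quotient.mk_surjective ⊥
    (l := (p : WittVector p T) :: l.map (teichmuller p))
  rw [bot_sup_eq, ← RingHom.ker_eq_comap_bot, Ideal.mk_ker, Ideal.ofList_cons, ← sup_assoc,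
    span_sup_span] at hc
  have h1 : (1 : WittVector p T) ∈ Ideal.span {(p : WittVector p T)} ⊔ Ideal.span {teichmuller p t} ⊔
      Ideal.ofList (l.map (teichmuller p)) := by
    rw [← hc, Ideal.mem_comap, map_one]
    simpa using h
  rw [sup_assoc, ← Ideal.ofList_cons, ← comap_constantCoeff_bot, ← List.map_cons,
    ← RegMod.ofList_comap (constantCoeff_surjective p), map_constantCoeff] at h1
  simpa using h1

theorem eq_zero_of_pow (ht : ∀ b, t * b = 0 → b = 0) (a : Untilt p t) (ha : a ^ p = 0) :
    a = 0 := by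
  obtain ⟨s, hs⟩ := (bijective_frobenius T p).2 t
  rw [frobenius_def] at hs
  have hreg : ∀ b : Untilt p t, (p : Untilt p t) * b = 0 → b = 0 := fun b hb =>
    (regMod (p := p) (t := t) (l := []) ⟨fun b hb => ht b hb, trivial⟩).1 b hb
  let σ : Untilt p t := mk p t (teichmuller p s)
  have hσ : σ ^ p = p := by rw [← map_pow, ← map_pow, hs, mk_p]
  have step : ∀ a : {a : Untilt p t // a ^ p = 0}, ∃ b : {a : Untilt p t // a ^ p = 0},
      a.1 = σ * b.1 := by
    rintro ⟨a, ha⟩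
    obtain ⟨w, rfl⟩ := Ideal.Quotient.mk_surjective a
    suffices h : ∃ b, mk p t w = σ * b by
      obtain ⟨b, hb⟩ := h
      refine ⟨⟨b, hreg _ ?_⟩, hb⟩
      rw [← hσ, ← mul_pow, ← hb]; exact ha
    rw [← map_pow, Ideal.Quotient.eq_zero_iff_mem] at ha
    obtain ⟨v, hv⟩ := Ideal.mem_span_singleton.1 ha
    have h0 : w.coeff 0 ^ p = s ^ p * (-v.coeff 0) := by
      have := congrArg (constantCoeff : WittVector p T →+* T) hv
      simp only [map_pow, map_mul, map_sub, map_natCast, CharP.cast_eq_zero] at this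
      simp only [constantCoeff, RingHom.coe_mk, MonoidHom.coe_mk, OneHom.coe_mk,
        teichmuller_coeff_zero] at this
      rw [this, hs]; ring
    obtain ⟨u, hu⟩ := (bijective_frobenius T p).2 (-v.coeff 0)
    rw [frobenius_def] at hu
    rw [← hu, ← mul_pow] at h0
    have h0 := (bijective_frobenius T p).1 (by simpa only [frobenius_def] using h0)
    have : (w - teichmuller p s * teichmuller p u) ∈ RingHom.ker (constantCoeff : WittVector p T →+* T) := by
      rw [RingHom.mem_ker, map_sub, map_mul]
      simp [constantCoeff, h0]
    rw [ker_constantCoeff, Ideal.mem_span_singleton] at this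
    obtain ⟨z, hz⟩ := this
    refine ⟨mk p t (teichmuller p u) + σ ^ (p - 1) * mk p t z, ?_⟩
    have hp : σ * σ ^ (p - 1) = p := by
      rw [← pow_succ', Nat.sub_add_cancel (Fact.out : p.Prime).one_le, hσ]
    have := congrArg (mk p t) hz
    rw [map_sub, map_mul, map_mul, map_natCast] at this
    linear_combination this - mk p t z * hp
  choose f hf using step
  have hd : DComplete σ (Untilt p t) := DComplete.of_pow (k := p) (by rw [hσ]; exact dcomplete p t)
  exact hd.eq_zero (e := fun k => (f^[k] ⟨a, ha⟩).1)
    (fun n => by rw [Function.iterate_succ_apply']; exact hf _) 0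

theorem isReduced (ht : ∀ b, t * b = 0 → b = 0) : IsReduced (Untilt p t) := by
  refine ⟨fun a ⟨n, hn⟩ => ?_⟩
  have : ∀ k (a : Untilt p t), a ^ p ^ k = 0 → a = 0 := by
    intro k
    induction k with
    | zero => intro a h; simpa using h
    | succ k ih => intro a h; exact ih a (eq_zero_of_pow ht _ (by rw [← pow_mul, ← pow_succ, h]))
  exact this n a (pow_eq_zero_of_le (Nat.lt_pow_self (Fact.out : p.Prime).one_lt).le hn)

end Untilt

end

section

open WittVector

namespace WittVector

variable {p : ℕ} [hp : Fact p.Prime] {T : Type*} [CommRing T]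

theorem teichmuller_add_verschiebung (a : T) (w : WittVector p T) :
    teichmuller p a + verschiebung w = mk p fun i => Nat.casesOn i a fun i => w.coeff i := by
  ext k
  rw [coeff_add_of_disjoint]
  · cases k with
    | zero => simp [teichmuller_coeff_zero, verschiebung_coeff_zero]
    | succ k => simp [teichmuller_coeff_pos, verschiebung_coeff_succ]
  · intro n
    cases n with
    | zero => right; exact verschiebung_coeff_zero _
    | succ n => left; exact teichmuller_coeff_pos _ _ _ n.succ_pos

theorem teichmuller_mul_coeff [CharP T p] (a : T) (w : WittVector p T) (k : ℕ) :
    (teichmuller p a * w).coeff k = a ^ p ^ k * w.coeff k := by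
  induction k generalizing a w with
  | zero => rw [mul_coeff_zero, teichmuller_coeff_zero, pow_zero, pow_one]
  | succ k ih =>
    have hw : w = teichmuller p (w.coeff 0) + verschiebung (w.shift 1) := by
      rw [teichmuller_add_verschiebung]
      ext k
      cases k with
      | zero => rfl
      | succ k => simp [shift_coeff, add_comm]
    conv_lhs => rw [hw]
    rw [mul_add, ← map_mul, mul_comm (teichmuller p a) (verschiebung _),
      ← verschiebung_mul_frobenius, frobenius_eq_map_frobenius,
      map_teichmuller, teichmuller_add_verschiebung, coeff_mk, mul_comm (shift _ _)]
    simp only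
    rw [ih, frobenius_def, shift_coeff, ← pow_mul, ← pow_succ', add_comm 1]

theorem exists_init_add (w : WittVector p T) (k : ℕ) :
    ∃ s : WittVector p T, w = init k w + verschiebung^[k] s ∧ s.coeff 0 = w.coeff k := by
  have h1 : ∀ i < k, (tail k w).coeff i = 0 := fun i hi => by
    simp [tail, select, hi]
  refine ⟨(tail k w).shift k, ?_, ?_⟩
  · rw [← eq_iterate_verschiebung h1, init_add_tail]
  · rw [shift_coeff, add_zero]
    simp [tail, select]

theorem init_add_verschiebung_coeff (c s : WittVector p T) (k : ℕ) :
    (init k c + verschiebung^[k] s).coeff k = s.coeff 0 := by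
  rw [coeff_add_of_disjoint]
  · have := iterate_verschiebung_coeff s k 0
    rw [zero_add] at this
    rw [this]
    simp [select, WittVector.init]
  · intro n
    by_cases hn : n < k
    · right; exact iterate_verschiebung_coeff_eq_zero _ hn
    · left; simp [select, WittVector.init, hn]

theorem verschiebung_iterate_add (s t : WittVector p T) (k : ℕ) :
    verschiebung^[k] (s + t) = verschiebung^[k] s + verschiebung^[k] t := by
  induction k with
  | zero => rfl
  | succ k ih => rw [Function.iterate_succ_apply', ih, map_add, Function.iterate_succ_apply',
      Function.iterate_succ_apply']

theorem add_coeff_eq (a b : WittVector p T) (k : ℕ) :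
    (a + b).coeff k = a.coeff k + b.coeff k + (init k a + init k b).coeff k := by
  obtain ⟨s, hs, hs0⟩ := exists_init_add a k
  obtain ⟨t, ht, ht0⟩ := exists_init_add b k
  obtain ⟨r, hr, hr0⟩ := exists_init_add (init k a + init k b) k
  have : a + b = init k (init k a + init k b) + verschiebung^[k] (r + (s + t)) := by
    rw [verschiebung_iterate_add, verschiebung_iterate_add, ← add_assoc, ← hr]
    conv_lhs => rw [hs, ht]
    ring
  rw [this, init_add_verschiebung_coeff, add_coeff_zero, add_coeff_zero, hs0, ht0, hr0]
  ring

theorem init_congr {a b : WittVector p T} {k : ℕ} (h : ∀ i < k, a.coeff i = b.coeff i) :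
    init k a = init k b := by
  ext i
  by_cases hi : i < k
  · simp [select, WittVector.init, hi, h i hi]
  · simp [select, WittVector.init, hi]

theorem dcomplete_teichmuller [CharP T p] {x : T} (hx : DComplete x T) :
    DComplete (teichmuller p x) (WittVector p T) := by
  have hxk : ∀ k, DComplete (x ^ p ^ k) T := fun k => by
    have h1 := hx.mul_right (x ^ (p ^ k - 1))
    rwa [← pow_succ', Nat.sub_add_cancel (Nat.one_le_pow _ _ hp.out.pos)] at h1
  refine DComplete.of_exists (fun e he => ?_) fun d => ?_
  · ext k
    rw [zero_coeff]
    exact (hxk k).eq_zero (e := fun n => (e n).coeff k) (fun n => by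
      rw [he n, smul_eq_mul, teichmuller_mul_coeff]; rfl) 0
  · let w (k : ℕ) (g : ∀ i < k, ℕ → T) (n : ℕ) : WittVector p T :=
      mk p fun i => if h : i < k then g i h n else 0
    choose F hF using fun k (d : ℕ → T) => (hxk k).exists_eq d
    let f : ℕ → ℕ → T := fun k => Nat.strongRec (fun k g => F k fun n => (d n).coeff k +
      (init k (d n) + init k (teichmuller p x * w k g (n + 1))).coeff k) k
    have hf : ∀ k, f k = F k fun n => (d n).coeff k +
        (init k (d n) + init k (teichmuller p x * w k (fun i _ => f i) (n + 1))).coeff k := fun k => by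
      simp only [f]
      rw [Nat.strongRec_eq]
    refine ⟨fun n => mk p fun i => f i n, fun n => ?_⟩
    ext k
    rw [coeff_mk, smul_eq_mul, add_coeff_eq, teichmuller_mul_coeff, coeff_mk]
    have h1 := hF k (fun n => (d n).coeff k +
        (init k (d n) + init k (teichmuller p x * w k (fun i _ => f i) (n + 1))).coeff k) n
    rw [← hf k] at h1
    rw [h1, smul_eq_mul]
    have h2 : init k (teichmuller p x * w k (fun i _ => f i) (n + 1)) =
        init k (teichmuller p x * mk p fun i => f i (n + 1)) := by
      refine init_congr fun i hi => ?_
      rw [teichmuller_mul_coeff, teichmuller_mul_coeff, coeff_mk]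
      simp [hi]
    rw [h2]
    ring

end WittVector

end

section

open Polynomial

namespace Polynomial

/-- Successive quotients of `P` by `X - x 0`, `X - x 1`, … . -/
noncomputable def divSeq {M : Type*} [CommRing M] (P : M[X]) (x : ℕ → M) : ℕ → M[X]
  | 0 => P
  | i + 1 => divSeq P x i /ₘ (X - C (x i))

section

variable {M N : Type*} [CommRing M] [CommRing N]

theorem map_divSeq (f : M →+* N) (P : M[X]) (x : ℕ → M) (i : ℕ) :
    (divSeq P x i).map f = divSeq (P.map f) (fun j => f (x j)) i := by
  induction i with
  | zero => rfl
  | succ i ih =>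
    rw [divSeq, divSeq, map_divByMonic _ (monic_X_sub_C _), ih]
    simp

theorem divSeq_monic [Nontrivial M] {P : M[X]} (hP : P.Monic) (x : ℕ → M) (i : ℕ)
    (hi : i ≤ P.natDegree) :
    (divSeq P x i).Monic ∧ (divSeq P x i).natDegree = P.natDegree - i := by
  induction i with
  | zero => exact ⟨hP, rfl⟩
  | succ i ih =>
    obtain ⟨h1, h2⟩ := ih (by omega)
    refine ⟨?_, ?_⟩
    · rw [divSeq, Monic, leadingCoeff_divByMonic_of_monic (monic_X_sub_C _), h1.leadingCoeff]
      rw [degree_X_sub_C, degree_eq_natDegree h1.ne_zero, h2]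
      exact_mod_cast (by omega : 1 ≤ P.natDegree - i)
    · rw [divSeq, natDegree_divByMonic _ (monic_X_sub_C _), h2, natDegree_X_sub_C]
      omega

theorem divSeq_coeff_mem (S : Subring M) {P : M[X]} (hP : ∀ n, P.coeff n ∈ S) (x : ℕ → M) (i : ℕ)
    (hx : ∀ j < i, x j ∈ S) (n : ℕ) : (divSeq P x i).coeff n ∈ S := by
  induction i generalizing n with
  | zero => exact hP n
  | succ i ih =>
    rw [divSeq, coeff_divByMonic_X_sub_C]
    exact sum_mem fun k _ => mul_mem (pow_mem (hx i i.lt_succ_self) _)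
      (ih (fun j hj => hx j (hj.trans i.lt_succ_self)) k)

theorem prod_mul_divSeq {P : M[X]} (x : ℕ → M) (k : ℕ)
    (h : ∀ i < k, (divSeq P x i).eval (x i) = 0) :
    ((Multiset.range k).map fun i => X - C (x i)).prod * divSeq P x k = P := by
  induction k with
  | zero => simp [divSeq]
  | succ k ih =>
    rw [Multiset.range_succ, Multiset.map_cons, Multiset.prod_cons, divSeq, mul_comm (X - C (x k)),
      mul_assoc, mul_divByMonic_eq_iff_isRoot.2 (h k k.lt_succ_self)]
    exact ih fun i hi => h i (hi.trans k.lt_succ_self)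

end

end Polynomial

namespace Untilt

universe u

theorem exists_splitting (p : ℕ) [Fact p.Prime] {T : Type u} [CommRing T] [Nontrivial T] [CharP T p]
    (t : T) (ht : (1 : T) ∉ Ideal.span {t}) {Q : Type u} [CommRing Q] (ρ : Q →+* WittVector p T) :
    ∃ (T' : Type u) (_ : CommRing T') (_ : CharP T' p) (_ : PerfectRing T' p) (φ : T →+* T'),
      (∀ l, RegMod ⊥ (t :: l) → RegMod ⊥ ((t :: l).map φ)) ∧
      (∀ l, (1 : T') ∈ Ideal.ofList ((t :: l).map φ) → (1 : T) ∈ Ideal.ofList (t :: l)) ∧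
      ∀ P : Q[X], P.Monic → ∃ s : Multiset (Untilt p (φ t)),
        P.map (((mk p (φ t)).comp (WittVector.map φ)).comp ρ) = (s.map (X - C ·)).prod := by
  classical
  let _ : LinearOrder {P : Q[X] // P.Monic} := linearOrderOfSTO WellOrderingRel
  let M := MvPolynomial ({P : Q[X] // P.Monic} ×ₗ ℕ) (WittVector p T)
  let c : WittVector p T →+* M := MvPolynomial.C
  let P' : {P : Q[X] // P.Monic} → M[X] := fun P => P.1.map (c.comp ρ)
  let x : {P : Q[X] // P.Monic} → ℕ → M := fun P i => MvPolynomial.X (toLex (P, i))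
  have hP' : ∀ P, (P' P).Monic := fun P => P.2.map _
  let F : {P : Q[X] // P.Monic} ×ₗ ℕ → M[X] := fun i =>
    if (ofLex i).2 < (P' (ofLex i).1).natDegree then divSeq (P' (ofLex i).1) (x (ofLex i).1) (ofLex i).2
    else X
  obtain ⟨T', i1, i2, i3, φ, h1, h2, y, hy⟩ := Andre.exists_extension p t ht F
    (fun i => by
      dsimp only [F]
      split_ifs with h
      · exact (divSeq_monic (hP' _) _ _ h.le).1
      · exact monic_X)
    (fun i => by
      dsimp only [F]
      split_ifs with h
      · rw [(divSeq_monic (hP' _) _ _ h.le).2]; omega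
      · rw [natDegree_X]; exact one_pos)
    (fun i n => by
      dsimp only [F]
      split_ifs with h
      · refine divSeq_coeff_mem (MvPolynomial.supported (WittVector p T) {j | j < i}).toSubring
          (fun n => ?_) _ _ (fun j hj => ?_) n
        · rw [coeff_map]
          exact Subalgebra.algebraMap_mem _ (ρ ((ofLex i).1.1.coeff n))
        · exact MvPolynomial.X_mem_supported.2 (Prod.Lex.right _ hj)
      · rw [coeff_X]
        split_ifs
        · exact Subalgebra.one_mem _
        · exact Subalgebra.zero_mem _)
  refine ⟨T', i1, i2, i3, φ, h1, h2, fun P hP => ?_⟩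
  let ev : M →+* Untilt p (φ t) := (mk p (φ t)).comp
    (MvPolynomial.eval₂Hom (WittVector.map φ) fun j => WittVector.teichmuller p (y j))
  have hev : ∀ j, ev (MvPolynomial.X j) = mk p (φ t) (WittVector.teichmuller p (y j)) := fun j =>
    congrArg (mk p (φ t)) (MvPolynomial.eval₂Hom_X' _ _ j)
  have hc : (P' ⟨P, hP⟩).map ev = P.map (((mk p (φ t)).comp (WittVector.map φ)).comp ρ) := by
    rw [map_map]
    congr 1
    ext q
    exact congrArg (mk p (φ t)) (MvPolynomial.eval₂Hom_C _ _ (ρ q))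
  rw [← hc, ← prod_mul_divSeq (P := (P' ⟨P, hP⟩).map ev) (fun j => ev (x ⟨P, hP⟩ j))
    (P' ⟨P, hP⟩).natDegree]
  · refine ⟨(Multiset.range (P' ⟨P, hP⟩).natDegree).map (fun j => ev (x ⟨P, hP⟩ j)), ?_⟩
    have := divSeq_monic (hP' ⟨P, hP⟩) (x ⟨P, hP⟩) _ le_rfl
    rw [Nat.sub_self] at this
    rw [← map_divSeq, this.1.natDegree_eq_zero.1 this.2, Polynomial.map_one, mul_one, Multiset.map_map]
    rfl
  · intro i hi
    have := hy (toLex (⟨P, hP⟩, i))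
    rw [← map_divSeq, hev, ← map_map, eval_map_apply, Ideal.Quotient.eq_zero_iff_mem,
      Ideal.mem_span_singleton]
    have hF : F (toLex (⟨P, hP⟩, i)) = divSeq (P' ⟨P, hP⟩) (x ⟨P, hP⟩) i := if_pos hi
    rwa [hF] at this

theorem exists_roots (p : ℕ) [Fact p.Prime] {T : Type u} [CommRing T] [Nontrivial T] [CharP T p]
    (t : T) (ht : (1 : T) ∉ Ideal.span {t}) :
    ∃ (T' : Type u) (_ : CommRing T') (_ : CharP T' p) (_ : PerfectRing T' p) (φ : T →+* T'),
      (∀ l, RegMod ⊥ (t :: l) → RegMod ⊥ ((t :: l).map φ)) ∧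
      (∀ l, (1 : T') ∈ Ideal.ofList ((t :: l).map φ) → (1 : T) ∈ Ideal.ofList (t :: l)) ∧
      ∀ w : WittVector p T, ∃ y : T', mk p (φ t) (WittVector.map φ w) =
        mk p (φ t) (WittVector.teichmuller p y) := by
  classical
  let _ : LinearOrder (WittVector p T) := linearOrderOfSTO WellOrderingRel
  obtain ⟨T', i1, i2, i3, φ, h1, h2, y, hy⟩ := Andre.exists_extension p t ht
    (fun w : WittVector p T => X - C (MvPolynomial.C w))
    (fun i => monic_X_sub_C _) (fun i => by rw [natDegree_X_sub_C]; exact one_pos)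
    (fun i n => by
      rw [coeff_sub, coeff_X, coeff_C]
      refine Subalgebra.sub_mem _ ?_ ?_
      · split_ifs
        · exact Subalgebra.one_mem _
        · exact Subalgebra.zero_mem _
      · split_ifs
        · exact Subalgebra.algebraMap_mem _ i
        · exact Subalgebra.zero_mem _)
  refine ⟨T', i1, i2, i3, φ, h1, h2, fun w => ⟨y w, ?_⟩⟩
  have := hy w
  simp only [Polynomial.map_sub, map_X, map_C, eval_sub, eval_X, eval_C] at this
  rw [MvPolynomial.eval₂Hom_C, ← Ideal.mem_span_singleton, ← Ideal.Quotient.eq_zero_iff_mem, map_sub,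
    sub_eq_zero] at this
  exact this.symm

/-- A reduced quotient of a ring of Witt vectors in which the monic polynomials over `Q` split, with
roots in a subring whose elements have arbitrary `p`-power roots. -/
theorem exists_reduced (p : ℕ) [Fact p.Prime] {T : Type u} [CommRing T] [CharP T p]
    {t : T} {xs : List T} (hreg : RegMod ⊥ (t :: xs)) (h1 : (1 : T) ∉ Ideal.ofList (t :: xs))
    {Q : Type u} [CommRing Q] (ρ : Q →+* WittVector p T) :
    ∃ (A : Type u) (_ : CommRing A) (_ : IsReduced A) (σ : WittVector p T →+* A),
      RegMod ⊥ ((p : A) :: xs.map fun a => σ (WittVector.teichmuller p a)) ∧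
      (1 : A) ∉ Ideal.ofList ((p : A) :: xs.map fun a => σ (WittVector.teichmuller p a)) ∧
      ∃ A1 : Subring A, (∀ w, σ w ∈ A1) ∧
        (∀ P : Q[X], P.Monic → ∃ s : Multiset A, (∀ a ∈ s, a ∈ A1) ∧
          P.map (σ.comp ρ) = (s.map (X - C ·)).prod) ∧
        ∀ h ∈ A1, ∀ e : ℕ, ∃ g : A, g ^ p ^ e = h := by
  have : Nontrivial T := ⟨⟨1, 0, fun h => h1 (h ▸ zero_mem _)⟩⟩
  have ht : (1 : T) ∉ Ideal.span {t} := fun h => h1 (by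
    rw [Ideal.ofList_cons]; exact Ideal.mem_sup_left h)
  obtain ⟨T₁, _, _, _, φ, hφ1, hφ2, hsplit⟩ := exists_splitting p t ht ρ
  have h1' : (1 : T₁) ∉ Ideal.ofList ((t :: xs).map φ) := fun h => h1 (hφ2 _ h)
  have ht' : (1 : T₁) ∉ Ideal.span {φ t} := fun h => h1' (by
    rw [List.map_cons, Ideal.ofList_cons]; exact Ideal.mem_sup_left h)
  have : Nontrivial T₁ := ⟨⟨1, 0, fun h => h1' (h ▸ zero_mem _)⟩⟩
  obtain ⟨T₂, _, _, _, ψ, hψ1, hψ2, hroot⟩ := exists_roots p (φ t) ht'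
  let χ : Untilt p (φ t) →+* Untilt p (ψ (φ t)) := Ideal.quotientMap _ (WittVector.map ψ) (by
    rw [Ideal.span_singleton_le_iff_mem, Ideal.mem_comap, map_sub, map_natCast,
      WittVector.map_teichmuller]
    exact Ideal.mem_span_singleton_self _)
  have hχ : ∀ w, χ (mk p (φ t) w) = mk p (ψ (φ t)) (WittVector.map ψ w) := fun w =>
    Ideal.quotientMap_mk
  have hr : RegMod ⊥ (ψ (φ t) :: xs.map (ψ.comp φ)) := by
    simpa [Function.comp_def] using hψ1 _ (hφ1 _ hreg)
  have hone : (1 : T₂) ∉ Ideal.ofList (ψ (φ t) :: xs.map (ψ.comp φ)) := fun h =>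
    h1' (hψ2 _ (by simpa [Function.comp_def] using h))
  let σ : WittVector p T →+* Untilt p (ψ (φ t)) := (mk p (ψ (φ t))).comp (WittVector.map (ψ.comp φ))
  have hσ : ∀ w, σ w = χ (mk p (φ t) (WittVector.map φ w)) := fun w => by
    rw [hχ]
    refine congrArg (mk p (ψ (φ t))) ?_
    ext n
    simp
  have hl : ((xs.map (ψ.comp φ)).map (WittVector.teichmuller p)).map (mk p (ψ (φ t))) =
      xs.map fun a => σ (WittVector.teichmuller p a) := by
    rw [List.map_map, List.map_map]
    refine List.map_congr_left fun a _ => ?_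
    exact congrArg (mk p (ψ (φ t))) (WittVector.map_teichmuller p (ψ.comp φ) a).symm
  refine ⟨Untilt p (ψ (φ t)), inferInstance, isReduced (fun b hb => hr.1 b hb), σ, ?_, ?_, χ.range,
    fun w => ?_, fun P hP => ?_, ?_⟩
  · rw [← hl]; exact regMod hr
  · rw [← hl]; exact fun h => hone (one_mem h)
  · rw [hσ]; exact ⟨_, rfl⟩
  · obtain ⟨s, hs⟩ := hsplit P hP
    refine ⟨s.map χ, ?_, ?_⟩
    · intro a ha
      obtain ⟨b, _, rfl⟩ := Multiset.mem_map.1 ha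
      exact ⟨b, rfl⟩
    · have : σ.comp ρ = χ.comp (((mk p (φ t)).comp (WittVector.map φ)).comp ρ) := by
        ext q
        exact hσ _
      rw [this, ← Polynomial.map_map, hs, ← Polynomial.coe_mapRingHom, map_multiset_prod,
        Multiset.map_map, Multiset.map_map]
      simp
  · rintro _ ⟨a, rfl⟩ e
    obtain ⟨w, rfl⟩ := Ideal.Quotient.mk_surjective a
    obtain ⟨y, hy⟩ := hroot w
    obtain ⟨z, hz⟩ := (bijective_iterateFrobenius T₂ p (n := e)).2 y
    rw [iterateFrobenius_def] at hz
    refine ⟨mk p (ψ (φ t)) (WittVector.teichmuller p z), ?_⟩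
    rw [← map_pow, ← map_pow, hz, ← hy]
    exact (hχ w).symm

end Untilt

end

section

open IsLocalRing


namespace PowerSeries

variable {C : Type*} [CommRing C]

theorem dcomplete_X : DComplete (X : C⟦X⟧) C⟦X⟧ :=
  DComplete.of_isAdicComplete (Ideal.span {X}) (Ideal.mem_span_singleton_self _)

theorem dcomplete_C {a : C} (h : DComplete a C) : DComplete (PowerSeries.C a) C⟦X⟧ := by
  rw [← DComplete.of_ringHom (PowerSeries.C) a C⟦X⟧ (fun r m => by rw [smul_eq_C_mul]; rfl)]
  exact DComplete.pi (M := fun _ : Unit →₀ ℕ => C) fun _ => h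

theorem comap_constantCoeff_bot :
    (⊥ : Ideal C).comap (constantCoeff : C⟦X⟧ →+* C) = Ideal.span {X} := by
  ext f
  rw [Ideal.mem_comap, Ideal.mem_bot, Ideal.mem_span_singleton, X_dvd_iff]

theorem map_constantCoeff_map_C (l : List C) :
    (l.map (PowerSeries.C)).map (constantCoeff : C⟦X⟧ →+* C) = l := by
  simp [Function.comp_def]

theorem regMod_X_cons {l : List C} (h : RegMod ⊥ l) :
    RegMod ⊥ ((X : C⟦X⟧) :: l.map PowerSeries.C) := by
  refine ⟨fun b hb => ?_, ?_⟩
  · exact X_mul_cancel (by rw [mul_zero]; exact hb)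
  · rw [bot_sup_eq, ← comap_constantCoeff_bot,
      ← RegMod.map_iff_comap (constantCoeff_surj), map_constantCoeff_map_C]
    exact h

theorem comap_constantCoeff_ofList {l : List C} :
    (Ideal.ofList l).comap (constantCoeff : C⟦X⟧ →+* C) = Ideal.ofList (X :: l.map PowerSeries.C) := by
  have := RegMod.ofList_comap (C := C⟦X⟧) (f := constantCoeff) constantCoeff_surj ⊥
    (l := l.map PowerSeries.C)
  rwa [map_constantCoeff_map_C, bot_sup_eq, comap_constantCoeff_bot, ← Ideal.ofList_cons] at this

/-- Setting the variable equal to `s` gives an isomorphism onto the base when the base is derived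
complete along `s`. -/
theorem bijective_mk_sub {s : C} (hs : DComplete s C) :
    Function.Bijective ((Ideal.Quotient.mk (Ideal.span {X - PowerSeries.C s})).comp
      (PowerSeries.C : C →+* C⟦X⟧)) := by
  constructor
  · rw [injective_iff_map_eq_zero]
    intro c hc
    obtain ⟨g, hg⟩ := Ideal.mem_span_singleton.1 (Ideal.Quotient.eq_zero_iff_mem.1 hc)
    have : ∀ n, coeff n g = s • coeff (n + 1) g := fun n => by
      have := congrArg (coeff (n + 1)) hg
      rw [sub_mul, map_sub, coeff_succ_X_mul, coeff_C_mul, coeff_C, if_neg (by simp)] at this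
      exact (sub_eq_zero.1 this.symm)
    have h0 := hs.eq_zero this
    have hg0 : g = 0 := by ext n; simpa using h0 n
    rw [hg0, mul_zero] at hg
    simpa using congrArg constantCoeff hg
  · intro f
    obtain ⟨f, rfl⟩ := Ideal.Quotient.mk_surjective f
    obtain ⟨e, he⟩ := hs.exists_eq fun n => coeff n f
    refine ⟨e 0, Ideal.Quotient.eq.2 (Ideal.mem_span_singleton.2 ⟨-mk fun n => e (n + 1), ?_⟩)⟩
    ext n
    rcases n with _ | n
    · have := he 0
      simp [sub_mul] at this ⊢
      linear_combination this
    · have := he (n + 1)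
      simp [sub_mul, coeff_succ_X_mul] at this ⊢
      linear_combination this

theorem exists_eval {Q : Type*} [CommRing Q] (ψ : Q →+* C) {s : C} (hs : DComplete s C) :
    ∃ ψ' : Q⟦X⟧ →+* C, ψ'.comp PowerSeries.C = ψ ∧ ψ' X = s := by
  let e := RingEquiv.ofBijective _ (bijective_mk_sub hs)
  refine ⟨(e.symm : C⟦X⟧ ⧸ Ideal.span {X - PowerSeries.C s} →+* C).comp ((Ideal.Quotient.mk _).comp (PowerSeries.map ψ)), ?_, ?_⟩
  · ext q
    have : e (ψ q) = Ideal.Quotient.mk _ (PowerSeries.C (ψ q)) := rfl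
    simp [← this]
  · have : e s = Ideal.Quotient.mk _ X := by
      refine (Ideal.Quotient.eq.2 ?_).symm
      exact Ideal.mem_span_singleton_self _
    simp [← this]

theorem coeff_mem_of_isAlmostIntegral {Q F : Type*} [CommRing Q] [IsDomain Q] [IsNoetherianRing Q]
    [IsIntegrallyClosed Q] [Field F] [Algebra Q F] [IsFractionRing Q F] {h : Q⟦X⟧} (h0 : h ≠ 0)
    {φ : F⟦X⟧} (hφ : ∀ n, ∃ g : Q⟦X⟧, map (algebraMap Q F) h * φ ^ n = map (algebraMap Q F) g) :
    ∃ g : Q⟦X⟧, φ = map (algebraMap Q F) g := by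
  suffices H : ∀ i, ∃ q, algebraMap Q F q = coeff i φ by
    choose q hq using H
    exact ⟨mk q, by ext; simp [hq]⟩
  intro i
  induction i using Nat.strong_induction_on with
  | _ i ih =>
  choose! q hq using ih
  let r : Q⟦X⟧ := mk fun j => if j < i then q j else 0
  obtain ⟨φ', hφ'⟩ : X ^ i ∣ φ - map (algebraMap Q F) r := by
    rw [X_pow_dvd_iff]
    intro m hm
    simp [r, hm, hq]
  have hc : coeff 0 φ' = coeff i φ := by
    have := congrArg (coeff i) hφ'
    rw [coeff_X_pow_mul'] at this
    simpa [r] using this.symm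
  obtain ⟨h', hh', hh0⟩ : ∃ h', h = X ^ h.order.toNat * h' ∧ coeff 0 h' ≠ 0 := by
    obtain ⟨h', hh'⟩ := X_pow_order_dvd (φ := h)
    refine ⟨h', hh', fun hz => coeff_order h0 ?_⟩
    nth_rw 2 [hh']
    rw [coeff_X_pow_mul']
    simpa using hz
  have hpow : ∀ n, ∃ g : Q⟦X⟧, map (algebraMap Q F) h * (φ - map (algebraMap Q F) r) ^ n =
      map (algebraMap Q F) g := by
    intro n
    choose g hg using hφ
    refine ⟨∑ m ∈ Finset.range (n + 1), g m * (-r) ^ (n - m) * (n.choose m), ?_⟩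
    rw [sub_eq_add_neg, add_pow, Finset.mul_sum, map_sum]
    refine Finset.sum_congr rfl fun m _ => ?_
    rw [map_mul, map_mul, ← hg, map_pow, map_neg, map_natCast]; ring
  have hal : IsAlmostIntegral Q (coeff i φ) := by
    refine ⟨coeff 0 h', mem_nonZeroDivisors_of_ne_zero hh0, fun n => ?_⟩
    obtain ⟨g, hg⟩ := hpow n
    rw [hφ', hh', map_mul, map_pow, map_X] at hg
    have := congrArg (coeff (h.order.toNat + i * n)) hg
    rw [mul_pow, ← pow_mul] at this
    have e1 : (X : F⟦X⟧) ^ h.order.toNat * map (algebraMap Q F) h' * (X ^ (i * n) * φ' ^ n) =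
        X ^ (h.order.toNat + i * n) * (map (algebraMap Q F) h' * φ' ^ n) := by rw [pow_add]; ring
    rw [e1, coeff_X_pow_mul', if_pos le_rfl, Nat.sub_self, coeff_map] at this
    refine ⟨_, this.symm.trans ?_⟩
    rw [← hc, Algebra.smul_def, ← coeff_map]
    simp only [coeff_zero_eq_constantCoeff, map_mul, map_pow]
  exact IsIntegrallyClosed.isIntegral_iff.1 hal.isIntegral

theorem isIntegrallyClosed_of_isFractionRing (Q F : Type*) [CommRing Q] [IsDomain Q]
    [IsNoetherianRing Q] [IsIntegrallyClosed Q] [Field F] [Algebra Q F] [IsFractionRing Q F] :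
    IsIntegrallyClosed Q⟦X⟧ := by
  rw [isIntegrallyClosed_iff (FractionRing Q⟦X⟧)]
  intro θ hθ
  obtain ⟨h, hh, hθ⟩ := hθ.isAlmostIntegral
  obtain ⟨f, g, hg, rfl⟩ := IsFractionRing.div_surjective (A := Q⟦X⟧) θ
  let ι : Q⟦X⟧ →+* F⟦X⟧ := map (algebraMap Q F)
  have hι : Function.Injective ι := map_injective _ (IsFractionRing.injective Q F)
  have h0 : h ≠ 0 := nonZeroDivisors.ne_zero hh
  have g0 : g ≠ 0 := nonZeroDivisors.ne_zero hg
  have hgK : algebraMap Q⟦X⟧ (FractionRing Q⟦X⟧) g ≠ 0 := by simpa using g0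
  have hι0 : ∀ {a : Q⟦X⟧}, a ≠ 0 → ι a ≠ 0 := fun ha => by
    rw [Ne, map_eq_zero_iff ι hι]; exact ha
  have key : ∀ n, ∃ u, h * f ^ n = g ^ n * u := by
    intro n
    obtain ⟨u, hu⟩ := hθ n
    refine ⟨u, IsFractionRing.injective Q⟦X⟧ (FractionRing Q⟦X⟧) ?_⟩
    rw [map_mul, map_mul, map_pow, map_pow, hu, Algebra.smul_def, div_pow]
    field_simp
  obtain ⟨φ, hφ⟩ : ∃ φ, ι f = ι g * φ := by
    have hgK' : algebraMap F⟦X⟧ (FractionRing F⟦X⟧) (ι g) ≠ 0 := by simpa using hι0 g0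
    have : IsAlmostIntegral F⟦X⟧ (algebraMap F⟦X⟧ (FractionRing F⟦X⟧) (ι f) /
        algebraMap F⟦X⟧ (FractionRing F⟦X⟧) (ι g)) := by
      refine ⟨ι h, mem_nonZeroDivisors_of_ne_zero (hι0 h0), fun n => ?_⟩
      obtain ⟨u, hu⟩ := key n
      have := congrArg (fun z => algebraMap F⟦X⟧ (FractionRing F⟦X⟧) (ι z)) hu
      simp only [map_mul, map_pow] at this
      refine ⟨ι u, ?_⟩
      rw [Algebra.smul_def, div_pow]
      field_simp
      linear_combination -this
    obtain ⟨φ, hφ⟩ := IsIntegrallyClosed.isIntegral_iff.1 this.isIntegral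
    refine ⟨φ, IsFractionRing.injective F⟦X⟧ (FractionRing F⟦X⟧) ?_⟩
    rw [map_mul, hφ]; field_simp
  obtain ⟨u, hu⟩ := coeff_mem_of_isAlmostIntegral (F := F) h0 (φ := φ) (fun n => by
    obtain ⟨u, hu⟩ := key n
    have hgn : ι g ^ n ≠ 0 := pow_ne_zero n (hι0 g0)
    refine ⟨u, mul_left_cancel₀ hgn ?_⟩
    have := congrArg ι hu
    simp only [map_mul, map_pow, hφ] at this
    change _ * (ι h * _) = _ * ι u
    rw [← this]; ring)
  refine ⟨u, ?_⟩
  have : f = g * u := hι (by rw [map_mul, hφ, hu])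
  rw [this, map_mul]; field_simp

instance isIntegrallyClosed {Q : Type*} [CommRing Q] [IsDomain Q] [IsNoetherianRing Q]
    [IsIntegrallyClosed Q] : IsIntegrallyClosed Q⟦X⟧ :=
  isIntegrallyClosed_of_isFractionRing Q (FractionRing Q)

end PowerSeries

end

section

open IsLocalRing

/-- A sequence generating the maximal ideal and weakly regular, in a local ring derived complete
along its maximal ideal. -/
structure IsRegularSystem {Q : Type*} [CommRing Q] [IsLocalRing Q] (x : List Q) : Prop where
  span_eq : Ideal.ofList x = maximalIdeal Q
  regMod : RegMod ⊥ x
  dcomplete : ∀ a ∈ maximalIdeal Q, DComplete a Q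

namespace IsRegularSystem

variable {Q : Type*} [CommRing Q] [IsLocalRing Q] {x : List Q}

theorem ofList_perm {R : Type*} [CommRing R] {l l' : List R} (h : l.Perm l') :
    Ideal.ofList l = Ideal.ofList l' := by
  unfold Ideal.ofList
  congr 1
  ext r
  exact h.mem_iff

theorem perm (hx : IsRegularSystem x) {y : List Q} (h : x.Perm y) : IsRegularSystem y where
  span_eq := by rw [← ofList_perm h, hx.span_eq]
  regMod := hx.regMod.perm h Submodule.fg_bot fun a ha => hx.dcomplete a <| by
    rw [← hx.span_eq]; exact Ideal.subset_span (s := {r | r ∈ x}) ha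
  dcomplete := hx.dcomplete

theorem powerSeries (hx : IsRegularSystem x) :
    IsRegularSystem ((PowerSeries.X : PowerSeries Q) :: x.map PowerSeries.C) := by
  have hspan : Ideal.ofList ((PowerSeries.X : PowerSeries Q) :: x.map PowerSeries.C) =
      maximalIdeal _ := by
    rw [← PowerSeries.comap_constantCoeff_ofList, hx.span_eq]
    ext f
    rw [Ideal.mem_comap, mem_maximalIdeal, mem_maximalIdeal, mem_nonunits_iff, mem_nonunits_iff,
      PowerSeries.isUnit_iff_constantCoeff]
  refine ⟨hspan, PowerSeries.regMod_X_cons hx.regMod, fun a ha => ?_⟩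
  rw [← hspan] at ha
  refine DComplete.of_mem_radical (s := {r | r ∈ PowerSeries.X :: x.map PowerSeries.C}) ?_
    (Ideal.le_radical ha)
  intro b hb
  rcases List.mem_cons.1 hb with rfl | hb
  · exact PowerSeries.dcomplete_X
  · obtain ⟨c, hc, rfl⟩ := List.mem_map.1 hb
    exact PowerSeries.dcomplete_C (hx.dcomplete c (hx.span_eq ▸ Ideal.subset_span (s := {r | r ∈ x}) hc))

universe u

theorem exists_powerSeries {Λ : Type u} [CommRing Λ] [IsDomain Λ] [IsNoetherianRing Λ]
    [IsLocalRing Λ] [IsIntegrallyClosed Λ] {l₀ : List Λ} (h₀ : IsRegularSystem l₀) (n : ℕ) :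
    ∃ (Q : Type u) (_ : CommRing Q) (_ : IsDomain Q) (_ : IsNoetherianRing Q) (_ : IsLocalRing Q)
      (_ : IsIntegrallyClosed Q) (c : Λ →+* Q) (x : List Q), x.length = n ∧
      IsRegularSystem (l₀.map c ++ x) ∧ (∀ q, ∃ a, q - c a ∈ Ideal.ofList x) ∧
      ∀ (C : Type u) [CommRing C] (ψ : Λ →+* C) (s : List C), s.length = n →
        (∀ a ∈ s, DComplete a C) → ∃ ψ' : Q →+* C, ψ'.comp c = ψ ∧ x.map ψ' = s := by
  induction n with
  | zero =>
    refine ⟨Λ, _, ‹_›, ‹_›, ‹_›, ‹_›, RingHom.id Λ, [], rfl, by simpa using h₀, fun q => ⟨q, by simp⟩,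
      fun C _ ψ s hs _ => ⟨ψ, by simp, ?_⟩⟩
    rw [List.length_eq_zero_iff.1 hs]; rfl
  | succ n ih =>
    obtain ⟨Q, _, _, _, _, _, c, x, hlen, hreg, hres, hev⟩ := ih
    refine ⟨PowerSeries Q, inferInstance, inferInstance, inferInstance, inferInstance,
      inferInstance, PowerSeries.C.comp c, PowerSeries.X :: x.map PowerSeries.C, by simp [hlen],
      ?_, fun f => ?_, fun C _ ψ s hs hd => ?_⟩
    · refine hreg.powerSeries.perm ?_
      rw [List.map_append, List.map_map]
      exact List.perm_middle.symm
    · obtain ⟨a, ha⟩ := hres (PowerSeries.constantCoeff f)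
      refine ⟨a, ?_⟩
      rw [← PowerSeries.comap_constantCoeff_ofList, Ideal.mem_comap]
      simpa using ha
    · obtain _ | ⟨r, s⟩ := s
      · simp at hs
      obtain ⟨ψ₁, h1, h2⟩ := hev C ψ s (by simpa using hs) fun a ha => hd a (by simp [ha])
      obtain ⟨ψ₂, h3, h4⟩ := PowerSeries.exists_eval ψ₁ (hd r (by simp))
      refine ⟨ψ₂, by rw [← RingHom.comp_assoc, h3, h1], ?_⟩
      rw [List.map_cons, h4, List.map_map, ← h2, ← h3]; rfl

end IsRegularSystem

end

section

open IsLocalRing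


namespace RegMod

variable {C : Type*} [CommRing C]

theorem sup_span_of_forall_append {I : Ideal C} {w : C} {l : List C} (hl : RegMod I l)
    (hw : ∀ u v, u ++ v = l → ∀ c, w * c ∈ I ⊔ Ideal.ofList u → c ∈ I ⊔ Ideal.ofList u) :
    RegMod (I ⊔ Ideal.span {w}) l := by
  induction l generalizing I with
  | nil => trivial
  | cons a l ih =>
    refine ⟨comm_left hl.1 (by simpa using hw [a] l rfl), ?_⟩
    rw [sup_right_comm]
    refine ih hl.2 fun u v huv => ?_
    have := hw (a :: u) v (by simp [huv])
    rwa [Ideal.ofList_cons, ← sup_assoc] at this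

end RegMod

namespace PowerSeries

variable {C : Type*} [CommRing C]

theorem mem_ofList_map_C {l : List C} {f : C⟦X⟧} :
    f ∈ Ideal.ofList (l.map PowerSeries.C) ↔ ∀ n, coeff n f ∈ Ideal.ofList l := by
  induction l generalizing f with
  | nil => simpa using PowerSeries.ext_iff (φ := f) (ψ := 0)
  | cons a l ih =>
    have key {D : Type _} [CommRing D] (a : D) (l : List D) (y : D) :
        y ∈ Ideal.ofList (a :: l) ↔ ∃ c, y - a * c ∈ Ideal.ofList l := by
      rw [Ideal.ofList_cons, sup_comm, RegMod.mem_sup_span]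
    rw [List.map_cons, key]
    constructor
    · rintro ⟨c, hc⟩ n
      exact (key a l _).2 ⟨coeff n c, by simpa using ih.1 hc n⟩
    · intro h
      choose c hc using fun n => (key a l _).1 (h n)
      exact ⟨mk c, ih.2 fun n => by simpa using hc n⟩

theorem regMod_map_C {u l : List C} (h : RegMod (Ideal.ofList u) l) :
    RegMod (Ideal.ofList (u.map PowerSeries.C)) (l.map PowerSeries.C) := by
  induction l generalizing u with
  | nil => trivial
  | cons a l ih =>
    refine ⟨fun f hf => ?_, ?_⟩
    · rw [mem_ofList_map_C] at hf ⊢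
      exact fun n => h.1 _ (by simpa using hf n)
    · simpa using ih (u := u ++ [a]) (by simpa using h.2)

theorem mem_of_X_sub_mul_mem {l : List C} {x : C}
    (hx : x ∈ Ideal.ofList l ∨ ∀ c, x * c ∈ Ideal.ofList l → c ∈ Ideal.ofList l) {f : C⟦X⟧}
    (hf : (X - PowerSeries.C x) * f ∈ Ideal.ofList (l.map PowerSeries.C)) :
    f ∈ Ideal.ofList (l.map PowerSeries.C) := by
  rw [mem_ofList_map_C] at hf ⊢
  rcases hx with hx | hx
  · intro n
    have := hf (n + 1)
    rw [sub_mul, map_sub, coeff_succ_X_mul, coeff_C_mul] at this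
    exact (Submodule.sub_mem_iff_left _ (Ideal.mul_mem_right _ _ hx)).1 this
  · intro n
    induction n with
    | zero =>
      have := hf 0
      rw [sub_mul, map_sub, coeff_zero_X_mul, coeff_C_mul, zero_sub, neg_mem_iff] at this
      exact hx _ this
    | succ n ih =>
      have := hf (n + 1)
      rw [sub_mul, map_sub, coeff_succ_X_mul, coeff_C_mul] at this
      exact hx _ ((Submodule.sub_mem_iff_right _ ih).1 this)

end PowerSeries

universe u

theorem RegMod.exists_dcomplete_step {C : Type u} [CommRing C] {u v : List C} {x : C}
    (hd : ∀ a ∈ u, DComplete a C) (h : RegMod ⊥ (u ++ x :: v)) :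
    ∃ (C' : Type u) (_ : CommRing C') (φ : C →+* C'), RegMod ⊥ ((u ++ x :: v).map φ) ∧
      ((1 : C') ∈ Ideal.ofList ((u ++ x :: v).map φ) → (1 : C) ∈ Ideal.ofList (u ++ x :: v)) ∧
      ∀ a ∈ u ++ [x], DComplete (φ a) C' := by
  let J : Ideal (PowerSeries C) := Ideal.span {PowerSeries.X - PowerSeries.C x}
  have hJ : J.FG := Submodule.fg_span_singleton _
  have hmap : (u ++ x :: v).map ((Ideal.Quotient.mk J).comp PowerSeries.C) =
      ((u ++ x :: v).map PowerSeries.C).map (Ideal.Quotient.mk J) := by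
    rw [List.map_map]; rfl
  have hquot : ∀ a : PowerSeries C, DComplete a (PowerSeries C) →
      DComplete (Ideal.Quotient.mk J a) (PowerSeries C ⧸ J) := fun a ha => by
    rw [← DComplete.of_ringHom (Ideal.Quotient.mk J) a _
      (fun r m => rfl)]
    exact ha.quotient hJ
  refine ⟨PowerSeries C ⧸ J, inferInstance, (Ideal.Quotient.mk J).comp PowerSeries.C, ?_, ?_, ?_⟩
  · rw [hmap]
    refine RegMod.quotient ?_
    have hbase : RegMod (⊥ : Ideal (PowerSeries C)) ((u ++ x :: v).map PowerSeries.C) := by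
      have := PowerSeries.regMod_map_C (u := []) (l := u ++ x :: v) (by rwa [Ideal.ofList_nil])
      rwa [List.map_nil, Ideal.ofList_nil] at this
    have := hbase.sup_span_of_forall_append (w := PowerSeries.X - PowerSeries.C x) ?_
    · rwa [bot_sup_eq] at this
    intro u' v' huv f hf
    rw [bot_sup_eq] at hf ⊢
    obtain ⟨u', rfl, v', rfl⟩ : ∃ u'' : List C, u''.map PowerSeries.C = u' ∧ ∃ v'' : List C, v''.map PowerSeries.C = v' := by
      obtain ⟨a, b, -, h1, h2⟩ := List.append_eq_map_iff.1 huv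
      exact ⟨a, h1, b, h2⟩
    rw [← List.map_append] at huv
    replace huv := List.map_injective_iff.2 PowerSeries.C_injective huv
    refine PowerSeries.mem_of_X_sub_mul_mem ?_ hf
    rcases List.append_eq_append_iff.1 huv with ⟨w, hw, -⟩ | ⟨w, hw, hw2⟩
    · right
      subst hw
      have h1 : RegMod ⊥ ((u' ++ w ++ [x]) ++ v) := by simpa using h
      have h2 := (RegMod.append.1 h1).1
      rw [List.append_assoc] at h2
      have h3 := (RegMod.append.1 h2).2
      rw [bot_sup_eq] at h3
      exact (h3.move_front (Submodule.fg_def.2 ⟨_, List.finite_toSet u', rfl⟩) fun a ha => hd a (by simp [ha])).1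
    · rcases w with _ | ⟨y, w⟩
      · right
        have : u' = u := by simpa using hw
        subst this
        have := (RegMod.append.1 h).2.1
        rwa [bot_sup_eq] at this
      · left
        have : x = y := by simp at hw2; exact hw2.1
        subst this
        exact Ideal.subset_span (s := {r | r ∈ u'}) (by simp [hw])
  · intro h1
    rw [hmap] at h1
    have hc := RegMod.ofList_comap (f := Ideal.Quotient.mk J) Ideal.Quotient.mk_surjective ⊥
      (l := (u ++ x :: v).map PowerSeries.C)
    rw [bot_sup_eq, ← RingHom.ker_eq_comap_bot, Ideal.mk_ker] at hc
    have h2 : (1 : PowerSeries C) ∈ J ⊔ Ideal.ofList ((u ++ x :: v).map PowerSeries.C) := by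
      rw [← hc, Ideal.mem_comap, map_one]; exact h1
    have h3 : J ⊔ Ideal.ofList ((u ++ x :: v).map PowerSeries.C) ≤
        (Ideal.ofList (u ++ x :: v)).comap PowerSeries.constantCoeff := by
      refine sup_le ?_ ?_
      · rw [Ideal.span_singleton_le_iff_mem, Ideal.mem_comap]
        have hx : x ∈ Ideal.ofList (u ++ x :: v) :=
          Ideal.subset_span (s := {r | r ∈ u ++ x :: v}) (by simp)
        have : PowerSeries.constantCoeff (PowerSeries.X - PowerSeries.C x) = -x := by simp
        rw [this]
        exact neg_mem hx
      · rw [PowerSeries.comap_constantCoeff_ofList, Ideal.ofList_cons]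
        exact le_sup_right
    simpa using h3 h2
  · intro a ha
    rw [List.mem_append, List.mem_singleton] at ha
    rcases ha with ha | rfl
    · exact hquot _ (PowerSeries.dcomplete_C (hd a ha))
    · have : (Ideal.Quotient.mk J) (PowerSeries.C a) = Ideal.Quotient.mk J PowerSeries.X :=
        (Ideal.Quotient.eq.2 (Ideal.mem_span_singleton_self _)).symm
      rw [RingHom.comp_apply, this]
      exact hquot _ PowerSeries.dcomplete_X

/-- A ring with a weakly regular sequence maps to one in which the sequence is still weakly regular
and along which it is derived complete. -/
theorem RegMod.exists_dcomplete {C : Type u} [CommRing C] {l : List C} (h : RegMod ⊥ l) :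
    ∃ (C' : Type u) (_ : CommRing C') (φ : C →+* C'), RegMod ⊥ (l.map φ) ∧
      ((1 : C') ∈ Ideal.ofList (l.map φ) → (1 : C) ∈ Ideal.ofList l) ∧
      ∀ a ∈ l, DComplete (φ a) C' := by
  suffices H : ∀ (v : List C) (u : List C) (C' : Type u) (_ : CommRing C') (φ : C →+* C'),
      RegMod ⊥ ((u ++ v).map φ) → (∀ a ∈ u, DComplete (φ a) C') →
      ∃ (C'' : Type u) (_ : CommRing C'') (ψ : C' →+* C''), RegMod ⊥ ((u ++ v).map (ψ.comp φ)) ∧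
        ((1 : C'') ∈ Ideal.ofList ((u ++ v).map (ψ.comp φ)) →
          (1 : C') ∈ Ideal.ofList ((u ++ v).map φ)) ∧
        ∀ a ∈ u ++ v, DComplete (ψ.comp φ a) C'' by
    obtain ⟨C', i, ψ, h1, h2, h3⟩ := H l [] C _ (RingHom.id C) (by simpa using h) (by simp)
    exact ⟨C', i, ψ, by simpa using h1, by simpa using h2, by simpa using h3⟩
  clear h l
  intro v
  induction v with
  | nil => exact fun u C' _ φ h hd => ⟨C', _, RingHom.id C', h, id, by simpa using hd⟩
  | cons x v ih =>
    intro u C' _ φ h hd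
    rw [List.map_append, List.map_cons] at h
    obtain ⟨C₁, _, ψ₁, h1, h2, h3⟩ := h.exists_dcomplete_step (fun a ha => by
      obtain ⟨b, hb, rfl⟩ := List.mem_map.1 ha
      exact hd b hb)
    rw [← List.map_cons, ← List.map_append] at h1 h2
    rw [List.map_map] at h1 h2
    have happ : u ++ x :: v = (u ++ [x]) ++ v := by simp
    obtain ⟨C₂, i, ψ₂, h4, h5, h6⟩ := ih (u ++ [x]) C₁ _ (ψ₁.comp φ) (by rw [← happ]; exact h1)
      (fun a ha => h3 _ (by
        rw [List.mem_append, List.mem_singleton] at ha ⊢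
        exact ha.imp (fun h => List.mem_map_of_mem h) (fun h => by rw [h])))
    rw [← happ] at h4 h5 h6
    exact ⟨C₂, i, ψ₂.comp ψ₁, h4, fun h => h2 (h5 h), h6⟩

end

section

open IsLocalRing


theorem DComplete.exists_limit {R : Type*} [CommRing R] {l : List R}
    (hl : ∀ a ∈ l, DComplete a R) (y : ℕ → R)
    (hy : ∀ n, y (n + 1) - y n ∈ Ideal.ofList (l.map (· ^ n))) :
    ∃ z, ∀ n, z - y n ∈ Ideal.ofList (l.map (· ^ n)) := by
  induction l generalizing y with
  | nil =>
    refine ⟨y 0, fun n => ?_⟩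
    simp only [List.map_nil, Ideal.ofList_nil, Ideal.mem_bot] at hy ⊢
    induction n with
    | zero => simp
    | succ n ih => linear_combination ih - hy n
  | cons a l ih =>
    have key (b : R) (l : List R) (y : R) :
        y ∈ Ideal.ofList (b :: l) ↔ ∃ c, y - b * c ∈ Ideal.ofList l := by
      rw [Ideal.ofList_cons, sup_comm, RegMod.mem_sup_span]
    simp only [List.map_cons, key] at hy ⊢
    choose w hw using hy
    obtain ⟨E, hE⟩ := (hl a (by simp)).exists_eq w
    obtain ⟨z, hz⟩ := ih (fun b hb => hl b (by simp [hb]))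
      (fun n => ∑ k ∈ Finset.range n, (y (k + 1) - y k - a ^ k * w k)) fun n => by
        rw [Finset.sum_range_succ, add_sub_cancel_left]; exact hw n
    refine ⟨y 0 + E 0 + z, fun n => ⟨E n, ?_⟩⟩
    convert hz n using 1
    have : ∀ n, ∑ k ∈ Finset.range n, (y (k + 1) - y k - a ^ k * w k) =
        y n - y 0 - E 0 + a ^ n * E n := by
      intro n
      induction n with
      | zero => simp
      | succ n ih =>
        rw [Finset.sum_range_succ, ih]
        have := hE n
        rw [smul_eq_mul] at this
        linear_combination a ^ n * this
    rw [this]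
    ring

theorem RegMod.map_pow_append {C : Type*} [CommRing C] {I : Ideal C} {u v : List C}
    (h : RegMod I (u ++ v)) (k : ℕ) : RegMod I (u.map (· ^ k) ++ v) := by
  induction u generalizing I with
  | nil => exact h
  | cons a u ih =>
    have := RegMod.pow_cons (rs := u ++ v) h k
    exact ⟨this.1, ih this.2⟩

section Indep

variable {Q C ι : Type*} [CommRing Q] [CommRing C] [Algebra Q C]

/-- Independence of a family modulo an ideal of the base. -/
def IndepMod (b : ι → C) (I : Ideal Q) : Prop :=
  ∀ q : ι →₀ Q, Finsupp.linearCombination Q b q ∈ I.map (algebraMap Q C) → ∀ i, q i ∈ I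

theorem IndepMod.sup_span_pow {b : ι → C} {I : Ideal Q} {a : Q}
    (h : IndepMod b (I ⊔ Ideal.span {a}))
    (ha : ∀ c, algebraMap Q C a * c ∈ I.map (algebraMap Q C) → c ∈ I.map (algebraMap Q C)) (n : ℕ) :
    IndepMod b (I ⊔ Ideal.span {a ^ n}) := by
  have hmap : ∀ n, (I ⊔ Ideal.span {a ^ n}).map (algebraMap Q C) =
      I.map (algebraMap Q C) ⊔ Ideal.span {algebraMap Q C a ^ n} := fun n => by
    rw [Ideal.map_sup, Ideal.map_span, Set.image_singleton, map_pow]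
  induction n with
  | zero => intro q _ i; simp
  | succ n ih =>
    intro q hq i
    have h1 : ∀ i, q i ∈ I ⊔ Ideal.span {a} := h q (by
      have := hmap 1
      rw [pow_one, pow_one] at this
      rw [this]
      rw [hmap] at hq
      have hle : Ideal.span {algebraMap Q C a ^ (n + 1)} ≤ Ideal.span {algebraMap Q C a} := ?_
      · exact (sup_le_sup_left hle _ : I.map (algebraMap Q C) ⊔ _ ≤ _) hq
      rw [Ideal.span_singleton_le_span_singleton]
      exact dvd_pow_self _ n.succ_ne_zero)
    have hg : ∀ x : Q, ∃ y, (x ∈ I ⊔ Ideal.span {a} → x - a * y ∈ I) ∧ (x = 0 → y = 0) := by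
      intro x
      by_cases hx : x ∈ I ⊔ Ideal.span {a}
      · by_cases h0 : x = 0
        · exact ⟨0, by simp [h0], by simp⟩
        · obtain ⟨y, hy⟩ := RegMod.mem_sup_span.1 hx
          exact ⟨y, fun _ => hy, fun h => absurd h h0⟩
      · exact ⟨0, fun h => absurd h hx, by simp⟩
    choose g hg hg0 using hg
    have key : ∀ i, q i - a * g (q i) ∈ I := fun i => hg _ (h1 i)
    rw [hmap, RegMod.mem_sup_span] at hq
    obtain ⟨c, hc⟩ := hq
    let r := q.mapRange g (hg0 0 rfl)
    have hsub : Finsupp.linearCombination Q b (q - a • r) ∈ I.map (algebraMap Q C) := by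
      rw [Finsupp.linearCombination_apply]
      refine Submodule.sum_mem _ fun i _ => ?_
      change (q - a • r) i • b i ∈ _
      rw [Algebra.smul_def]
      exact Ideal.mul_mem_right _ _ (Ideal.mem_map_of_mem _ (by simpa [r] using key i))
    have h2 : Finsupp.linearCombination Q b r ∈ (I ⊔ Ideal.span {a ^ n}).map (algebraMap Q C) := by
      rw [hmap, RegMod.mem_sup_span]
      refine ⟨c, ha _ ?_⟩
      rw [map_sub, map_smul, Algebra.smul_def] at hsub
      convert Ideal.sub_mem _ hc hsub using 1
      ring
    have h3 := ih r h2 i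
    obtain ⟨c', hc'⟩ := RegMod.mem_sup_span.1 h3
    refine RegMod.mem_sup_span.2 ⟨c', ?_⟩
    convert I.add_mem (key i) (I.mul_mem_left a hc') using 1
    simp only [r, Finsupp.mapRange_apply]
    ring

theorem IndepMod.ofList_map_pow {b : ι → C} {u v : List Q} (h : IndepMod b (Ideal.ofList (u ++ v)))
    (hdc : ∀ a ∈ u ++ v, DComplete (algebraMap Q C a) C)
    (hreg : RegMod ⊥ ((u ++ v).map (algebraMap Q C))) (n : ℕ) :
    IndepMod b (Ideal.ofList (u.map (· ^ n) ++ v)) := by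
  induction u generalizing v with
  | nil => exact h
  | cons a u ih =>
    have hp : (a :: u ++ v).Perm (u ++ (v ++ [a])) := by
      rw [← List.append_assoc]; exact (List.perm_append_singleton a (u ++ v)).symm
    have hreg' : RegMod ⊥ ((u ++ (v ++ [a])).map (algebraMap Q C)) :=
      hreg.perm (hp.map _) Submodule.fg_bot (by
        intro c hc
        obtain ⟨d, hd, rfl⟩ := List.mem_map.1 hc
        exact hdc d hd)
    have h1 := ih (v := v ++ [a]) (by
      rw [Ideal.ofList_append, Ideal.ofList_append, Ideal.ofList_singleton, ← sup_assoc, sup_comm,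
        ← Ideal.ofList_append, ← Ideal.ofList_cons]
      exact h) (fun c hc => hdc c (hp.mem_iff.2 hc)) hreg'
    rw [← List.append_assoc, Ideal.ofList_append, Ideal.ofList_singleton] at h1
    rw [List.map_cons, List.cons_append, Ideal.ofList_cons, sup_comm]
    refine h1.sup_span_pow (fun c hc => ?_) n
    rw [Ideal.map_ofList, List.map_append] at hc ⊢
    have h2 : RegMod ⊥ ((u.map (algebraMap Q C)).map (· ^ n) ++
        (v.map (algebraMap Q C) ++ [algebraMap Q C a])) := by
      refine RegMod.map_pow_append ?_ n
      simpa using hreg'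
    rw [← List.append_assoc, RegMod.append] at h2
    have h3 := h2.2.1 c
    rw [bot_sup_eq] at h3
    have h4 : (u.map (· ^ n)).map (algebraMap Q C) = (u.map (algebraMap Q C)).map (· ^ n) := by
      simp [Function.comp_def]
    rw [h4] at hc ⊢
    exact h3 hc

end Indep

end

section

open IsLocalRing


section Retraction

universe v

variable {Q : Type*} {C : Type v} [CommRing Q] [CommRing C] [Algebra Q C]

theorem exists_indepMod {m : Ideal Q} [hm : m.IsMaximal] (h1 : (1 : C) ∉ m.map (algebraMap Q C)) :
    ∃ (ι : Type v) (b : ι → C) (i₀ : ι), b i₀ = 1 ∧ IndepMod b m ∧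
      ∀ c, ∃ q : ι →₀ Q, c - Finsupp.linearCombination Q b q ∈ m.map (algebraMap Q C) := by
  let _ := Ideal.Quotient.field m
  let V := C ⧸ m.map (algebraMap Q C)
  have hV : (1 : V) ≠ 0 := fun h => h1 (Ideal.Quotient.eq_zero_iff_mem.1 (by simpa using h))
  have hs : LinearIndepOn (Q ⧸ m) id ({1} : Set V) := LinearIndepOn.singleton hV
  let B := Module.Basis.extend hs
  choose g hg using fun v : V => Ideal.Quotient.mk_surjective (I := m.map (algebraMap Q C)) v
  let g' : V → C := fun v => by classical exact if v = 1 then 1 else g v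
  have hg' : ∀ v, Ideal.Quotient.mk (m.map (algebraMap Q C)) (g' v) = v := by
    intro v
    by_cases hv : v = 1
    · simp [g', hv]
    · simp [g', hv, hg]
  have hlin : ∀ q : _ →₀ Q, Ideal.Quotient.mk (m.map (algebraMap Q C))
      (Finsupp.linearCombination Q (fun i => g' (B i)) q) =
      Finsupp.linearCombination (Q ⧸ m) B (q.mapRange (Ideal.Quotient.mk m) (map_zero _)) := by
    intro q
    induction q using Finsupp.induction_linear with
    | zero => simp
    | add f g hf hg =>
      rw [map_add, map_add, hf, hg, Finsupp.mapRange_add (by simp), map_add]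
    | single i a =>
      rw [Finsupp.linearCombination_single, Finsupp.mapRange_single,
        Finsupp.linearCombination_single, Algebra.smul_def, map_mul, hg', Algebra.smul_def]
      rfl
  refine ⟨hs.extend (Set.subset_univ _), fun i => g' (B i), ⟨1, hs.subset_extend _ rfl⟩, ?_, ?_, ?_⟩
  · simp [B, g', Module.Basis.extend_apply_self]
  · intro q hq i
    rw [← Ideal.Quotient.eq_zero_iff_mem, hlin] at hq
    have := (linearIndependent_iff.1 B.linearIndependent) _ hq
    rw [← Ideal.Quotient.eq_zero_iff_mem]
    simpa using DFunLike.congr_fun this i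
  · intro c
    choose s hs using fun v : Q ⧸ m => Ideal.Quotient.mk_surjective v
    let s' : Q ⧸ m → Q := fun v => by classical exact if v = 0 then 0 else s v
    have hs' : ∀ v, Ideal.Quotient.mk m (s' v) = v := by
      intro v
      by_cases hv : v = 0
      · simp [s', hv]
      · simp [s', hv, hs]
    refine ⟨(B.repr (Ideal.Quotient.mk _ c)).mapRange s' (by simp [s']), ?_⟩
    rw [← Ideal.Quotient.eq_zero_iff_mem, map_sub, hlin, sub_eq_zero]
    conv_lhs => rw [← B.linearCombination_repr (Ideal.Quotient.mk _ c)]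
    congr 1
    ext i
    simp [hs']

theorem exists_sub_linearCombination_mem_pow {ι : Type*} {b : ι → C} {m : Ideal Q}
    (h : ∀ c, ∃ q : ι →₀ Q, c - Finsupp.linearCombination Q b q ∈ m.map (algebraMap Q C)) (n : ℕ)
    (c : C) : ∃ q : ι →₀ Q, c - Finsupp.linearCombination Q b q ∈ (m ^ n).map (algebraMap Q C) := by
  set N := LinearMap.range (Finsupp.linearCombination Q b)
  have h1 : N ⊔ m • (⊤ : Submodule Q C) = ⊤ := by
    rw [Ideal.smul_top_eq_map, eq_top_iff]
    intro c _
    obtain ⟨q, hq⟩ := h c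
    exact Submodule.mem_sup.2 ⟨_, ⟨q, rfl⟩, _, hq, add_sub_cancel _ _⟩
  have key : ∀ n, N ⊔ m ^ n • (⊤ : Submodule Q C) = ⊤ := by
    intro n
    induction n with
    | zero => rw [pow_zero, Submodule.one_smul, sup_top_eq]
    | succ n ih =>
      rw [eq_top_iff]
      calc ⊤ = N ⊔ m • (N ⊔ m ^ n • (⊤ : Submodule Q C)) := by rw [ih, h1]
        _ ≤ N ⊔ m ^ (n + 1) • (⊤ : Submodule Q C) := by
          rw [Submodule.smul_sup, pow_succ', ← smul_assoc, smul_eq_mul, ← sup_assoc]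
          exact sup_le_sup_right (sup_le le_rfl Submodule.smul_le_right) _
  have := key n
  rw [Ideal.smul_top_eq_map] at this
  obtain ⟨_, ⟨q, rfl⟩, z, hz, h⟩ := Submodule.mem_sup.1 (this ▸ Submodule.mem_top (x := c))
  exact ⟨q, by rw [← h, add_sub_cancel_left]; exact hz⟩

theorem exists_retraction [IsNoetherianRing Q] [IsLocalRing Q] {x : List Q}
    (hx : Ideal.ofList x = maximalIdeal Q) (hdQ : ∀ a ∈ x, DComplete a Q)
    (hdC : ∀ a ∈ x, DComplete (algebraMap Q C a) C) (hreg : RegMod ⊥ (x.map (algebraMap Q C)))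
    (h1 : (1 : C) ∉ Ideal.ofList (x.map (algebraMap Q C))) : ∃ α : C →ₗ[Q] Q, α 1 = 1 := by
  rw [← Ideal.map_ofList, hx] at h1
  obtain ⟨ι, b, i₀, hb1, hb, hspan⟩ := exists_indepMod h1
  let J : ℕ → Ideal Q := fun n => Ideal.ofList (x.map (· ^ n))
  have hJind : ∀ n, IndepMod b (J n) := fun n => by
    have := hb
    rw [← hx] at this
    simpa using IndepMod.ofList_map_pow (u := x) (v := []) (by simpa using this) (by simpa using hdC)
      (by simpa using hreg) n
  have hJle : ∀ n, ∃ N, maximalIdeal Q ^ N ≤ J n := fun n => by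
    rw [← hx]
    refine Ideal.exists_pow_le_of_le_radical_of_fg ?_ (IsNoetherian.noetherian _)
    rw [Ideal.ofList, Ideal.span_le]
    intro a ha
    exact ⟨n, Ideal.subset_span (s := {r | r ∈ x.map (· ^ n)}) (List.mem_map_of_mem ha)⟩
  have hJm : ∀ n, J n ≤ maximalIdeal Q ^ n := fun n => by
    rw [← hx]
    refine Ideal.span_le.2 fun z hz => ?_
    obtain ⟨a, ha, rfl⟩ := List.mem_map.1 hz
    exact Ideal.pow_mem_pow (Ideal.subset_span (s := {r | r ∈ x}) ha) n
  have hJanti : ∀ n, J (n + 1) ≤ J n := fun n => by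
    refine Ideal.span_le.2 fun z hz => ?_
    obtain ⟨a, ha, rfl⟩ := List.mem_map.1 hz
    simp only [pow_succ]
    exact Ideal.mul_mem_right _ _ (Ideal.subset_span (s := {r | r ∈ x.map (· ^ n)})
      (List.mem_map_of_mem ha))
  have hJzero : ∀ z, (∀ n, z ∈ J n) → z = 0 := fun z hz => by
    have := Ideal.iInf_pow_eq_bot_of_isLocalRing (maximalIdeal Q) (Ideal.IsPrime.ne_top inferInstance)
    rw [← Ideal.mem_bot, ← this, Ideal.mem_iInf]
    exact fun n => hJm n (hz n)
  have hspan' : ∀ n c, ∃ q : ι →₀ Q, c - Finsupp.linearCombination Q b q ∈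
      (J n).map (algebraMap Q C) := fun n c => by
    obtain ⟨N, hN⟩ := hJle n
    obtain ⟨q, hq⟩ := exists_sub_linearCombination_mem_pow hspan N c
    exact ⟨q, Ideal.map_mono hN hq⟩
  let Rel : C → Q → Prop := fun c z => ∀ n, ∃ q : ι →₀ Q, c - Finsupp.linearCombination Q b q ∈
      (J n).map (algebraMap Q C) ∧ q i₀ - z ∈ J n
  have hex : ∀ c, ∃ z, Rel c z := fun c => by
    choose q hq using fun n => hspan' n c
    obtain ⟨z, hz⟩ := DComplete.exists_limit hdQ (fun n => q n i₀) fun n => by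
      refine hJind n (q (n + 1) - q n) ?_ i₀
      rw [map_sub]
      have := Ideal.sub_mem _ (hq n) (Ideal.map_mono (hJanti n) (hq (n + 1)))
      rwa [sub_sub_sub_cancel_left] at this
    refine ⟨z, fun n => ⟨q n, hq n, ?_⟩⟩
    rw [← neg_mem_iff, neg_sub]
    exact hz n
  have huniq : ∀ c z z', Rel c z → Rel c z' → z = z' := fun c z z' h h' => by
    rw [← sub_eq_zero]
    refine hJzero _ fun n => ?_
    obtain ⟨q, hq, hqz⟩ := h n
    obtain ⟨q', hq', hqz'⟩ := h' n
    have := hJind n (q - q') (by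
      rw [map_sub]
      have := Ideal.sub_mem _ hq' hq
      rwa [sub_sub_sub_cancel_left] at this) i₀
    have h2 := Ideal.sub_mem _ this (Ideal.sub_mem _ hqz hqz')
    rw [Finsupp.sub_apply] at h2
    convert h2 using 1
    ring
  choose α hα using hex
  refine ⟨{ toFun := α, map_add' := fun c d => huniq (c + d) _ _ (hα _) fun n => ?_,
            map_smul' := fun a c => huniq (a • c) _ _ (hα _) fun n => ?_ }, ?_⟩
  · obtain ⟨q, hq, hqz⟩ := hα c n
    obtain ⟨q', hq', hqz'⟩ := hα d n
    refine ⟨q + q', ?_, ?_⟩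
    · rw [map_add, add_sub_add_comm]; exact add_mem hq hq'
    · rw [Finsupp.add_apply, add_sub_add_comm]; exact add_mem hqz hqz'
  · obtain ⟨q, hq, hqz⟩ := hα c n
    refine ⟨a • q, ?_, ?_⟩
    · rw [map_smul, ← smul_sub, Algebra.smul_def]; exact Ideal.mul_mem_left _ _ hq
    · rw [Finsupp.smul_apply, RingHom.id_apply, ← smul_sub]; exact Ideal.mul_mem_left _ _ hqz
  · refine huniq 1 _ _ (hα 1) fun n => ⟨Finsupp.single i₀ 1, ?_, ?_⟩ <;> simp [hb1]

end Retraction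

end

section

open IsLocalRing Polynomial


/-- Every monic polynomial of positive degree has a root. -/
def MonicRoot (A : Type*) [CommRing A] : Prop :=
  ∀ P : Polynomial A, P.Monic → 0 < P.degree → ∃ a : A, P.IsRoot a

namespace MonicRoot

variable {A : Type*} [CommRing A]

theorem exists_prod [Nontrivial A] (h : MonicRoot A) {P : A[X]} (hP : P.Monic) :
    ∃ s : Multiset A, P = (s.map fun a => X - C a).prod := by
  induction hn : P.natDegree generalizing P with
  | zero => exact ⟨0, by simpa using hP.natDegree_eq_zero.1 hn⟩
  | succ n ih =>
    obtain ⟨a, ha⟩ := h P hP (natDegree_pos_iff_degree_pos.1 (by omega))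
    obtain ⟨R, rfl⟩ := dvd_iff_isRoot.2 ha
    have hR := (monic_X_sub_C a).of_mul_monic_left hP
    obtain ⟨s, rfl⟩ := ih hR (by
      rw [(monic_X_sub_C a).natDegree_mul hR, natDegree_X_sub_C] at hn; omega)
    exact ⟨a ::ₘ s, by simp⟩

theorem exists_eq_of_isIntegral [IsDomain A] (h : MonicRoot A) {F : Type*} [CommRing F] [IsDomain F]
    (f : A →+* F) {z : F} (hz : f.IsIntegralElem z) : ∃ a, f a = z := by
  obtain ⟨P, hP, hz⟩ := hz
  obtain ⟨s, rfl⟩ := h.exists_prod hP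
  rw [eval₂_multiset_prod, Multiset.prod_eq_zero_iff] at hz
  simp only [Multiset.map_map, Multiset.mem_map, Function.comp_apply, eval₂_sub, eval₂_X,
    eval₂_C] at hz
  obtain ⟨a, -, ha⟩ := hz
  exact ⟨a, (sub_eq_zero.1 ha).symm⟩

theorem isIntegrallyClosed [IsDomain A] (h : MonicRoot A) : IsIntegrallyClosed A :=
  (isIntegrallyClosed_iff (FractionRing A)).2 fun hx => h.exists_eq_of_isIntegral _ hx

theorem exists_pow_eq [Nontrivial A] (h : MonicRoot A) (a : A) {n : ℕ} (hn : n ≠ 0) :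
    ∃ b, b ^ n = a := by
  obtain ⟨b, hb⟩ := h (X ^ n - C a) (monic_X_pow_sub_C a hn) (by
    rw [degree_X_pow_sub_C (Nat.pos_of_ne_zero hn)]; exact_mod_cast Nat.pos_of_ne_zero hn)
  exact ⟨b, by simpa [sub_eq_zero] using hb⟩

theorem dvd_of_pow_eq_sum [IsDomain A] (h : MonicRoot A) {a r : A} (hr : r ≠ 0) {k : ℕ}
    (q : Fin k → A) (ha : a ^ k = ∑ i : Fin k, q i * r ^ (k - i) * a ^ (i : ℕ)) : r ∣ a := by
  have key {F : Type _} [Field F] [Algebra A F] [IsFractionRing A F] : r ∣ a := by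
    have hs : algebraMap A F r ≠ 0 := fun h =>
      hr (IsFractionRing.injective A F (by rw [h, map_zero]))
    have hintg : (algebraMap A F).IsIntegralElem (algebraMap A F a / algebraMap A F r) := by
      refine ⟨X ^ k - ∑ i : Fin k, Polynomial.C (q i) * X ^ (i : ℕ),
        monic_X_pow_sub (degree_sum_fin_lt _), ?_⟩
      simp only [eval₂_sub, eval₂_pow, eval₂_X, eval₂_finsetSum, eval₂_mul, eval₂_C]
      rw [sub_eq_zero, div_pow, div_eq_iff (pow_ne_zero _ hs), ← map_pow, ha, map_sum,
        Finset.sum_mul]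
      refine Finset.sum_congr rfl fun i _ => ?_
      have : algebraMap A F r ^ k = algebraMap A F r ^ (k - i) * algebraMap A F r ^ (i : ℕ) := by
        rw [← pow_add, Nat.sub_add_cancel i.2.le]
      rw [this]
      simp only [map_mul, map_pow, div_pow]
      field_simp
    obtain ⟨b, hb⟩ := h.exists_eq_of_isIntegral _ hintg
    refine ⟨b, IsFractionRing.injective A F ?_⟩
    rw [map_mul, hb, mul_div_cancel₀ _ hs]
  exact key (F := FractionRing A)

end MonicRoot

theorem exists_mem_span_image_lt {Q M : Type*} [CommRing Q] [AddCommGroup M] [Module Q M]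
    [IsNoetherian Q M] (v : ℕ → M) : ∃ k, ∃ q : Fin k → Q, v k = ∑ i, q i • v i := by
  obtain ⟨n, hn⟩ := monotone_stabilizes_iff_noetherian.2 ‹IsNoetherian Q M›
    ⟨fun k => Submodule.span Q (Set.range fun i : Fin k => v i), fun k l hkl =>
      Submodule.span_mono (by rintro _ ⟨i, rfl⟩; exact ⟨Fin.castLE hkl i, rfl⟩)⟩
  have h1 : v n ∈ Submodule.span Q (Set.range fun i : Fin (n + 1) => v i) :=
    Submodule.subset_span ⟨Fin.last n, rfl⟩
  have h2 := hn (n + 1) n.le_succ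
  change Submodule.span Q (Set.range fun i : Fin n => v i) =
    Submodule.span Q (Set.range fun i : Fin (n + 1) => v i) at h2
  rw [← h2, Submodule.mem_span_range_iff_exists_fun] at h1
  obtain ⟨q, hq⟩ := h1
  exact ⟨n, q, hq.symm⟩

section Retraction

variable {Q D C : Type*} [CommRing Q] [CommRing D] [CommRing C] [Algebra Q D] [Algebra Q C]

theorem algebraMap_dvd_of_retraction [IsNoetherianRing Q] [IsDomain D] [Algebra.IsIntegral Q D]
    (hD : MonicRoot D) (j : D →ₐ[Q] C) (α : C →ₗ[Q] Q) (hα : α 1 = 1) {r : Q} {a : D}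
    (hr : algebraMap Q D r ≠ 0) (h : algebraMap Q C r ∣ j a) : algebraMap Q D r ∣ a := by
  obtain ⟨c, hc⟩ := h
  have hαj : ∀ q, α (j (algebraMap Q D q)) = q := fun q => by
    rw [AlgHom.commutes, Algebra.algebraMap_eq_smul_one, map_smul, hα, smul_eq_mul, mul_one]
  have : Nontrivial Q := (algebraMap Q D).domain_nontrivial
  let A := Algebra.adjoin Q {a}
  have : Module.Finite Q A := Algebra.finite_adjoin_simple_of_isIntegral (Algebra.IsIntegral.isIntegral a)
  have : IsNoetherian Q (A →ₗ[Q] Q) := isNoetherian_linearMap _ _ _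
  let L : ℕ → A →ₗ[Q] Q := fun k => α ∘ₗ LinearMap.mulRight Q (c ^ k) ∘ₗ j.toLinearMap ∘ₗ
    A.val.toLinearMap
  have hL : ∀ k d, L k d = α (j d * c ^ k) := fun k d => rfl
  obtain ⟨k, q, hq⟩ := exists_mem_span_image_lt (Q := Q) L
  let a' : A := ⟨a, Algebra.self_mem_adjoin_singleton Q a⟩
  let u : A := a' ^ k - ∑ i : Fin k, (q i * r ^ (k - i)) • a' ^ (i : ℕ)
  have hu : ∀ d : A, α (j (d * u : A)) = 0 := by
    intro d
    have h1 : j (d * u : A) = r ^ k • (j d * c ^ k - ∑ i, q i • (j d * c ^ (i : ℕ))) := by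
      simp only [u, a', mul_sub, AddSubgroupClass.coe_sub, Finset.mul_sum, MulMemClass.coe_mul,
        SubmonoidClass.coe_pow, AddSubmonoidClass.coe_finsetSum, SetLike.val_smul,
        map_sub, map_mul, map_sum, map_smul, map_pow, hc, smul_sub, Finset.smul_sum, mul_pow]
      simp only [Algebra.smul_def, map_mul, map_pow]
      congr 1
      · ring
      · refine Finset.sum_congr rfl fun i _ => ?_
        have : algebraMap Q C r ^ k = algebraMap Q C r ^ (k - i) * algebraMap Q C r ^ (i : ℕ) := by
          rw [← pow_add, Nat.sub_add_cancel i.2.le]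
        rw [this]
        ring
    rw [h1, map_smul, map_sub, map_sum]
    simp only [map_smul, ← hL]
    rw [hq]
    simp
  have hu0 : u = 0 := by
    by_contra hne
    have := Ideal.comap_ne_bot_of_integral_mem (R := Q) hne (Ideal.mem_span_singleton_self u)
      (Algebra.IsIntegral.isIntegral u)
    obtain ⟨z, hz, hz0⟩ := Submodule.exists_mem_ne_zero_of_ne_bot this
    obtain ⟨d, hd⟩ := Ideal.mem_span_singleton'.1 (Ideal.mem_comap.1 hz)
    refine hz0 ?_
    rw [← hαj z, ← hu d, hd]
    rfl
  refine hD.dvd_of_pow_eq_sum hr (k := k) (fun i => algebraMap Q D (q i)) ?_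
  have := congrArg (fun z : A => (z : D)) hu0
  simp only [u, a', AddSubgroupClass.coe_sub, SubmonoidClass.coe_pow,
    AddSubmonoidClass.coe_finsetSum, ZeroMemClass.coe_zero,
    Algebra.smul_def, map_mul, map_pow] at this
  exact sub_eq_zero.1 this

theorem dvd_of_retraction [IsNoetherianRing Q] [IsDomain D] [Algebra.IsIntegral Q D]
    (hD : MonicRoot D) (j : D →ₐ[Q] C) (α : C →ₗ[Q] Q) (hα : α 1 = 1) {s a : D}
    (hs : s ≠ 0) (h : j s ∣ j a) : s ∣ a := by
  have : Nontrivial Q := (algebraMap Q D).domain_nontrivial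
  have := Ideal.comap_ne_bot_of_integral_mem (R := Q) hs (Ideal.mem_span_singleton_self s)
    (Algebra.IsIntegral.isIntegral s)
  obtain ⟨r, hr, hr0⟩ := Submodule.exists_mem_ne_zero_of_ne_bot this
  obtain ⟨s', hs'⟩ := Ideal.mem_span_singleton.1 (Ideal.mem_comap.1 hr)
  have hinj : algebraMap Q D r ≠ 0 := by
    intro h0
    have : α (j (algebraMap Q D r)) = r := by
      rw [AlgHom.commutes, Algebra.algebraMap_eq_smul_one, map_smul, hα, smul_eq_mul, mul_one]
    rw [h0, map_zero, map_zero] at this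
    exact hr0 this.symm
  have h1 : algebraMap Q D r ∣ a * s' := by
    refine algebraMap_dvd_of_retraction hD j α hα hinj ?_
    rw [← AlgHom.commutes j, hs', map_mul, map_mul]
    exact mul_dvd_mul_right h _
  rw [hs'] at h1
  exact (mul_dvd_mul_iff_right (by rintro rfl; simp [hs'] at hinj)).1 h1

end Retraction

end

section

open IsLocalRing


section Dimension

universe u v

theorem ringKrullDim_le_length {E : Type*} [CommRing E] [IsNoetherianRing E] [IsLocalRing E]
    {l : List E} (h : (Ideal.ofList l).radical = maximalIdeal E) : ringKrullDim E ≤ l.length := by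
  classical
  rw [← maximalIdeal_height_eq_ringKrullDim]
  have hmin : maximalIdeal E ∈ (Ideal.span (l.toFinset : Set E)).minimalPrimes := by
    have : Ideal.span (l.toFinset : Set E) = Ideal.ofList l := by simp [Ideal.ofList]
    rw [this]
    refine ⟨⟨inferInstance, Ideal.le_radical.trans h.le⟩, fun P hP _ => ?_⟩
    rw [← h]
    exact hP.1.radical_le_iff.2 hP.2
  have := Ideal.height_le_card_of_mem_minimalPrimes_span_finset hmin
  exact_mod_cast this.trans (by exact_mod_cast l.toFinset_card_le)

theorem radical_eq_of_mem_minimalPrimes {E : Type*} [CommRing E] [IsLocalRing E] {I : Ideal E}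
    (h : maximalIdeal E ∈ I.minimalPrimes) : I.radical = maximalIdeal E := by
  refine le_antisymm ((Ideal.IsPrime.radical_le_iff inferInstance).2 h.1.2) ?_
  rw [Ideal.radical_eq_sInf]
  exact le_sInf fun P hP => h.2 ⟨hP.2, hP.1⟩ (le_maximalIdeal hP.2.ne_top)

theorem exists_radical_ofList_append_eq {E : Type*} [CommRing E] [IsNoetherianRing E]
    [IsLocalRing E] {u : List E} (hu : ∀ a ∈ u, a ∈ maximalIdeal E) :
    ∃ z : List E, (z.length : WithBot ℕ∞) = ringKrullDim (E ⧸ Ideal.ofList u) ∧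
      (∀ a ∈ z, a ∈ maximalIdeal E) ∧ (Ideal.ofList (u ++ z)).radical = maximalIdeal E := by
  have hu' : Ideal.ofList u ≤ maximalIdeal E := Ideal.span_le.2 hu
  have : Nontrivial (E ⧸ Ideal.ofList u) :=
    Ideal.Quotient.nontrivial_iff.2 fun h => (Ideal.IsPrime.ne_top inferInstance) (top_le_iff.1 (h ▸ hu'))
  have hloc := IsLocalRing.of_surjective' (Ideal.Quotient.mk (Ideal.ofList u))
    Ideal.Quotient.mk_surjective
  have hmap : (maximalIdeal (E ⧸ Ideal.ofList u)).comap (Ideal.Quotient.mk (Ideal.ofList u)) =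
      maximalIdeal E := by
    have := Ideal.comap_isMaximal_of_surjective (Ideal.Quotient.mk (Ideal.ofList u))
      Ideal.Quotient.mk_surjective (K := maximalIdeal (E ⧸ Ideal.ofList u))
    exact eq_maximalIdeal this
  obtain ⟨s, hs, hcard⟩ := Ideal.exists_finset_card_eq_height_of_isNoetherianRing
    (maximalIdeal (E ⧸ Ideal.ofList u))
  obtain ⟨z, hz⟩ := List.map_surjective_iff.2 (Ideal.Quotient.mk_surjective (I := Ideal.ofList u)) s.toList
  have hspan : Ideal.ofList (z.map (Ideal.Quotient.mk (Ideal.ofList u))) = Ideal.span s := by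
    rw [hz]; simp [Ideal.ofList]
  have hrad : (Ideal.ofList (u ++ z)).radical = maximalIdeal E := by
    have := RegMod.ofList_comap (f := Ideal.Quotient.mk (Ideal.ofList u))
      Ideal.Quotient.mk_surjective ⊥ (l := z)
    rw [bot_sup_eq, ← RingHom.ker_eq_comap_bot, Ideal.mk_ker] at this
    rw [Ideal.ofList_append, ← hmap, ← radical_eq_of_mem_minimalPrimes hs, Ideal.comap_radical,
      ← hspan, this]
  refine ⟨z, ?_, fun a ha => ?_, hrad⟩
  · rw [← maximalIdeal_height_eq_ringKrullDim, ← hcard, ← s.length_toList, ← hz, List.length_map]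
    rfl
  · rw [← hrad]
    exact Ideal.le_radical (Ideal.subset_span (s := {r | r ∈ u ++ z}) (by simp [ha]))

theorem ringKrullDim_quotient_succ_le_of_forall_minimalPrimes {R : Type*} [CommRing R] {r : R}
    (hr : ∀ P ∈ minimalPrimes R, r ∉ P) :
    ringKrullDim (R ⧸ Ideal.span {r}) + 1 ≤ ringKrullDim R := by
  by_cases hr' : Ideal.span {r} = ⊤
  · rw [hr', ringKrullDim_eq_bot_of_subsingleton]
    simp
  have : Nonempty (PrimeSpectrum.zeroLocus (R := R) (Ideal.span {r})) := by
    rwa [Set.nonempty_coe_sort, Set.nonempty_iff_ne_empty, ne_eq,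
      PrimeSpectrum.zeroLocus_empty_iff_eq_top]
  have := Ideal.Quotient.nontrivial_iff.mpr hr'
  have := (Ideal.Quotient.mk (Ideal.span {r})).domain_nontrivial
  rw [ringKrullDim_quotient, Order.krullDim_eq_iSup_length, ringKrullDim,
    Order.krullDim_eq_iSup_length, ← WithBot.coe_one, ← WithBot.coe_add,
    ENat.iSup_add, WithBot.coe_le_coe, iSup_le_iff]
  intro l
  obtain ⟨p, hp, hp'⟩ := Ideal.exists_minimalPrimes_le (J := l.head.1.asIdeal) bot_le
  let p' : PrimeSpectrum R := ⟨p, hp.1.1⟩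
  have hp' : p' < l.head := lt_of_le_of_ne hp' fun h => hr p hp
    (show r ∈ p by simpa [← h] using l.head.2)
  refine le_trans ?_ (le_iSup _ ((l.map Subtype.val (fun _ _ => id)).cons p' hp'))
  simp [RelSeries.cons, RelSeries.append]
  rfl

theorem RegMod.length_le_ringKrullDim {E : Type u} {C : Type v} [CommRing E] [CommRing C]
    (φ : E →+* C) (l : List E) (h : RegMod ⊥ (l.map φ)) (h1 : (1 : C) ∉ Ideal.ofList (l.map φ)) :
    (l.length : WithBot ℕ∞) ≤ ringKrullDim E := by
  induction hn : l.length generalizing E C with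
  | zero =>
    obtain rfl := List.length_eq_zero_iff.1 hn
    have : Nontrivial C := ⟨1, 0, fun h => h1 (by simp [h])⟩
    have := φ.domain_nontrivial
    simpa using ringKrullDim_nonneg_of_nontrivial
  | succ n ih =>
    obtain ⟨a, l, rfl⟩ := List.exists_cons_of_length_eq_add_one hn
    obtain rfl : l.length = n := by simpa using hn
    let K := RingHom.ker φ
    let ψ : E ⧸ K →+* C := RingHom.kerLift φ
    have ha : Ideal.Quotient.mk K a ∈ nonZeroDivisors (E ⧸ K) := by
      rw [mem_nonZeroDivisors_iff_right]
      intro x hx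
      refine RingHom.kerLift_injective φ ?_
      rw [map_zero]
      have := congrArg ψ hx
      rw [map_mul, map_zero, mul_comm] at this
      exact h.1 _ this
    let E' := (E ⧸ K) ⧸ Ideal.span {Ideal.Quotient.mk K a}
    let φ' : E' →+* C ⧸ Ideal.span {φ a} := Ideal.Quotient.lift _
      ((Ideal.Quotient.mk (Ideal.span {φ a})).comp ψ) (by
        intro x hx
        obtain ⟨y, rfl⟩ := Ideal.mem_span_singleton.1 hx
        rw [map_mul]
        have : (Ideal.Quotient.mk (Ideal.span {φ a})) (ψ (Ideal.Quotient.mk K a)) = 0 :=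
          Ideal.Quotient.eq_zero_iff_mem.2 (Ideal.mem_span_singleton_self _)
        rw [RingHom.comp_apply, this, zero_mul])
    have hmap : (l.map ((Ideal.Quotient.mk _).comp (Ideal.Quotient.mk K) : E →+* E')).map φ' = 
        (l.map φ).map (Ideal.Quotient.mk (Ideal.span {φ a})) := by
      rw [List.map_map, List.map_map]; rfl
    have h2 := ih φ' (l.map ((Ideal.Quotient.mk _).comp (Ideal.Quotient.mk K))) (by
      rw [hmap]
      refine RegMod.quotient ?_
      have := h.2
      rwa [bot_sup_eq] at this) (by
      rw [hmap]
      intro h2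
      refine h1 ?_
      have := (RegMod.ofList_comap (f := Ideal.Quotient.mk (Ideal.span {φ a}))
        Ideal.Quotient.mk_surjective ⊥ (l := l.map φ)).le (x := 1) (by
          rw [Ideal.mem_comap, map_one]; exact Ideal.mem_sup_right h2)
      rw [← RingHom.ker_eq_comap_bot, Ideal.mk_ker] at this
      rwa [List.map_cons, Ideal.ofList_cons]) (by simp)
    calc _ = ((l.map ((Ideal.Quotient.mk _).comp (Ideal.Quotient.mk K) : E →+* E')).length : WithBot ℕ∞) + 1 := by simp
      _ ≤ ringKrullDim E' + 1 := by gcongr; simpa using h2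
      _ ≤ ringKrullDim (E ⧸ K) := ringKrullDim_quotient_succ_le_of_nonZeroDivisor ha
      _ ≤ ringKrullDim E := ringKrullDim_quotient_le _

end Dimension

end

section

open IsLocalRing


theorem DComplete.subsingleton_of_le {R : Type*} {M : Type*} [CommRing R] [AddCommGroup M]
    [Module R M] {l : List R} (hl : ∀ a ∈ l, DComplete a M)
    (h : ⊤ ≤ Ideal.ofList l • (⊤ : Submodule R M)) : Subsingleton M := by
  induction hn : l.length generalizing l M with
  | zero =>
    obtain rfl := List.length_eq_zero_iff.1 hn
    rw [Ideal.ofList_nil, Submodule.bot_smul] at h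
    exact (Submodule.subsingleton_iff R).1 ⟨fun a b => by
      rw [le_bot_iff.1 (le_top.trans h : a ≤ ⊥), le_bot_iff.1 (le_top.trans h : b ≤ ⊥)]⟩
  | succ n ih =>
    obtain ⟨a, l, rfl⟩ := List.exists_cons_of_length_eq_add_one hn
    obtain rfl : l.length = n := by simpa using hn
    let A : M →ₗ[R] M := LinearMap.lsmul R M a
    have hdc : ∀ b ∈ l, DComplete b (M ⧸ LinearMap.range A) := fun b hb =>
      DComplete.of_exact (LinearMap.range A).mkQ A (Submodule.mkQ_surjective _)
        (by rw [Submodule.ker_mkQ]) (fun x => by simp) (hl b (by simp [hb])) (hl b (by simp [hb]))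
    have hs : Subsingleton (M ⧸ LinearMap.range A) := by
      refine ih hdc ?_ rfl
      have := Submodule.map_mono (f := (LinearMap.range A).mkQ) h
      rw [Submodule.map_top, Submodule.range_mkQ, Submodule.map_smul'', Submodule.map_top,
        Submodule.range_mkQ, Ideal.ofList_cons, Submodule.sup_smul] at this
      refine this.trans (sup_le ?_ le_rfl)
      rw [Submodule.ideal_span_singleton_smul]
      rintro _ ⟨y, -, rfl⟩
      obtain ⟨y, rfl⟩ := Submodule.mkQ_surjective _ y
      have : a • (LinearMap.range A).mkQ y = 0 := by
        rw [← map_smul]; exact (Submodule.Quotient.mk_eq_zero _).2 ⟨y, rfl⟩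
      change a • (LinearMap.range A).mkQ y ∈ _
      rw [this]; exact zero_mem _
    have hA : ∀ y : M, ∃ z, y = a • z := fun y => by
      have : y ∈ LinearMap.range A := (Submodule.Quotient.mk_eq_zero _).1 (Subsingleton.elim _ _)
      obtain ⟨z, hz⟩ := this
      exact ⟨z, hz.symm⟩
    choose g hg using hA
    refine subsingleton_of_forall_eq 0 fun y => ?_
    exact (hl a (by simp)).eq_zero (e := fun n => g^[n] y) (fun n => by
      rw [Function.iterate_succ_apply']; exact hg _) 0

theorem Module.Finite.of_radical_ofList_eq {Q : Type*} {E : Type*} [CommRing Q] [CommRing E]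
    [Algebra Q E] [IsNoetherianRing E] [IsLocalRing E] {x : List Q}
    (hdQ : ∀ a ∈ x, DComplete a Q) (hdE : ∀ a ∈ x, DComplete (algebraMap Q E a) E)
    (hrad : (Ideal.ofList (x.map (algebraMap Q E))).radical = maximalIdeal E)
    (hres : ∀ e : E, ∃ q, e - algebraMap Q E q ∈ maximalIdeal E) : Module.Finite Q E := by
  classical
  have key : ∀ k : ℕ, ∃ F : Submodule Q E, F.FG ∧
      ∀ e, ∃ f ∈ F, e - f ∈ maximalIdeal E ^ k := by
    intro k
    induction k with
    | zero => exact ⟨⊥, Submodule.fg_bot, fun e => ⟨0, by simp, by simp⟩⟩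
    | succ k ih =>
      obtain ⟨F, hF, hFe⟩ := ih
      obtain ⟨T, hT⟩ := (isNoetherianRing_iff_ideal_fg E).1 inferInstance (maximalIdeal E ^ k)
      refine ⟨F ⊔ Submodule.span Q T, hF.sup ⟨T, rfl⟩, fun e => ?_⟩
      have h2 : ∀ μ ∈ maximalIdeal E ^ k, ∃ f ∈ Submodule.span Q (T : Set E),
          μ - f ∈ maximalIdeal E ^ (k + 1) := by
        intro μ hμ
        rw [← hT] at hμ
        induction hμ using Submodule.span_induction with
        | mem t ht => exact ⟨t, Submodule.subset_span ht, by simp⟩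
        | zero => exact ⟨0, by simp, by simp⟩
        | add u v _ _ hu hv =>
          obtain ⟨f, hf, hf'⟩ := hu
          obtain ⟨g, hg, hg'⟩ := hv
          exact ⟨f + g, add_mem hf hg, by rw [add_sub_add_comm]; exact add_mem hf' hg'⟩
        | smul c u hu0 hu =>
          obtain ⟨f, hf, hf'⟩ := hu
          obtain ⟨q, hq⟩ := hres c
          refine ⟨q • f, Submodule.smul_mem _ _ hf, ?_⟩
          have hfm : f ∈ maximalIdeal E ^ k := by
            have : Submodule.span Q (T : Set E) ≤ (maximalIdeal E ^ k).restrictScalars Q :=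
              Submodule.span_le.2 fun t ht => by
                change t ∈ maximalIdeal E ^ k
                rw [← hT]; exact Submodule.subset_span ht
            exact this hf
          have : c • u - q • f = c * (u - f) + (c - algebraMap Q E q) * f := by
            rw [Algebra.smul_def q f, smul_eq_mul]; ring
          rw [this, pow_succ']
          refine add_mem (Ideal.mul_mem_left _ _ (by rwa [← pow_succ'])) (Ideal.mul_mem_mul hq hfm)
      obtain ⟨f, hf, hf'⟩ := hFe e
      obtain ⟨g, hg, hg'⟩ := h2 _ hf'
      exact ⟨f + g, Submodule.add_mem_sup hf hg, by rwa [← sub_sub]⟩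
  obtain ⟨N, hN⟩ := Ideal.exists_radical_pow_le_of_fg (Ideal.ofList (x.map (algebraMap Q E)))
    (IsNoetherian.noetherian _)
  rw [hrad] at hN
  obtain ⟨F, hF, hFe⟩ := key N
  obtain ⟨n, s, hs⟩ := Submodule.fg_iff_exists_fin_generating_family.1 hF
  have hdE' : ∀ a ∈ x, DComplete a E := fun a ha =>
    (DComplete.of_ringHom (algebraMap Q E) a E (fun r m => Algebra.smul_def r m)).2 (hdE a ha)
  have hdF : ∀ a ∈ x, DComplete a (E ⧸ F) := fun a ha => by
    refine DComplete.of_exact F.mkQ (Fintype.linearCombination Q s) (Submodule.mkQ_surjective F)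
      ?_ ?_ (hdE' a ha) (DComplete.pi fun _ => hdQ a ha)
    · rw [Submodule.ker_mkQ, Fintype.range_linearCombination, hs]
    · intro y
      have : Fintype.linearCombination Q s y ∈ F := by
        rw [← hs, ← Fintype.range_linearCombination]; exact ⟨y, rfl⟩
      exact (Submodule.Quotient.mk_eq_zero F).2 this
  have hsub : Subsingleton (E ⧸ F) := by
    refine DComplete.subsingleton_of_le hdF fun y _ => ?_
    obtain ⟨e, rfl⟩ := Submodule.mkQ_surjective _ y
    obtain ⟨f, hf, hfe⟩ := hFe e
    have h1 : F.mkQ e = F.mkQ (e - f) := by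
      rw [map_sub, show F.mkQ f = 0 from (Submodule.Quotient.mk_eq_zero F).2 hf, sub_zero]
    have h2 := hN hfe
    rw [h1]
    rw [← Ideal.map_ofList, Ideal.map] at h2
    change e - f ∈ ((Ideal.ofList x).map (algebraMap Q E)).restrictScalars Q at h2
    rw [← Ideal.smul_top_eq_map] at h2
    have h3 := Submodule.mem_map_of_mem (f := F.mkQ) h2
    rwa [Submodule.map_smul'', Submodule.map_top, Submodule.range_mkQ] at h3
  rw [Submodule.Quotient.subsingleton_iff] at hsub
  exact ⟨hsub ▸ hF⟩

theorem injective_of_ofList_eq {Q : Type*} {E : Type*} [CommRing Q] [IsDomain Q] [IsNoetherianRing Q]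
    [IsLocalRing Q] [CommRing E] [IsNoetherianRing E] [IsLocalRing E] (φ : Q →+* E) {x : List Q}
    (hx : Ideal.ofList x = maximalIdeal Q)
    (hrad : (Ideal.ofList (x.map φ)).radical = maximalIdeal E)
    (hdim : (x.length : WithBot ℕ∞) = ringKrullDim E) : Function.Injective φ := by
  rw [injective_iff_map_eq_zero]
  intro f hf
  by_contra hf0
  have hfm : f ∈ maximalIdeal Q := (mem_maximalIdeal _).2 fun hu => by
    simpa [hf] using hu.map φ
  obtain ⟨z, hzl, hz, hzr⟩ := exists_radical_ofList_append_eq (u := [f]) (by simpa)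
  have h1 : ringKrullDim (Q ⧸ Ideal.span {f}) + 1 ≤ ringKrullDim Q :=
    ringKrullDim_quotient_succ_le_of_forall_minimalPrimes fun P hP => by
      rw [IsDomain.minimalPrimes_eq_singleton_bot] at hP
      obtain rfl := Set.mem_singleton_iff.1 hP
      simpa using hf0
  have h2 : ringKrullDim Q ≤ x.length := ringKrullDim_le_length (by
    rw [hx]; exact (Ideal.IsPrime.isRadical inferInstance).radical)
  have h3 : ringKrullDim E ≤ z.length := by
    have := ringKrullDim_le_length (l := z.map φ) (by
      refine le_antisymm ?_ ?_
      · rw [← hrad]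
        refine Ideal.radical_le_radical_iff.2 ?_
        refine Ideal.span_le.2 fun a ha => ?_
        obtain ⟨b, hb, rfl⟩ := List.mem_map.1 ha
        have := hz b hb
        rw [← hx] at this
        have := Ideal.mem_map_of_mem φ this
        rw [Ideal.map_ofList] at this
        exact Ideal.le_radical this
      · rw [← hrad]
        refine Ideal.radical_le_radical_iff.2 ?_
        refine Ideal.span_le.2 fun a ha => ?_
        obtain ⟨b, hb, rfl⟩ := List.mem_map.1 ha
        have : b ∈ maximalIdeal Q := by
          rw [← hx]; exact Ideal.subset_span hb
        rw [← hzr] at this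
        obtain ⟨n, hn⟩ := this
        refine ⟨n, ?_⟩
        have := Ideal.mem_map_of_mem φ hn
        rw [Ideal.map_ofList, List.map_append, Ideal.ofList_append] at this
        simpa [hf] using this)
    simpa using this
  rw [Ideal.ofList_singleton] at hzl
  rw [← hzl] at h1
  have h4 := (h1.trans h2).trans (hdim.le.trans h3)
  have : z.length + 1 ≤ z.length := by exact_mod_cast h4
  omega

theorem ringKrullDim_le_of_isIntegral {Q : Type*} {E : Type*} [CommRing Q] [CommRing E]
    [Algebra Q E] [Algebra.IsIntegral Q E] (hinj : Function.Injective (algebraMap Q E)) :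
    ringKrullDim Q ≤ ringKrullDim E := by
  cases subsingleton_or_nontrivial Q
  · rw [ringKrullDim_eq_bot_of_subsingleton]; exact bot_le
  rw [ringKrullDim, Order.krullDim]
  refine iSup_le fun l : LTSeries (PrimeSpectrum Q) => ?_
  have := l.head.2
  obtain ⟨P, -, hP, hPl⟩ := Ideal.exists_ideal_over_prime_of_isIntegral l.head.asIdeal (⊥ : Ideal E)
    (by rw [← RingHom.ker_eq_comap_bot, (RingHom.injective_iff_ker_eq_bot _).1 hinj]; exact bot_le)
  have : P.LiesOver l.head.asIdeal := ⟨hPl.symm⟩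
  obtain ⟨L, hL, -, -⟩ := Ideal.exists_ltSeries_of_hasGoingUp l P
  rw [← hL]
  exact le_iSup (fun l : LTSeries (PrimeSpectrum E) => (l.length : WithBot ℕ∞)) L

end

section

open IsLocalRing


/-- The list `l` is a system of parameters of `E`. -/
structure IsParam (E : Type*) [CommRing E] [IsLocalRing E] (l : List E) : Prop where
  length_eq : (l.length : WithBot ℕ∞) = ringKrullDim E
  radical_eq : (Ideal.ofList l).radical = maximalIdeal E

/-- `φ` makes the target a big Cohen-Macaulay algebra over `E`. -/
def CMHom {E : Type*} {C : Type*} [CommRing E] [IsLocalRing E] [CommRing C] (φ : E →+* C) : Prop :=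
  ∀ l, IsParam E l → RegMod ⊥ (l.map φ) ∧ (1 : C) ∉ Ideal.ofList (l.map φ)

namespace IsParam

variable {E : Type*} [CommRing E] [IsLocalRing E] {l : List E}

theorem mem (h : IsParam E l) {a : E} (ha : a ∈ l) : a ∈ maximalIdeal E := by
  rw [← h.radical_eq]
  exact Ideal.le_radical (Ideal.subset_span (s := {r | r ∈ l}) ha)

theorem length_le [IsNoetherianRing E] (h : IsParam E l) {z : List E}
    (hz : (Ideal.ofList z).radical = maximalIdeal E) : l.length ≤ z.length := by
  have := h.length_eq.le.trans (ringKrullDim_le_length hz)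
  exact_mod_cast this

theorem exists_cons [IsNoetherianRing E] [IsDomain E] {a : E} (ha : a ∈ maximalIdeal E)
    (ha0 : a ≠ 0) : ∃ l, IsParam E (a :: l) := by
  obtain ⟨z, hzl, -, hzr⟩ := exists_radical_ofList_append_eq (u := [a]) (by simpa)
  refine ⟨z, le_antisymm ?_ (ringKrullDim_le_length hzr), hzr⟩
  have h1 : ringKrullDim (E ⧸ Ideal.span {a}) + 1 ≤ ringKrullDim E :=
    ringKrullDim_quotient_succ_le_of_forall_minimalPrimes fun P hP => by
      rw [IsDomain.minimalPrimes_eq_singleton_bot] at hP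
      obtain rfl := Set.mem_singleton_iff.1 hP
      simpa using ha0
  rw [Ideal.ofList_singleton] at hzl
  rw [← hzl] at h1
  simpa using h1

theorem exists_param (E : Type*) [CommRing E] [IsLocalRing E] [IsNoetherianRing E] [IsDomain E] :
    ∃ l, IsParam E l := by
  by_cases h : maximalIdeal E = ⊥
  · refine ⟨[], ?_, ?_⟩
    · have : IsField E := IsLocalRing.isField_iff_maximalIdeal_eq.2 h
      rw [ringKrullDim_eq_zero_of_isField this]; rfl
    · rw [h, Ideal.ofList_nil]; exact (Ideal.isPrime_bot).isRadical.radical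
  · obtain ⟨a, ha, ha0⟩ := Submodule.exists_mem_ne_zero_of_ne_bot h
    exact ⟨_, (exists_cons ha ha0).choose_spec⟩

theorem cmHom [IsNoetherianRing E] {C : Type*} [CommRing C] {φ : E →+* C}
    (hdc : ∀ a ∈ maximalIdeal E, DComplete (φ a) C) (hl : IsParam E l)
    (hreg : RegMod ⊥ (l.map φ)) (h1 : (1 : C) ∉ Ideal.ofList (l.map φ)) : CMHom φ := by
  intro y hy
  refine ⟨RegMod.of_radical_eq φ hdc (n := l.length) (fun z => hl.length_le) l y rfl
    (le_antisymm (hy.length_le hl.radical_eq) (hl.length_le hy.radical_eq)) hl.radical_eq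
    hy.radical_eq hreg, fun h2 => h1 ?_⟩
  have h3 : (Ideal.ofList (l.map φ)).radical = ⊤ := by
    refine top_le_iff.1 (((Ideal.eq_top_iff_one _).2 h2).ge.trans ?_)
    rw [← Ideal.map_ofList, ← Ideal.map_ofList, Ideal.map_le_iff_le_comap, Ideal.comap_radical]
    refine Ideal.le_radical.trans ?_
    rw [hy.radical_eq, ← hl.radical_eq]
    exact Ideal.radical_mono Ideal.le_comap_map
  exact (Ideal.eq_top_iff_one _).1 (Ideal.radical_eq_top.1 h3)

end IsParam

theorem IsSOP.isParam {E : Type*} [CommRing E] [IsLocalRing E] {d : ℕ} {x : Fin d → E}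
    (h : IsSOP E x) : IsParam E (List.ofFn x) :=
  ⟨by simpa using h.1, by
    rw [← h.2.2]; simp only [Ideal.ofList, List.mem_ofFn]; rfl⟩

theorem isRegSeq_of_regMod {C : Type*} [CommRing C] {m : ℕ} {y : Fin m → C}
    (h : RegMod ⊥ (List.ofFn y)) (h1 : (1 : C) ∉ Ideal.ofList (List.ofFn y)) : IsRegSeq y := by
  refine ⟨fun i b hb => ?_, fun h2 => h1 ?_⟩
  · have h3 : Ideal.span (y '' {j | j < i}) = Ideal.ofList ((List.ofFn y).take i) := by
      simp only [Ideal.ofList]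
      congr 1
      ext c
      simp only [Set.mem_image, Set.mem_ofPred_eq, List.mem_take_iff_getElem, List.length_ofFn,
        List.getElem_ofFn]
      constructor
      · rintro ⟨j, hj, rfl⟩
        exact ⟨j, by have : (j : ℕ) < i := hj; omega, rfl⟩
      · rintro ⟨j, hj, rfl⟩
        exact ⟨⟨j, by omega⟩, Fin.lt_def.2 (by simp; omega), rfl⟩
    rw [h3] at hb ⊢
    have h4 : List.ofFn y = (List.ofFn y).take i ++ (y i :: (List.ofFn y).drop (i + 1)) := by
      conv_lhs => rw [← List.take_append_drop i (List.ofFn y)]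
      rw [List.drop_eq_getElem_cons (by simp)]
      simp
    rw [h4, RegMod.append, bot_sup_eq] at h
    exact h.2.1 b hb
  · rw [Ideal.eq_top_iff_one] at h2
    have : Set.range y = {r | r ∈ List.ofFn y} := by ext; simp [List.mem_ofFn]
    rw [this] at h2
    exact h2

theorem CMHom.isBigCM {E : Type*} {C : Type*} [CommRing E] [IsLocalRing E] [CommRing C]
    {φ : E →+* C} (h : CMHom φ) : IsBigCM φ := fun d x hx => by
  have := h _ hx.isParam
  rw [List.map_ofFn] at this
  exact isRegSeq_of_regMod this.1 this.2

end

section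

open IsLocalRing


universe u v

theorem Ideal.exists_mul_pow_mem_of_mem_minimalPrimes {R : Type*} [CommRing R] {I P : Ideal R}
    (hP : P ∈ I.minimalPrimes) {a : R} (ha : a ∈ P) : ∃ h ∉ P, ∃ n : ℕ, h * a ^ n ∈ I := by
  have := hP.1.1
  let S : Submonoid R := P.primeCompl ⊔ Submonoid.powers a
  by_contra! H
  have hd : Disjoint (I : Set R) S := by
    rw [Set.disjoint_left]
    intro x hx hxS
    obtain ⟨h, hh, _, ⟨n, rfl⟩, rfl⟩ := Submonoid.mem_sup.1 hxS
    exact H h hh n hx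
  obtain ⟨P', hP', hI, hd'⟩ := Ideal.exists_le_prime_disjoint I S hd
  rw [Set.disjoint_left] at hd'
  have h1 : P' ≤ P := fun x hx => by
    by_contra hxP
    exact hd' hx (Submonoid.mem_sup_left (S := P.primeCompl) hxP)
  exact hd' (hP.2 ⟨hP', hI⟩ h1 ha) (Submonoid.mem_sup_right (Submonoid.mem_powers a))

namespace RegMod

theorem mem_ofList_pi {ι : Type*} {C : ι → Type*} [∀ i, CommRing (C i)] {l : List (∀ i, C i)}
    {b : ∀ i, C i} : b ∈ Ideal.ofList l ↔ ∀ i, b i ∈ Ideal.ofList (l.map fun a => a i) := by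
  induction l generalizing b with
  | nil => simp [funext_iff]
  | cons a l ih =>
    simp_rw [List.map_cons, Ideal.ofList_cons]
    rw [sup_comm, mem_sup_span]
    simp_rw [ih, fun i => sup_comm (Ideal.span {a i}) (Ideal.ofList (l.map fun a => a i)),
      mem_sup_span]
    constructor
    · rintro ⟨c, hc⟩ i
      exact ⟨c i, hc i⟩
    · intro h
      choose c hc using h
      exact ⟨c, hc⟩

theorem pi {ι : Type*} {C : ι → Type*} [∀ i, CommRing (C i)] {v l : List (∀ i, C i)}
    (h : ∀ i, RegMod (Ideal.ofList (v.map fun a => a i)) (l.map fun a => a i)) :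
    RegMod (Ideal.ofList v) l := by
  induction l generalizing v with
  | nil => trivial
  | cons a l ih =>
    refine ⟨fun b hb => ?_, ?_⟩
    · rw [mem_ofList_pi] at hb ⊢
      exact fun i => (h i).1 _ (hb i)
    · have := ih (v := v ++ [a]) fun i => by simpa [Ideal.ofList_append] using (h i).2
      simpa [Ideal.ofList_append] using this

theorem map_localization {A B : Type*} [CommRing A] [CommRing B] [Algebra A B] (S : Submonoid A)
    [IsLocalization S B] {I : Ideal A} {l : List A} (h : RegMod I l) :
    RegMod (I.map (algebraMap A B)) (l.map (algebraMap A B)) := by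
  induction l generalizing I with
  | nil => trivial
  | cons a l ih =>
    refine ⟨fun b hb => ?_, ?_⟩
    · obtain ⟨x, s, rfl⟩ := IsLocalization.exists_mk'_eq S b
      rw [← IsLocalization.mk'_one (M := S) B a, ← IsLocalization.mk'_mul, one_mul,
        IsLocalization.mk'_mem_map_algebraMap_iff] at hb
      rw [IsLocalization.mk'_mem_map_algebraMap_iff]
      obtain ⟨m, hm, hmx⟩ := hb
      exact ⟨m, hm, h.1 _ (by rwa [mul_left_comm])⟩
    · have := ih h.2
      rwa [Ideal.map_sup, Ideal.map_span, Set.image_singleton] at this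

theorem localization_pi {ι : Type*} {C : ι → Type*} [∀ i, CommRing (C i)]
    (S : Submonoid (∀ i, C i)) {l : List (∀ i, C i)} (h : ∀ i, RegMod ⊥ (l.map fun a => a i)) :
    RegMod ⊥ (l.map (algebraMap _ (Localization S))) := by
  have h1 := map_localization (B := Localization S) S (pi (v := []) (by simpa using h))
  simpa using h1

theorem one_mem_localization_pi {ι : Type*} {C : ι → Type*} [∀ i, CommRing (C i)]
    (S : Submonoid (∀ i, C i)) {l : List (∀ i, C i)}
    (h : 1 ∈ Ideal.ofList (l.map (algebraMap _ (Localization S)))) :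
    ∃ u ∈ S, ∀ i, u i ∈ Ideal.ofList (l.map fun a => a i) := by
  rw [← Ideal.map_ofList, IsLocalization.mem_map_algebraMap_iff S] at h
  obtain ⟨⟨x, s⟩, hx⟩ := h
  rw [one_mul] at hx
  obtain ⟨c, hc⟩ := (IsLocalization.eq_iff_exists S _).1 hx
  refine ⟨c * s, (c * s).2, mem_ofList_pi.1 ?_⟩
  rw [hc]
  exact Ideal.mul_mem_left _ _ x.2

end RegMod

theorem RegMod.exists_kill {p : ℕ} (hp : 1 < p) {D : Type v} {C : Type u} [CommRing D] [IsDomain D]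
    (hD : MonicRoot D) [CommRing C] (j : D →+* C) (hdvd : ∀ s a, s ≠ 0 → j s ∣ j a → s ∣ a)
    {t : D} (ht : t ≠ 0) {y : List C} (hreg : RegMod ⊥ (j t :: y))
    (hdc : ∀ a ∈ y, DComplete a C) {𝔮 : Ideal D} (h𝔮 : 𝔮 ∈ (Ideal.span {t}).minimalPrimes) :
    ∃ (C' : Type u) (_ : CommRing C') (θ : C →+* C'), (∀ a ∈ 𝔮, θ (j a) = 0) ∧
      RegMod ⊥ (y.map θ) ∧ (1 : C') ∉ Ideal.ofList (y.map θ) ∧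
      ∀ a ∈ y, DComplete (θ a) C' := by
  have := h𝔮.1.1
  have := hD.isIntegrallyClosed
  have hp0 : p ≠ 0 := by omega
  choose rt hrt using fun a : D => hD.exists_pow_eq a hp0
  have hiter : ∀ a : D, ∀ e : ℕ, rt^[e] a ^ p ^ e = a := fun a e => by
    induction e with
    | zero => simp
    | succ e ih => rw [pow_succ', pow_mul, Function.iterate_succ_apply', hrt, ih]
  let s : ℕ → D := fun e => rt^[e] t
  have hs : ∀ e, s e ^ p ^ e = t := fun e => hiter t e
  have hs0 : ∀ e, s e ≠ 0 := fun e h => ht (by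
    rw [← hs e, h, zero_pow (pow_ne_zero _ hp0)])
  have hregs : ∀ e, RegMod ⊥ (j (s e) :: y) := fun e =>
    RegMod.root_cons (pow_ne_zero e hp0) (by rwa [← _root_.map_pow, hs])
  let B : Type u := ∀ e : ℕ, C ⧸ Ideal.span {j (s e)}
  let mk : ∀ e, C →+* C ⧸ Ideal.span {j (s e)} := fun e => Ideal.Quotient.mk _
  let S : Submonoid B :=
    { carrier := {u | ∃ h ∉ 𝔮, ∃ (g : ℕ → D) (e₀ : ℕ), ∀ e, e₀ ≤ e →
        g e ^ p ^ e = h ∧ u e = mk e (j (g e))}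
      one_mem' := ⟨1, fun h => Ideal.IsPrime.ne_top inferInstance ((Ideal.eq_top_iff_one _).2 h),
        fun _ => 1, 0, fun e _ => ⟨one_pow _, by rw [map_one, map_one]; rfl⟩⟩
      mul_mem' := by
        rintro u u' ⟨h, hh, g, e₀, H⟩ ⟨h', hh', g', e₀', H'⟩
        refine ⟨h * h', fun hc => (Ideal.IsPrime.mem_or_mem inferInstance hc).elim hh hh',
          fun e => g e * g' e, max e₀ e₀', fun e he => ⟨?_, ?_⟩⟩
        · rw [mul_pow, (H e (le_of_max_le_left he)).1, (H' e (le_of_max_le_right he)).1]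
        · rw [Pi.mul_apply, (H e (le_of_max_le_left he)).2, (H' e (le_of_max_le_right he)).2,
            map_mul, map_mul] }
  let δ : C →+* B := RingHom.pi mk
  let θ : C →+* Localization S := (algebraMap B (Localization S)).comp δ
  have hy : ∀ e, (y.map δ).map (fun a => a e) = y.map (mk e) := fun e => by
    rw [List.map_map]; rfl
  have hθy : y.map θ = (y.map δ).map (algebraMap B (Localization S)) := by
    rw [List.map_map]; rfl
  have hregθ : RegMod ⊥ (y.map θ) := by
    rw [hθy]
    refine RegMod.localization_pi S fun e => ?_
    rw [hy]
    refine RegMod.quotient ?_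
    simpa using (hregs e).2
  have honeθ : (1 : Localization S) ∉ Ideal.ofList (y.map θ) := by
    intro h1
    rw [hθy] at h1
    obtain ⟨u, ⟨h, hh, g, e₀, H⟩, hu⟩ := RegMod.one_mem_localization_pi S h1
    have hmem : ∀ e, e₀ ≤ e → j (g e) ∈ Ideal.span {j (s e)} ⊔ Ideal.ofList y := fun e he => by
      have h2 := hu e
      rw [hy, (H e he).2] at h2
      have := RegMod.ofList_comap (f := mk e) Ideal.Quotient.mk_surjective ⊥ (l := y)
      rw [bot_sup_eq, ← RingHom.ker_eq_comap_bot, Ideal.mk_ker] at this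
      rw [← this]; exact h2
    have hp1 : j h ∈ Ideal.span {j (s 1)} := by
      refine RegMod.mem_of_forall_pow (Submodule.fg_span_singleton _) hdc
        (by simpa using (hregs 1).2) fun n => ?_
      let e := e₀ + n + 1
      have h3 : n ≤ p ^ e - p ^ (e - 1) := by
        have h4 : n < p ^ (e - 1) := lt_of_le_of_lt (by omega) (Nat.lt_pow_self hp)
        have h5 : p ^ e = p ^ (e - 1) * p := by rw [← pow_succ]; rfl
        rw [h5]
        have : p ^ (e - 1) * 2 ≤ p ^ (e - 1) * p := Nat.mul_le_mul_left _ hp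
        omega
      have h4 : p ^ (e - 1) + (p ^ e - p ^ (e - 1)) = p ^ e :=
        Nat.add_sub_cancel' (Nat.pow_le_pow_right (by omega) (by omega))
      have h5 := Ideal.pow_mem_pow (hmem e (by omega)) (p ^ e)
      rw [← _root_.map_pow, (H e (by omega)).1] at h5
      have h6 : (Ideal.span {j (s e)} ⊔ Ideal.ofList y) ^ p ^ e ≤
          Ideal.span {j (s 1)} ⊔ Ideal.ofList y ^ n := by
        rw [← h4]
        refine Ideal.sup_pow_add_le_pow_sup_pow.trans (sup_le_sup ?_ (Ideal.pow_le_pow_right h3))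
        rw [Ideal.span_singleton_pow, ← _root_.map_pow]
        have : s e ^ p ^ (e - 1) = s 1 := by
          have : s e = rt^[e - 1] (s 1) := by
            simp only [s, e]
            rw [← Function.iterate_add_apply]; rfl
          rw [this, hiter]
        rw [this]
      exact h6 h5
    rw [Ideal.mem_span_singleton] at hp1
    have h2 := pow_dvd_pow_of_dvd (hdvd _ _ (hs0 1) hp1) p
    have h3 : s 1 ^ p = t := by simpa using hs 1
    rw [h3] at h2
    exact hh (Ideal.IsPrime.mem_of_pow_mem inferInstance p
      (h𝔮.1.2 (Ideal.mem_span_singleton.2 h2)))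
  have hkill : ∀ a ∈ 𝔮, θ (j a) = 0 := by
    intro a ha
    obtain ⟨h, hh, N, hN⟩ := Ideal.exists_mul_pow_mem_of_mem_minimalPrimes h𝔮 ha
    let u : B := fun e => if N ≤ e then mk e (j (rt^[e] h)) else 0
    have hu : u ∈ S := ⟨h, hh, fun e => rt^[e] h, N, fun e he => ⟨hiter h e, if_pos he⟩⟩
    have h1 : u * δ (j a) = 0 := by
      funext e
      change (if N ≤ e then mk e (j (rt^[e] h)) else 0) * mk e (j a) = 0
      split_ifs with he
      · rw [← map_mul, ← map_mul]
        refine Ideal.Quotient.eq_zero_iff_mem.2 (Ideal.mem_span_singleton.2 (map_dvd j ?_))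
        rw [← IsIntegrallyClosed.pow_dvd_pow_iff (pow_ne_zero e hp0), hs, mul_pow, hiter]
        obtain ⟨k, hk⟩ := Nat.exists_eq_add_of_le (he.trans (Nat.lt_pow_self hp).le : N ≤ p ^ e)
        rw [hk, pow_add, ← mul_assoc]
        exact (Ideal.mem_span_singleton.1 hN).mul_right _
      · rw [zero_mul]
    refine (IsLocalization.map_eq_zero_iff S (Localization S) _).2 ⟨⟨u, hu⟩, h1⟩
  obtain ⟨C', _, φ, h1, h2, h3⟩ := hregθ.exists_dcomplete
  rw [List.map_map] at h1 h2
  exact ⟨C', _, φ.comp θ, fun a ha => by rw [RingHom.comp_apply, hkill a ha, map_zero], h1,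
    fun h => honeθ (h2 h), fun a ha => h3 _ (List.mem_map_of_mem ha)⟩

end

section

open IsLocalRing


universe u v

namespace IsRegularSystem

theorem nil (K : Type*) [Field K] : IsRegularSystem ([] : List K) where
  span_eq := by rw [Ideal.ofList_nil]; exact (IsLocalRing.isField_iff_maximalIdeal_eq.1 (Field.toIsField K)).symm
  regMod := trivial
  dcomplete a ha := by
    rw [IsLocalRing.isField_iff_maximalIdeal_eq.1 (Field.toIsField K), Ideal.mem_bot] at ha
    rw [ha]
    exact DComplete.zero

variable (p : ℕ) [Fact p.Prime] (K : Type*) [Field K] [CharP K p] [PerfectRing K p]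

theorem maximalIdeal_wittVector :
    maximalIdeal (WittVector p K) = Ideal.span {(p : WittVector p K)} := by
  refine (IsLocalRing.eq_maximalIdeal ?_).symm
  rw [← Untilt.comap_constantCoeff_bot]
  exact Ideal.comap_isMaximal_of_surjective _ (Untilt.constantCoeff_surjective p)

theorem wittVector : IsRegularSystem [(p : WittVector p K)] where
  span_eq := by rw [maximalIdeal_wittVector, Ideal.ofList_singleton]
  regMod := ⟨fun b hb => Untilt.mul_p_injective p b hb, trivial⟩
  dcomplete a ha := by
    rw [maximalIdeal_wittVector, Ideal.mem_span_singleton] at ha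
    obtain ⟨b, rfl⟩ := ha
    exact (Untilt.dcomplete_witt p).mul_right b

theorem finite_injective {Q E : Type*} [CommRing Q] [IsDomain Q] [IsNoetherianRing Q] [IsLocalRing Q]
    [CommRing E] [IsNoetherianRing E] [IsLocalRing E] (hdE : ∀ a ∈ maximalIdeal E, DComplete a E)
    {x : List Q} (hx : IsRegularSystem x) (ψ : Q →+* E) (hpar : IsParam E (x.map ψ))
    (hres : ∀ e, ∃ a, e - ψ a ∈ maximalIdeal E) : ψ.Finite ∧ Function.Injective ψ := by
  constructor
  · algebraize [ψ]
    exact Module.Finite.of_radical_ofList_eq (x := x)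
      (fun a ha => hx.dcomplete a (hx.span_eq ▸ Ideal.subset_span (s := {r | r ∈ _}) ha))
      (fun a ha => hdE _ (hpar.mem (List.mem_map_of_mem ha))) hpar.radical_eq hres
  · exact injective_of_ofList_eq ψ hx.span_eq hpar.radical_eq (by
      rw [← hpar.length_eq, List.length_map])

/-- A complete local ring is finite over a power series ring over a given coefficient ring. -/
theorem exists_finite {E : Type u} [CommRing E] [IsNoetherianRing E] [IsLocalRing E]
    (hdE : ∀ a ∈ maximalIdeal E, DComplete a E) {Λ : Type u} [CommRing Λ] [IsDomain Λ]
    [IsNoetherianRing Λ] [IsLocalRing Λ] [IsIntegrallyClosed Λ] {l₀ : List Λ}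
    (h₀ : IsRegularSystem l₀) (c : Λ →+* E) (hc : ∀ e, ∃ a, e - c a ∈ maximalIdeal E) {s : List E}
    (hs : IsParam E (l₀.map c ++ s)) :
    ∃ (Q : Type u) (_ : CommRing Q) (_ : IsDomain Q) (_ : IsNoetherianRing Q) (_ : IsLocalRing Q)
      (_ : IsIntegrallyClosed Q) (x : List Q) (ψ : Q →+* E), IsRegularSystem x ∧
      IsParam E (x.map ψ) ∧ ψ.Finite ∧ Function.Injective ψ := by
  obtain ⟨Q, _, _, _, _, _, c', x, hxl, hx, -, hQ⟩ := exists_powerSeries h₀ s.length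
  obtain ⟨ψ, hψ, hψx⟩ := hQ E c s rfl fun a ha => hdE a (hs.mem (List.mem_append_right _ ha))
  have hmap : (l₀.map c' ++ x).map ψ = l₀.map c ++ s := by
    rw [List.map_append, List.map_map, hψx, ← hψ]; rfl
  have hpar : IsParam E ((l₀.map c' ++ x).map ψ) := hmap ▸ hs
  exact ⟨Q, _, ‹_›, ‹_›, ‹_›, ‹_›, l₀.map c' ++ x, ψ, hx, hpar,
    finite_injective hdE hx ψ hpar fun e => (hc e).imp' c' fun a ha => by
      rwa [← RingHom.comp_apply, hψ]⟩

variable {p K}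

theorem natCast_mem_maximalIdeal {E : Type*} [CommRing E] [IsLocalRing E] (c : WittVector p K →+* E)
    (hc : ∀ e, ∃ a, e - c a ∈ maximalIdeal E) : (p : E) ∈ maximalIdeal E := by
  have h1 : (maximalIdeal E).comap c = maximalIdeal (WittVector p K) := by
    rw [← Ideal.mk_ker (I := maximalIdeal E), RingHom.comap_ker]
    refine IsLocalRing.eq_maximalIdeal (RingHom.ker_isMaximal_of_surjective (K := ResidueField E)
      ((residue E).comp c) fun e => ?_)
    obtain ⟨e, rfl⟩ := residue_surjective e
    obtain ⟨a, ha⟩ := hc e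
    exact ⟨a, (sub_eq_zero.1 (by rw [RingHom.comp_apply, ← map_sub]; exact (residue_eq_zero_iff _).2 ha)).symm⟩
  have h2 : (p : WittVector p K) ∈ (maximalIdeal E).comap c := by
    rw [h1, maximalIdeal_wittVector]
    exact Ideal.mem_span_singleton_self _
  simpa using h2

theorem exists_finite_of_wittVector {K : Type u} [Field K] [CharP K p] [PerfectRing K p] {E : Type u}
    [CommRing E] [IsDomain E] [IsNoetherianRing E] [IsLocalRing E]
    (hdE : ∀ a ∈ maximalIdeal E, DComplete a E) (c : WittVector p K →+* E)
    (hc : ∀ e, ∃ a, e - c a ∈ maximalIdeal E) :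
    ∃ (Q : Type u) (_ : CommRing Q) (_ : IsDomain Q) (_ : IsNoetherianRing Q) (_ : IsLocalRing Q)
      (_ : IsIntegrallyClosed Q) (x : List Q) (ψ : Q →+* E), IsRegularSystem x ∧
      IsParam E (x.map ψ) ∧ ψ.Finite ∧ Function.Injective ψ := by
  by_cases hp : (p : E) = 0
  · have hker : RingHom.ker (WittVector.constantCoeff : WittVector p K →+* K) ≤ RingHom.ker c := by
      rw [RingHom.ker_eq_comap_bot, Untilt.comap_constantCoeff_bot,
        Ideal.span_singleton_le_iff_mem, RingHom.mem_ker, map_natCast, hp]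
    let c' := (WittVector.constantCoeff : WittVector p K →+* K).liftOfSurjective
      (Untilt.constantCoeff_surjective p) ⟨c, hker⟩
    have hc' : ∀ a, c' (WittVector.constantCoeff a) = c a := fun a =>
      RingHom.liftOfRightInverse_comp_apply _ _ _ _ _
    obtain ⟨s, hs⟩ := IsParam.exists_param E
    exact exists_finite hdE (nil K) c' (fun e => (hc e).imp' WittVector.constantCoeff fun a ha => by
      rwa [hc']) hs
  · obtain ⟨s, hs⟩ := IsParam.exists_cons (natCast_mem_maximalIdeal c hc) hp
    exact exists_finite hdE (wittVector p K) c hc (s := s) (by simpa using hs)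

end IsRegularSystem

/-- Divisibility in an absolutely integrally closed domain can be tested in a Cohen-Macaulay
algebra. -/
theorem CMHom.dvd_of_dvd {p : ℕ} [Fact p.Prime] {K : Type u} [Field K] [CharP K p] [PerfectRing K p]
    {E : Type u} [CommRing E] [IsDomain E] [IsNoetherianRing E] [IsLocalRing E]
    (hdE : ∀ a ∈ maximalIdeal E, DComplete a E) (c : WittVector p K →+* E)
    (hc : ∀ e, ∃ a, e - c a ∈ maximalIdeal E) {D : Type*} {C : Type*} [CommRing D] [IsDomain D]
    [CommRing C] {i : E →+* D} (hintg : i.IsIntegral) (hD : MonicRoot D) {j : D →+* C}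
    (hj : CMHom (j.comp i)) (hdC : ∀ a ∈ maximalIdeal E, DComplete (j (i a)) C) {s a : D}
    (hs : s ≠ 0) (h : j s ∣ j a) : s ∣ a := by
  obtain ⟨Q, _, _, _, _, _, x, ψ, hx, hpar, hfin, hinj⟩ :=
    IsRegularSystem.exists_finite_of_wittVector hdE c hc
  have hintg' : (i.comp ψ).IsIntegral := hfin.to_isIntegral.trans _ _ hintg
  algebraize [i.comp ψ, j.comp (i.comp ψ)]
  have hxm : ∀ a ∈ x, a ∈ maximalIdeal Q := fun a ha =>
    hx.span_eq ▸ Ideal.subset_span (s := {r | r ∈ x}) ha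
  obtain ⟨h1, h2⟩ := hj _ hpar
  rw [List.map_map] at h1 h2
  obtain ⟨α, hα⟩ := exists_retraction (C := C) hx.span_eq (fun a ha => hx.dcomplete a (hxm a ha))
    (fun a ha => hdC _ (hpar.mem (List.mem_map_of_mem ha))) h1 h2
  exact dvd_of_retraction hD ⟨j, fun _ => rfl⟩ α hα hs h

end

section

open IsLocalRing


universe u v

theorem MonicRoot.of_surjective {A B : Type*} [CommRing A] [CommRing B] [Nontrivial B]
    (h : MonicRoot A) {f : A →+* B}
    (hf : Function.Surjective f) : MonicRoot B := fun P hP hd => by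
  obtain ⟨P', hP', hd', hm'⟩ := Polynomial.lifts_and_degree_eq_and_monic
    ((Polynomial.mem_lifts P).2 (Polynomial.map_surjective f hf P)) hP
  obtain ⟨a, ha⟩ := h P' hm' (by rwa [hd'])
  exact ⟨f a, by rw [← hP']; exact ha.map⟩

theorem radical_ofList_map_of_surjective {E E' : Type*} [CommRing E] [CommRing E'] [IsLocalRing E]
    [IsLocalRing E'] {g : E →+* E'} (hg : Function.Surjective g) {l : List E}
    (hl : (Ideal.ofList l).radical = maximalIdeal E) :
    (Ideal.ofList (l.map g)).radical = maximalIdeal E' := by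
  have h1 := map_maximalIdeal_of_surjective g hg
  rw [← Ideal.map_ofList, ← h1]
  apply le_antisymm
  · rw [h1, (maximalIdeal.isMaximal E').isPrime.radical_le_iff, ← h1, ← hl]
    exact Ideal.map_mono Ideal.le_radical
  · rw [← hl]
    exact Ideal.map_radical_le g

theorem IsParam.map_ringEquiv {E E' : Type*} [CommRing E] [CommRing E'] [IsLocalRing E]
    [IsLocalRing E'] (g : E ≃+* E') {l : List E} (h : IsParam E l) : IsParam E' (l.map g) where
  length_eq := by rw [List.length_map, h.length_eq, ringKrullDim_eq_of_ringEquiv g]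
  radical_eq := radical_ofList_map_of_surjective (g := (g : E →+* E')) g.surjective h.radical_eq

theorem DComplete.forall_maximalIdeal {E C : Type*} [CommRing E] [IsLocalRing E] [CommRing C]
    {φ : E →+* C} {l : List E} (hl : (Ideal.ofList l).radical = maximalIdeal E)
    (h : ∀ a ∈ l, DComplete (φ a) C) : ∀ a ∈ maximalIdeal E, DComplete (φ a) C := by
  intro a ha
  refine DComplete.of_mem_radical (s := {r | r ∈ l.map φ}) ?_ ?_
  · intro b hb
    obtain ⟨c, hc, rfl⟩ := List.mem_map.1 hb
    exact h c hc
  · rw [← hl] at ha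
    have := Ideal.map_radical_le φ (Ideal.mem_map_of_mem φ ha)
    rwa [Ideal.map_ofList] at this

/-- Cohen-Macaulay algebras can be pushed forward along quotients of absolutely integrally closed
domains. -/
theorem CMHom.exists_descend {p : ℕ} [hp : Fact p.Prime] {K : Type u} [Field K] [CharP K p]
    [PerfectRing K p] {E' D' : Type u} [CommRing E'] [IsLocalRing E'] [CommRing D'] [IsDomain D']
    {i' : E' →+* D'} (hi' : Function.Injective i') (n : ℕ) :
    ∀ {E D C : Type u} [CommRing E] [IsDomain E] [IsNoetherianRing E] [IsLocalRing E]
      [CommRing D] [IsDomain D] [CommRing C] (c : WittVector p K →+* E)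
      (_ : ∀ e, ∃ a, e - c a ∈ maximalIdeal E) (_ : ∀ a ∈ maximalIdeal E, DComplete a E)
      {i : E →+* D} (_ : Function.Injective i) (_ : i.IsIntegral) (_ : MonicRoot D) {j : D →+* C}
      (_ : CMHom (j.comp i)) (_ : ∀ a ∈ maximalIdeal E, DComplete (j (i a)) C)
      {g : E →+* E'} (_ : Function.Surjective g) {π : D →+* D'} (_ : Function.Surjective π)
      (_ : π.comp i = i'.comp g) {l : List E} (_ : IsParam E l) (_ : l.length = n),
      ∃ (C' : Type u) (_ : CommRing C') (θ : C →+* C') (j' : D' →+* C'),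
        j'.comp π = θ.comp j ∧ CMHom (j'.comp i') ∧
        ∀ a ∈ maximalIdeal E', DComplete (j' (i' a)) C' := by
  induction n using Nat.strong_induction_on with
  | _ n ih =>
  intro E D C _ _ _ _ _ _ _ c hc hdE i hi hintg hD j hj hdC g hg π hπ hcomm l hl hn
  have hcomm' : ∀ a, π (i a) = i' (g a) := fun a => RingHom.congr_fun hcomm a
  by_cases hker : RingHom.ker π = ⊥
  · have hπi := (RingHom.injective_iff_ker_eq_bot _).2 hker
    have hgi : Function.Injective g := fun a b hab =>
      hi (hπi (by rw [hcomm', hcomm', hab]))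
    let eg := RingEquiv.ofBijective g ⟨hgi, hg⟩
    let eπ := RingEquiv.ofBijective π ⟨hπi, hπ⟩
    let j' : D' →+* C := j.comp eπ.symm
    have h1 : ∀ a, j' (π a) = j a := fun a => congrArg j (eπ.symm_apply_apply a)
    have h2 : (j'.comp i').comp g = j.comp i := by
      ext a
      simp only [RingHom.comp_apply]
      rw [← hcomm', h1]
    refine ⟨C, _, RingHom.id C, j', RingHom.ext h1, fun l' hl' => ?_, fun a ha => ?_⟩
    · have h3 := hj _ (hl'.map_ringEquiv eg.symm)
      have h4 : l' = (l'.map eg.symm).map g := by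
        rw [List.map_map]
        conv_lhs => rw [← List.map_id l']
        exact List.map_congr_left fun a _ => (eg.apply_symm_apply a).symm
      rw [h4, List.map_map, ← RingHom.coe_comp, h2]
      exact h3
    · obtain ⟨b, rfl⟩ := hg a
      have := hdC b (by
        have := hg.isLocalHom
        rw [← maximalIdeal_comap g]; exact ha)
      rw [← h1, hcomm'] at this
      exact this
  have hintg' := hintg
  have hx : ∃ x : E, x ≠ 0 ∧ g x = 0 := by
    algebraize [i]
    have h1 : (RingHom.ker π).comap (algebraMap E D) ≠ ⊥ := fun h =>
      hker (Ideal.eq_bot_of_comap_eq_bot h)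
    obtain ⟨x, hx, hx0⟩ := Submodule.exists_mem_ne_zero_of_ne_bot h1
    refine ⟨x, hx0, hi' ?_⟩
    rw [← hcomm', map_zero]
    exact hx
  obtain ⟨x, hx0, hgx⟩ := hx
  have hxm : x ∈ maximalIdeal E := (mem_maximalIdeal _).2 fun hu => by
    simpa [hgx] using hu.map g
  obtain ⟨y, hy⟩ := IsParam.exists_cons hxm hx0
  have hyn : y.length + 1 = n := by
    have := hy.length_eq.trans hl.length_eq.symm
    rw [hn] at this
    exact_mod_cast this
  have hπx : π (i x) = 0 := by rw [hcomm', hgx, map_zero]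
  have := RingHom.ker_isPrime π
  obtain ⟨𝔮, h𝔮, h𝔮π⟩ := Ideal.exists_minimalPrimes_le (I := Ideal.span {i x}) (J := RingHom.ker π)
    ((Ideal.span_singleton_le_iff_mem _).2 hπx)
  have h𝔮p := h𝔮.1.1
  have hix : i x ∈ 𝔮 := h𝔮.1.2 (Ideal.mem_span_singleton_self _)
  obtain ⟨C₁, _, θ, hkill, hreg, hone, hdc⟩ := RegMod.exists_kill hp.out.one_lt hD j
    (fun s a hs h => CMHom.dvd_of_dvd hdE c hc hintg hD hj hdC hs h)
    (t := i x) (fun h => hx0 (hi (by rw [h, map_zero]))) (y := y.map (j.comp i))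
    (by simpa using (hj _ hy).1)
    (fun a ha => by
      obtain ⟨b, hb, rfl⟩ := List.mem_map.1 ha
      exact hdC b (hy.mem (List.mem_cons_of_mem _ hb))) h𝔮
  let mE := Ideal.Quotient.mk (𝔮.comap i)
  have hmE : Function.Surjective mE := Ideal.Quotient.mk_surjective
  let mD := Ideal.Quotient.mk 𝔮
  have hmD : Function.Surjective mD := Ideal.Quotient.mk_surjective
  have : IsLocalRing (E ⧸ 𝔮.comap i) := .of_surjective' mE hmE
  let i₁ : E ⧸ 𝔮.comap i →+* D ⧸ 𝔮 := Ideal.quotientMap 𝔮 i le_rfl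
  have hi₁m : ∀ a, i₁ (mE a) = mD (i a) := fun a => rfl
  let j₁ : D ⧸ 𝔮 →+* C₁ := Ideal.Quotient.lift 𝔮 (θ.comp j) hkill
  have hj₁m : ∀ a, j₁ (mD a) = θ (j a) := fun a => rfl
  let g₁ : E ⧸ 𝔮.comap i →+* E' := Ideal.Quotient.lift _ g fun a ha => hi' (by
    rw [map_zero, ← hcomm']
    exact h𝔮π ha)
  let π₁ : D ⧸ 𝔮 →+* D' := Ideal.Quotient.lift 𝔮 π h𝔮π
  have hmap : (y.map mE).map (j₁.comp i₁) = (y.map (j.comp i)).map θ := by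
    rw [List.map_map, List.map_map]; rfl
  have hmE_max := map_maximalIdeal_of_surjective mE hmE
  have hrad : (Ideal.ofList (y.map mE)).radical = maximalIdeal (E ⧸ 𝔮.comap i) := by
    rw [← radical_ofList_map_of_surjective hmE hy.radical_eq, List.map_cons]
    have : mE x = 0 := Ideal.Quotient.eq_zero_iff_mem.2 hix
    simp [Ideal.ofList_cons, this]
  rw [← hmap] at hreg hone
  have hpar : IsParam (E ⧸ 𝔮.comap i) (y.map mE) :=
    ⟨le_antisymm (RegMod.length_le_ringKrullDim (j₁.comp i₁) _ hreg hone)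
      (ringKrullDim_le_length hrad), hrad⟩
  have hdC₁ : ∀ a ∈ maximalIdeal (E ⧸ 𝔮.comap i), DComplete (j₁ (i₁ a)) C₁ :=
    DComplete.forall_maximalIdeal (φ := j₁.comp i₁) hrad fun a ha => by
      obtain ⟨b, hb, rfl⟩ := List.mem_map.1 ha
      exact hdc _ (List.mem_map_of_mem hb)
  have hmem : ∀ a ∈ maximalIdeal (E ⧸ 𝔮.comap i), ∃ b ∈ maximalIdeal E, mE b = a := fun a ha => by
    rw [← hmE_max] at ha
    exact (Ideal.mem_map_iff_of_surjective mE hmE).1 ha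
  have hdE₁ : ∀ a ∈ maximalIdeal (E ⧸ 𝔮.comap i), DComplete a (E ⧸ 𝔮.comap i) := fun a ha => by
    obtain ⟨b, hb, rfl⟩ := hmem a ha
    rw [← DComplete.of_ringHom mE b _ (fun r m => rfl)]
    exact (hdE b hb).quotient (IsNoetherian.noetherian _)
  obtain ⟨C', _, θ', j', h1, h2, h3⟩ := ih y.length (by omega) (mE.comp c)
    (fun e => by
      obtain ⟨e, rfl⟩ := hmE e
      obtain ⟨a, ha⟩ := hc e
      refine ⟨a, ?_⟩
      rw [RingHom.comp_apply, ← map_sub, ← hmE_max]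
      exact Ideal.mem_map_of_mem _ ha)
    hdE₁ (i := i₁) (Ideal.quotientMap_injective) (by
      refine RingHom.IsIntegral.tower_top mE i₁ ?_
      exact hintg.trans i mD (RingHom.isIntegral_of_surjective _ hmD))
    (hD.of_surjective hmD) (j := j₁) (hpar.cmHom hdC₁ hreg hone) hdC₁ (g := g₁)
    (fun a => (hg a).imp' mE fun b hb => hb) (π := π₁) (fun a => (hπ a).imp' mD fun b hb => hb)
    (by
      ext a
      exact hcomm' a) hpar (by rw [List.length_map])
  refine ⟨C', _, θ'.comp θ, j', ?_, h2, h3⟩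
  ext a
  exact RingHom.congr_fun h1 (mD a)

end

section

open Polynomial IsLocalRing

universe u

theorem MonicRoot.of_splits {Q D : Type*} [CommRing Q] [CommRing D] [IsDomain D] [Algebra Q D]
    [Algebra.IsIntegral Q D] (h : ∀ P : Q[X], P.Monic → (P.map (algebraMap Q D)).Splits) :
    MonicRoot D := by
  intro F hF hd
  have hFn : Nontrivial (AdjoinRoot F) := AdjoinRoot.nontrivial F hd.ne'
  have : Algebra.IsIntegral D (AdjoinRoot F) := by
    have := (AdjoinRoot.powerBasis' hF).finite
    infer_instance
  have hb : IsIntegral Q (AdjoinRoot.root F) :=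
    isIntegral_trans (R := Q) (A := D) _ (Algebra.IsIntegral.isIntegral _)
  obtain ⟨P, hP, hPb⟩ := hb
  have hdvd : F ∣ P.map (algebraMap Q D) := by
    rw [← AdjoinRoot.mk_eq_zero, ← AdjoinRoot.aeval_eq, aeval_map_algebraMap]
    exact hPb
  have hs := (h P hP).of_dvd (hP.map _).ne_zero hdvd
  obtain ⟨a, ha⟩ := hs.exists_eval_eq_zero hd.ne'
  exact ⟨a, ha⟩

/-- Krull's intersection theorem, transported along a Cohen-Macaulay algebra. -/
theorem IsRegularSystem.eq_zero_of_forall_mem_pow {Q : Type u} [CommRing Q] [IsNoetherianRing Q]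
    [IsLocalRing Q] {x : List Q} (hx : IsRegularSystem x) {A : Type u} [CommRing A] (β : Q →+* A)
    (hreg : RegMod ⊥ (x.map β)) (h1 : (1 : A) ∉ Ideal.ofList (x.map β)) {q : Q}
    (hq : ∀ n, β q ∈ Ideal.ofList (x.map β) ^ n) : q = 0 := by
  obtain ⟨C, _, φ, hφ, hφ1, hφd⟩ := RegMod.exists_dcomplete hreg
  algebraize [φ.comp β]
  have hmap : (x.map β).map φ = x.map (algebraMap Q C) := by simp [RingHom.algebraMap_toAlgebra]
  obtain ⟨α, hα⟩ := exists_retraction hx.span_eq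
    (fun a ha => hx.dcomplete a (hx.span_eq ▸ Ideal.subset_span (s := {r | r ∈ x}) ha))
    (fun a ha => hφd (β a) (List.mem_map_of_mem ha)) (hmap ▸ hφ)
    (fun h => h1 (hφ1 (hmap ▸ h)))
  have hmem : ∀ n, q ∈ maximalIdeal Q ^ n := by
    intro n
    have h2 : algebraMap Q C q ∈ (maximalIdeal Q ^ n).map (algebraMap Q C) := by
      have := Ideal.mem_map_of_mem φ (hq n)
      rw [← Ideal.map_ofList, Ideal.map_pow, Ideal.map_map, hx.span_eq] at this
      rw [Ideal.map_pow]
      exact this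
    have h3 : ∀ c ∈ (maximalIdeal Q ^ n).map (algebraMap Q C), α c ∈ maximalIdeal Q ^ n := by
      intro c hc
      have hc : c ∈ (maximalIdeal Q ^ n) • (⊤ : Submodule Q C) := by
        rw [Ideal.smul_top_eq_map]; exact hc
      refine Submodule.smul_induction_on hc (fun r hr c _ => ?_) fun a b ha hb => ?_
      · rw [map_smul]; exact Ideal.mul_mem_right _ _ hr
      · rw [map_add]; exact add_mem ha hb
    have := h3 _ h2
    rwa [Algebra.algebraMap_eq_smul_one, map_smul, hα, smul_eq_mul, mul_one] at this
  have := Ideal.iInf_pow_eq_bot_of_isLocalRing (maximalIdeal Q) (Ideal.IsPrime.ne_top inferInstance)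
  rw [← Ideal.mem_bot, ← this, Ideal.mem_iInf]
  exact hmem

/-- A reduced Cohen-Macaulay algebra in which the monic polynomials over `Q` split, with enough
`p`-power roots, yields a Cohen-Macaulay algebra over an absolute integral closure of `Q`. -/
theorem IsRegularSystem.exists_cm_of_reduced {Q : Type u} [CommRing Q] [IsDomain Q]
    [IsNoetherianRing Q] [IsLocalRing Q] {x : List Q} (hx : IsRegularSystem x)
    {A : Type u} [CommRing A] [IsReduced A] [Algebra Q A]
    (hreg : RegMod ⊥ (x.map (algebraMap Q A))) (h1 : (1 : A) ∉ Ideal.ofList (x.map (algebraMap Q A)))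
    (A1 : Subring A) (hA1 : ∀ q, algebraMap Q A q ∈ A1)
    (hsplit : ∀ P : Q[X], P.Monic → ∃ s : Multiset A, (∀ a ∈ s, a ∈ A1) ∧
      P.map (algebraMap Q A) = (s.map (X - C ·)).prod)
    {p : ℕ} (hp : 1 < p) (hroot : ∀ h ∈ A1, ∀ e : ℕ, ∃ g : A, g ^ p ^ e = h) :
    ∃ (D : Type u) (_ : CommRing D) (_ : IsDomain D) (i : Q →+* D) (B : Type u) (_ : CommRing B)
      (j : D →+* B), Function.Injective i ∧ i.IsIntegral ∧ MonicRoot D ∧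
      RegMod ⊥ (x.map (j.comp i)) ∧ (1 : B) ∉ Ideal.ofList (x.map (j.comp i)) ∧
      ∀ a ∈ maximalIdeal Q, DComplete (j (i a)) B := by
  let J := Ideal.ofList (x.map (algebraMap Q A))
  let U : Subring A := A1 ⊓ (integralClosure Q A).toSubring
  have hQU : ∀ q, algebraMap Q A q ∈ U := fun q => ⟨hA1 q, (integralClosure Q A).algebraMap_mem q⟩
  let iU : Q →+* U := (algebraMap Q A).codRestrict U hQU
  algebraize [iU]
  have hiU : ∀ q, (algebraMap Q U q : A) = algebraMap Q A q := fun q => rfl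
  have hUint : Algebra.IsIntegral Q U := by
    refine ⟨fun u => ?_⟩
    obtain ⟨P, hP, hPu⟩ := u.2.2
    refine ⟨P, hP, Subtype.ext ?_⟩
    have := Polynomial.hom_eval₂ P (algebraMap Q U) U.subtype u
    exact this.trans hPu
  let I : Ideal U := (⨅ n : ℕ, J ^ n).comap U.subtype
  have hI : ∀ u : U, u ∈ I ↔ ∀ n, (u : A) ∈ J ^ n := fun u => by
    rw [Ideal.mem_comap, Ideal.mem_iInf]; rfl
  have hdisj : Disjoint (I : Set U) ((nonZeroDivisors Q).map (algebraMap Q U)) := by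
    rw [Set.disjoint_left]
    rintro _ hu ⟨q, hq, rfl⟩
    exact nonZeroDivisors.ne_zero hq
      (hx.eq_zero_of_forall_mem_pow (algebraMap Q A) hreg h1 ((hI _).1 hu))
  obtain ⟨𝔯, h𝔯, hI𝔯, h𝔯d⟩ := Ideal.exists_le_prime_disjoint I _ hdisj
  have h𝔯0 : ∀ q, algebraMap Q U q ∈ 𝔯 → q = 0 := fun q hq => by
    by_contra h
    exact Set.disjoint_left.1 h𝔯d hq ⟨q, mem_nonZeroDivisors_of_ne_zero h, rfl⟩
  have hmin : 𝔯 ∈ (⊥ : Ideal U).minimalPrimes := by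
    obtain ⟨𝔰, h𝔰, hle⟩ := Ideal.exists_minimalPrimes_le (bot_le : (⊥ : Ideal U) ≤ 𝔯)
    have := h𝔰.1.1
    suffices h : 𝔯 ≤ 𝔰 by rwa [le_antisymm h hle]
    intro u hu
    by_contra hus
    have h2 := Ideal.comap_lt_comap_of_integral_mem_sdiff hle ⟨hu, hus⟩
      (Algebra.IsIntegral.isIntegral (R := Q) u)
    obtain ⟨q, hq, hq'⟩ := SetLike.exists_of_lt h2
    exact hq' (h𝔯0 q hq ▸ zero_mem _)
  let S : Submonoid (ℕ → A) :=
    { carrier := {u | ∃ h : U, h ∉ 𝔯 ∧ ∀ e, u e ^ p ^ e = h}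
      one_mem' := ⟨1, fun h => h𝔯.ne_top ((Ideal.eq_top_iff_one _).2 h), fun e => one_pow _⟩
      mul_mem' := by
        rintro u v ⟨h, hh, hu⟩ ⟨k, hk, hv⟩
        refine ⟨h * k, fun hm => (h𝔯.mem_or_mem hm).elim hh hk, fun e => ?_⟩
        rw [Pi.mul_apply, mul_pow, hu, hv]; rfl }
  let δ : A →+* (ℕ → A) := RingHom.pi fun _ => RingHom.id A
  let γ : A →+* Localization S := (algebraMap (ℕ → A) (Localization S)).comp δ
  have hreg' : RegMod ⊥ ((x.map (algebraMap Q A)).map γ) := by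
    have := RegMod.localization_pi S (l := (x.map (algebraMap Q A)).map δ) (fun i => by
      rw [List.map_map]
      convert hreg
      exact List.map_id _)
    rwa [List.map_map] at this
  have h1' : (1 : Localization S) ∉ Ideal.ofList ((x.map (algebraMap Q A)).map γ) := by
    intro h
    obtain ⟨u, ⟨h, hh, hu⟩, hmem⟩ := RegMod.one_mem_localization_pi S
      (l := (x.map (algebraMap Q A)).map δ) (by rw [List.map_map]; exact h)
    refine hh (hI𝔯 ((hI h).2 fun n => ?_))
    have h2 : u n ∈ J := by
      have := hmem n
      rw [List.map_map] at this
      convert this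
      exact (List.map_id _).symm
    rw [← hu n]
    exact Ideal.pow_le_pow_right (Nat.lt_pow_self hp).le (Ideal.pow_mem_pow h2 _)
  have hker : ∀ u ∈ 𝔯, γ (u : A) = 0 := by
    intro u hu
    obtain ⟨h, hh, n, hn⟩ := Ideal.exists_mul_pow_mem_of_mem_minimalPrimes hmin hu
    rw [Ideal.mem_bot] at hn
    choose g hg using hroot h h.2.1
    refine (IsLocalization.map_eq_zero_iff S (Localization S) _).2 ⟨⟨g, h, hh, hg⟩, ?_⟩
    funext e
    change g e * (u : A) = 0
    have hn' : (h : A) * (u : A) ^ n = 0 := congrArg Subtype.val hn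
    refine eq_zero_of_pow_eq_zero (n := p ^ e * (n + 1)) ?_
    rw [mul_pow, pow_mul, hg]
    have hle : n ≤ p ^ e * (n + 1) :=
      n.le_succ.trans (Nat.le_mul_of_pos_left _ (pow_pos (zero_lt_one.trans hp) e))
    exact zero_dvd_iff.1 (hn' ▸ mul_dvd_mul (dvd_pow_self _ n.succ_ne_zero) (pow_dvd_pow _ hle))
  obtain ⟨B, _, φ, hφ, hφ1, hφd⟩ := RegMod.exists_dcomplete hreg'
  let j : U ⧸ 𝔯 →+* B := Ideal.Quotient.lift 𝔯 ((φ.comp γ).comp U.subtype) fun u hu => by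
    change φ (γ u) = 0
    rw [hker u hu, map_zero]
  have hl : ((x.map (algebraMap Q A)).map γ).map φ =
      x.map (j.comp ((Ideal.Quotient.mk 𝔯).comp iU)) := by
    rw [List.map_map, List.map_map]; rfl
  refine ⟨U ⧸ 𝔯, inferInstance, inferInstance, (Ideal.Quotient.mk 𝔯).comp iU, B, _, j, ?_, ?_, ?_, ?_,
    ?_, ?_⟩
  · rw [injective_iff_map_eq_zero]
    exact fun q hq => h𝔯0 q (Ideal.Quotient.eq_zero_iff_mem.1 hq)
  · exact (algebraMap_isIntegral_iff (R := Q) (A := U ⧸ 𝔯)).2 inferInstance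
  · refine MonicRoot.of_splits (Q := Q) fun P hP => ?_
    obtain ⟨s, hs, hPs⟩ := hsplit P hP
    have hsU : ∀ a ∈ s, a ∈ U := fun a ha => ⟨hs a ha, P, hP, by
      rw [← eval_map, hPs, eval_multiset_prod]
      exact Multiset.prod_eq_zero (Multiset.mem_map.2 ⟨X - C a, Multiset.mem_map_of_mem _ ha, by simp⟩)⟩
    lift s to Multiset U using hsU
    have hPU : P.map (algebraMap Q U) = (s.map (X - C ·)).prod := by
      refine Polynomial.map_injective U.subtype Subtype.val_injective ?_
      rw [Polynomial.map_map, ← Polynomial.coe_mapRingHom U.subtype, map_multiset_prod]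
      refine hPs.trans ?_
      simp [Multiset.map_map]
    rw [IsScalarTower.algebraMap_eq Q U (U ⧸ 𝔯), ← Polynomial.map_map, hPU,
      ← Polynomial.coe_mapRingHom, map_multiset_prod]
    refine Splits.multisetProd fun f hf => ?_
    obtain ⟨_, hg, rfl⟩ := Multiset.mem_map.1 hf
    obtain ⟨a, _, rfl⟩ := Multiset.mem_map.1 hg
    simp
  · exact hl ▸ hφ
  · exact fun h => h1' (hφ1 (hl ▸ h))
  · exact DComplete.forall_maximalIdeal (φ := j.comp ((Ideal.Quotient.mk 𝔯).comp iU)) (l := x)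
      (by rw [hx.span_eq]; exact (inferInstance : (maximalIdeal Q).IsPrime).isRadical.radical)
      fun a ha => hφd _ (List.mem_map_of_mem (List.mem_map_of_mem ha))

end

section

open IsLocalRing

universe u

theorem MonicRoot.exists_extension_of_injective {Q E D : Type*} [CommRing Q] [CommRing E] [IsDomain E]
    [CommRing D] [IsDomain D] (hD : MonicRoot D) {a : Q →+* E} (ha : Function.Injective a)
    (hintg : a.IsIntegral) {b : Q →+* D} (hb : Function.Injective b) :
    ∃ c : E →+* D, c.comp a = b := by
  have := ha.isDomain a
  let L := AlgebraicClosure (FractionRing D)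
  let ι : D →+* L := (algebraMap (FractionRing D) L).comp (algebraMap D (FractionRing D))
  have hι : Function.Injective ι := (algebraMap (FractionRing D) L).injective.comp (IsFractionRing.injective D (FractionRing D))
  algebraize [a, ι.comp b]
  have : Module.IsTorsionFree Q E := Module.isTorsionFree_iff_algebraMap_injective.2 ha
  have : Module.IsTorsionFree Q L := Module.isTorsionFree_iff_algebraMap_injective.2 (hι.comp hb)
  have : Algebra.IsIntegral Q E := (algebraMap_isIntegral_iff).1 hintg
  let g : E →ₐ[Q] L := IsAlgClosed.lift
  have hg : ∀ e, ∃ d, ι d = g e := fun e => by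
    refine hD.exists_eq_of_isIntegral ι ?_
    obtain ⟨P, hP, he⟩ := hintg e
    refine ⟨P.map b, hP.map b, ?_⟩
    rw [Polynomial.eval₂_map]
    have h1 := Polynomial.hom_eval₂ P a (g : E →+* L) e
    rw [he, map_zero] at h1
    rw [h1]
    congr 1
    exact (RingHom.ext fun q => (g.commutes q).symm)
  choose c hc using hg
  refine ⟨⟨⟨⟨c, hι ?_⟩, fun x y => hι ?_⟩, hι ?_, fun x y => hι ?_⟩, RingHom.ext fun q => hι ?_⟩
  · rw [hc, map_one, map_one]
  · simp only [hc, map_mul]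
  · simp only [hc, map_zero]
  · simp only [hc, map_add]
  · exact (hc _).trans (g.commutes q)

theorem MonicRoot.exists_extension {Q E D : Type*} [CommRing Q] [CommRing E]
    [CommRing D] [IsDomain D] (hD : MonicRoot D) {a : Q →+* E}
    (hintg : a.IsIntegral) {b : Q →+* D} (hab : RingHom.ker a ≤ RingHom.ker b) :
    ∃ c : E →+* D, c.comp a = b := by
  algebraize [a]
  have hp : (RingHom.ker b).IsPrime := RingHom.ker_isPrime b
  obtain ⟨P, -, hP, hPb⟩ := Ideal.exists_ideal_over_prime_of_isIntegral (R := Q) (S := E)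
    (RingHom.ker b) ⊥ hab
  obtain ⟨c, hc⟩ := hD.exists_extension_of_injective Ideal.quotientMap_injective
    (hintg.quotient (I := P)) (b := Ideal.Quotient.lift (P.comap a) b fun q hq => hPb.le hq)
    (RingHom.lift_injective_of_ker_le_ideal _ _ hPb.ge)
  exact ⟨c.comp (Ideal.Quotient.mk P), RingHom.ext fun q => RingHom.congr_fun hc (Ideal.Quotient.mk _ q)⟩

theorem exists_cmHom {p : ℕ} [Fact p.Prime] {K : Type u} [Field K] [CharP K p] [PerfectRing K p]
    {E : Type u} [CommRing E] [IsDomain E] [IsNoetherianRing E] [IsLocalRing E]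
    (hdE : ∀ a ∈ maximalIdeal E, DComplete a E) (hpE : (p : E) ≠ 0) (c : WittVector p K →+* E)
    (hc : ∀ e, ∃ a, e - c a ∈ maximalIdeal E) {D : Type u} [CommRing D] {i : E →+* D}
    (hi : i.IsIntegral) (hinj : Function.Injective i) :
    ∃ (C : Type u) (_ : CommRing C) (j : D →+* C), CMHom (j.comp i) ∧
      ∀ a ∈ maximalIdeal E, DComplete (j (i a)) C := by
  obtain ⟨s, hs⟩ := IsParam.exists_cons (IsRegularSystem.natCast_mem_maximalIdeal c hc) hpE
  obtain ⟨Q, _, _, _, _, _, cQ, x, hxl, hx, -, hQ⟩ :=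
    IsRegularSystem.exists_powerSeries (IsRegularSystem.wittVector p K) s.length
  obtain ⟨T, _, _, _, _, _, cT, y, hyl, hy, -, -⟩ :=
    IsRegularSystem.exists_powerSeries (IsRegularSystem.nil K) (s.length + 1)
  obtain ⟨t, z, rfl⟩ := List.exists_cons_of_length_eq_add_one hyl
  rw [List.map_nil, List.nil_append] at hy
  rw [List.map_singleton, List.singleton_append, map_natCast] at hx
  have : CharP T p := charP_of_injective_ringHom cT.injective p
  obtain ⟨ρ, hρ, hρx⟩ := hQ (WittVector p T) (WittVector.map cT) (z.map (WittVector.teichmuller p))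
    (by simpa [hxl] using hyl) (by
      intro a ha
      obtain ⟨b, hb, rfl⟩ := List.mem_map.1 ha
      refine WittVector.dcomplete_teichmuller (hy.dcomplete b ?_)
      rw [← hy.span_eq]
      exact Ideal.subset_span (s := {r | r ∈ t :: z}) (List.mem_cons_of_mem _ hb))
  have h1 : (1 : T) ∉ Ideal.ofList (t :: z) := by
    rw [hy.span_eq]
    exact (Ideal.ne_top_iff_one _).1 (Ideal.IsPrime.ne_top inferInstance)
  obtain ⟨A, _, _, σ, hA, hA1, A1, hσ, hsplit, hroot⟩ := Untilt.exists_reduced p hy.regMod h1 ρ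
  algebraize [σ.comp ρ]
  have hl : (p : A) :: z.map (fun a => σ (WittVector.teichmuller p a)) =
      ((p : Q) :: x).map (algebraMap Q A) := by
    rw [List.map_cons, map_natCast]
    congr 1
    rw [RingHom.algebraMap_toAlgebra, RingHom.coe_comp, ← List.map_map, hρx, List.map_map]
    rfl
  obtain ⟨D', _, _, i', B, _, j', hi'inj, hi', hD', hreg, hone, hd⟩ :=
    hx.exists_cm_of_reduced (hl ▸ hA) (hl ▸ hA1) A1 (fun q => hσ _) hsplit
      (Fact.out : p.Prime).one_lt hroot
  obtain ⟨ψ, hψ, hψx⟩ := hQ E c s rfl fun a ha => hdE a (hs.mem (List.mem_cons_of_mem _ ha))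
  have hpar : IsParam E (((p : Q) :: x).map ψ) := by
    rwa [List.map_cons, hψx, map_natCast]
  obtain ⟨hfin, hψinj⟩ := hx.finite_injective hdE ψ hpar fun e => (hc e).imp' cQ fun a ha => by
    rwa [← RingHom.comp_apply, hψ]
  obtain ⟨ε, hε⟩ := hD'.exists_extension (a := i.comp ψ) (hfin.to_isIntegral.trans _ _ hi) (b := i') (by
    rw [(RingHom.injective_iff_ker_eq_bot (i.comp ψ)).1 (by exact hinj.comp hψinj)]
    exact bot_le)
  have hcomp : ((j'.comp ε).comp i).comp ψ = j'.comp i' := by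
    rw [← hε]; rfl
  have hmap : (((p : Q) :: x).map ψ).map ((j'.comp ε).comp i) = ((p : Q) :: x).map (j'.comp i') := by
    rw [List.map_map, ← hcomp]; rfl
  have hdB : ∀ a ∈ maximalIdeal E, DComplete (((j'.comp ε).comp i) a) B := by
    refine DComplete.forall_maximalIdeal hpar.radical_eq fun a ha => ?_
    obtain ⟨b, hb, rfl⟩ := List.mem_map.1 ha
    have := hd b (by rw [← hx.span_eq]; exact Ideal.subset_span (s := {r | r ∈ _}) hb)
    rw [← RingHom.comp_apply, hcomp]
    exact this
  exact ⟨B, _, j'.comp ε, hpar.cmHom hdB (hmap ▸ hreg) (hmap ▸ hone), hdB⟩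

end

section

open IsLocalRing

theorem Ideal.ofList_map_pow_le {R : Type*} [CommRing R] (l : List R) (n : ℕ) :
    Ideal.ofList (l.map (· ^ n)) ≤ Ideal.ofList l ^ n := by
  refine Ideal.span_le.2 fun a ha => ?_
  obtain ⟨b, hb, rfl⟩ := List.mem_map.1 ha
  exact Ideal.pow_mem_pow (Ideal.subset_span (s := {r | r ∈ l}) hb) n

theorem Ideal.exists_pow_le_ofList_map_pow {R : Type*} [CommRing R] (l : List R) (n : ℕ) :
    ∃ k, Ideal.ofList l ^ k ≤ Ideal.ofList (l.map (· ^ n)) := by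
  classical
  refine Ideal.exists_pow_le_of_le_radical_of_fg (Ideal.span_le.2 fun a ha => ⟨n, ?_⟩)
    ⟨l.toFinset, ?_⟩
  · exact Ideal.subset_span (s := {r | r ∈ l.map (· ^ n)}) (List.mem_map.2 ⟨a, ha, rfl⟩)
  · exact congrArg Ideal.span (by ext; simp)

theorem Ideal.exists_ofList_eq {R : Type*} [CommRing R] [IsNoetherianRing R] (I : Ideal R) :
    ∃ l, Ideal.ofList l = I := by
  obtain ⟨s, hs⟩ := (isNoetherianRing_iff_ideal_fg R).1 inferInstance I
  refine ⟨s.toList, ?_⟩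
  rw [← hs]
  exact congrArg Ideal.span (by ext; simp)

theorem DComplete.isUnit_one_sub {R : Type*} [CommRing R] {a : R} (h : DComplete a R) :
    IsUnit (1 - a) := by
  obtain ⟨b, hb⟩ := (h.bijective_sub LinearMap.id).2 1
  exact .of_mul_eq_one b (by simpa [sub_mul] using hb)

theorem DComplete.le_jacobson_bot {R : Type*} [CommRing R] {I : Ideal R}
    (h : ∀ a ∈ I, DComplete a R) : I ≤ (⊥ : Ideal R).jacobson := fun x hx => by
  rw [Ideal.mem_jacobson_bot]
  intro y
  have := (h _ (I.mul_mem_left (-y) hx)).isUnit_one_sub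
  convert this using 1
  ring

theorem DComplete.isAdicComplete {R : Type*} [CommRing R] [IsNoetherianRing R] {I : Ideal R}
    (h : ∀ a ∈ I, DComplete a R) : IsAdicComplete I R := by
  obtain ⟨l, rfl⟩ := I.exists_ofList_eq
  have hsm : ∀ n, (Ideal.ofList l ^ n • ⊤ : Submodule R R) = Ideal.ofList l ^ n := fun n => by
    rw [smul_eq_mul, Ideal.mul_top]
  refine { haus' := fun x hx => ?_, prec' := fun f hf => ?_ }
  · have h1 := Ideal.iInf_pow_smul_eq_bot_of_le_jacobson (M := R) (Ideal.ofList l)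
      (DComplete.le_jacobson_bot h)
    rw [← Submodule.mem_bot (R := R), ← h1, Submodule.mem_iInf]
    exact fun i => by simpa [SModEq.zero] using hx i
  · choose k hk using Ideal.exists_pow_le_ofList_map_pow l
    let K : ℕ → ℕ := fun n => n + ∑ i ∈ Finset.range (n + 1), k i
    have hK : ∀ n, k n ≤ K n := fun n =>
      (Finset.single_le_sum (f := k) (fun _ _ => Nat.zero_le _) (Finset.self_mem_range_succ n)).trans
        (Nat.le_add_left _ _)
    have hKm : ∀ n, K n ≤ K (n + 1) := fun n => by
      simp only [K, Finset.sum_range_succ _ (n + 1)]; lia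
    have hmem : ∀ {m n}, m ≤ n → f n - f m ∈ Ideal.ofList l ^ m := fun {m n} hmn => by
      have := hf hmn
      rw [hsm] at this
      exact Ideal.Quotient.eq.1 this.symm
    obtain ⟨z, hz⟩ := DComplete.exists_limit
      (fun a ha => h a (Ideal.subset_span (s := {r | r ∈ l}) ha)) (fun n => f (K n))
      (fun n => hk n (Ideal.pow_le_pow_right (hK n) (hmem (hKm n))))
    refine ⟨z, fun n => ?_⟩
    rw [hsm]
    refine Ideal.Quotient.eq.2 ?_
    have h1 := Ideal.ofList_map_pow_le l n (hz n)
    have h2 := hmem (Nat.le_add_right n _ : n ≤ K n)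
    rw [← Ideal.neg_mem_iff]
    convert add_mem h1 h2 using 1
    ring

theorem DComplete.of_finite {Q E : Type*} [CommRing Q] [IsNoetherianRing Q] [CommRing E]
    [Algebra Q E] [Module.Finite Q E] {a : Q} (ha : DComplete a Q) :
    DComplete (algebraMap Q E a) E := by
  rw [← DComplete.of_ringHom (algebraMap Q E) a E (fun r m => Algebra.smul_def r m)]
  obtain ⟨n, f, hf⟩ := Module.Finite.exists_fin' Q E
  obtain ⟨m, g, hg⟩ := Module.Finite.exists_fin' Q (LinearMap.ker f)
  refine DComplete.of_exact f ((LinearMap.ker f).subtype ∘ₗ g) hf ?_ ?_ (DComplete.pi fun _ => ha)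
    (DComplete.pi fun _ => ha)
  · intro x hx
    obtain ⟨y, hy⟩ := hg ⟨x, hx⟩
    exact ⟨y, by simp [hy]⟩
  · intro x
    exact (g x).2

theorem isLocalRing_of_isArtinianRing_quotient {E : Type*} [CommRing E] [IsDomain E]
    (I : Ideal E) [IsAdicComplete I E] [IsArtinianRing (E ⧸ I)] : IsLocalRing E := by
  have hjac := IsAdicComplete.le_jacobson_bot I
  have hunit : ∀ a b : E, 1 - a * b ∈ I → IsUnit a := fun a b h => by
    have h1 := Ideal.mem_jacobson_bot.1 (hjac h) (-1)
    refine isUnit_of_mul_isUnit_left (y := b) ?_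
    convert h1 using 1
    ring
  refine IsLocalRing.of_isUnit_or_isUnit_one_sub_self fun a => ?_
  let q := Ideal.Quotient.mk I
  obtain ⟨n, y', hy'⟩ := IsArtinian.exists_pow_succ_smul_dvd (R := E ⧸ I) (M := E ⧸ I) (q a) 1
  obtain ⟨y, rfl⟩ := Ideal.Quotient.mk_surjective y'
  change q a ^ (n + 1) * q y = q a ^ n * 1 at hy'
  have hk : ∀ k, q a ^ n * (q a * q y) ^ k = q a ^ n := fun k => by
    induction k with
    | zero => simp
    | succ k ih =>
      calc q a ^ n * (q a * q y) ^ (k + 1) = (q a ^ n * (q a * q y) ^ k) * (q a * q y) := by ring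
        _ = q a ^ (n + 1) * q y := by rw [ih]; ring
        _ = _ := by rw [hy', mul_one]
  have hidem : q ((a * y) ^ n) * q ((a * y) ^ n) = q ((a * y) ^ n) := by
    simp only [map_pow, map_mul]
    calc (q a * q y) ^ n * (q a * q y) ^ n = (q a ^ n * (q a * q y) ^ n) * q y ^ n := by ring
      _ = _ := by rw [hk, mul_pow]
  set e := (a * y) ^ n with he
  have hmemI : e * e - e ∈ I := by
    rw [← Ideal.Quotient.eq_zero_iff_mem, map_sub, map_mul]; exact sub_eq_zero.2 hidem
  have hH : HenselianRing E I := inferInstance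
  obtain ⟨e₁, hroot, hee⟩ := hH.is_henselian (Polynomial.X ^ 2 - Polynomial.X)
    (by
      refine Polynomial.monic_X_pow_sub (n := 2) ?_
      rw [Polynomial.degree_X]; exact_mod_cast (by norm_num : (1 : ℕ) < 2)) e
    (by simpa [pow_two] using hmemI)
    (by
      refine .of_mul_eq_one (q (2 * e - 1)) ?_
      have : q (e * e - e) = 0 := Ideal.Quotient.eq_zero_iff_mem.2 hmemI
      simp only [Polynomial.derivative_sub, Polynomial.derivative_X_pow, Polynomial.derivative_X,
        Polynomial.eval_sub, Polynomial.eval_mul, Polynomial.eval_pow, Polynomial.eval_X,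
        Polynomial.eval_one, Polynomial.eval_C]
      change q _ * q _ = 1
      rw [← map_mul, ← map_one q, Ideal.Quotient.eq]
      convert I.mul_mem_left 4 hmemI using 1
      push_cast
      ring)
  have h01 : e₁ * (e₁ - 1) = 0 := by
    have := hroot.eq_zero
    simp at this
    linear_combination this
  rcases mul_eq_zero.1 h01 with h0 | h1
  · right
    have hmem : e ∈ I := by
      rw [h0, zero_sub] at hee; exact I.neg_mem_iff.1 hee
    have han : a ^ n ∈ I := by
      rw [← Ideal.Quotient.eq_zero_iff_mem, map_pow]
      change q a ^ n = 0
      rw [← hk n]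
      have : q e = 0 := Ideal.Quotient.eq_zero_iff_mem.2 hmem
      rw [he, map_pow, map_mul] at this
      rw [this, mul_zero]
    refine hunit _ (∑ i ∈ Finset.range n, a ^ i) ?_
    rw [mul_neg_geom_sum]
    simpa using han
  · left
    rw [sub_eq_zero] at h1
    rw [h1] at hee
    have : IsUnit (a ^ n) := hunit _ (y ^ n) (by rwa [← mul_pow])
    rcases Nat.eq_zero_or_pos n with rfl | hn
    · have h2 : q a * q y = 1 := by simpa using hy'
      refine hunit a y ?_
      rw [← Ideal.Quotient.eq, map_one, map_mul]; exact h2.symm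
    · exact (isUnit_pow_iff hn.ne').1 this

theorem isArtinianRing_quotient_map_maximalIdeal (Q E : Type*) [CommRing Q] [IsLocalRing Q]
    [CommRing E] [Algebra Q E] [Module.Finite Q E] :
    IsArtinianRing (E ⧸ (maximalIdeal Q).map (algebraMap Q E)) := by
  let _ : Field (Q ⧸ maximalIdeal Q) := Ideal.Quotient.field _
  let I := (maximalIdeal Q).map (algebraMap Q E)
  let _ : Algebra (Q ⧸ maximalIdeal Q) (E ⧸ I) :=
    (Ideal.quotientMap I (algebraMap Q E) Ideal.le_comap_map).toAlgebra
  have : IsScalarTower Q (Q ⧸ maximalIdeal Q) (E ⧸ I) := .of_algebraMap_eq fun _ => rfl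
  have : Module.Finite (Q ⧸ maximalIdeal Q) (E ⧸ I) := .of_restrictScalars_finite Q _ _
  exact IsArtinianRing.of_finite (Q ⧸ maximalIdeal Q) (E ⧸ I)

/-- A finite domain over a complete noetherian local ring is a complete local ring. -/
theorem IsLocalRing.of_finite_of_dcomplete {Q E : Type*} [CommRing Q] [IsNoetherianRing Q]
    [IsLocalRing Q] (hdQ : ∀ a ∈ maximalIdeal Q, DComplete a Q) [CommRing E] [IsDomain E]
    [Algebra Q E] [Module.Finite Q E] : IsLocalRing E := by
  have : IsNoetherianRing E := IsNoetherianRing.of_finite Q E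
  let I := (maximalIdeal Q).map (algebraMap Q E)
  have hI : ∀ a ∈ I, DComplete a E := fun a ha => by
    refine DComplete.of_mem_radical (s := algebraMap Q E '' maximalIdeal Q) ?_
      (Ideal.le_radical ha)
    rintro _ ⟨b, hb, rfl⟩
    exact (hdQ b hb).of_finite
  have : IsAdicComplete I E := DComplete.isAdicComplete hI
  have : IsArtinianRing (E ⧸ I) := isArtinianRing_quotient_map_maximalIdeal Q E
  exact isLocalRing_of_isArtinianRing_quotient I

theorem DComplete.of_mem_maximalIdeal_of_finite {Q E : Type*} [CommRing Q] [IsNoetherianRing Q]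
    [IsLocalRing Q] (hdQ : ∀ a ∈ maximalIdeal Q, DComplete a Q) [CommRing E] [IsLocalRing E]
    [Algebra Q E] [Module.Finite Q E] : ∀ a ∈ maximalIdeal E, DComplete a E := by
  have : IsNoetherianRing E := IsNoetherianRing.of_finite Q E
  let I := (maximalIdeal Q).map (algebraMap Q E)
  have : IsArtinianRing (E ⧸ I) := isArtinianRing_quotient_map_maximalIdeal Q E
  intro a ha
  refine DComplete.of_mem_radical (s := algebraMap Q E '' maximalIdeal Q) ?_ ?_
  · rintro _ ⟨b, hb, rfl⟩
    exact (hdQ b hb).of_finite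
  · change a ∈ I.radical
    rw [Ideal.radical_eq_sInf, Ideal.mem_sInf]
    rintro P ⟨hIP, hP⟩
    have : P.IsMaximal := by
      have : (P.map (Ideal.Quotient.mk I)).IsPrime := Ideal.map_isPrime_of_surjective
        Ideal.Quotient.mk_surjective (by simpa using hIP)
      have hm : (P.map (Ideal.Quotient.mk I)).IsMaximal := inferInstance
      have h2 := Ideal.comap_isMaximal_of_surjective _ Ideal.Quotient.mk_surjective (K := P.map (Ideal.Quotient.mk I))
      rwa [Ideal.comap_map_of_surjective _ Ideal.Quotient.mk_surjective, ← RingHom.ker_eq_comap_bot,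
        Ideal.mk_ker, sup_of_le_left hIP] at h2
    rw [IsLocalRing.eq_maximalIdeal this]
    exact ha

end

section

open IsLocalRing Polynomial

theorem Field.exists_lift_of_mul_eq_zero {p : ℕ} [Fact p.Prime] {k B : Type*} [Field k]
    [CommRing B] [CharP B p] [CharP k p] (J : Ideal B) (hJ : ∀ a ∈ J, ∀ b ∈ J, a * b = 0)
    (φ : k →+* B ⧸ J) : ∃ ψ : k →+* B, (Ideal.Quotient.mk J).comp ψ = φ := by
  have hp : p.Prime := Fact.out
  let P : Subring (k × B) := RingHom.eqLocus (φ.comp (RingHom.fst k B))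
    ((Ideal.Quotient.mk J).comp (RingHom.snd k B))
  have hP : ∀ x, x ∈ P ↔ φ x.1 = Ideal.Quotient.mk J x.2 := fun x => Iff.rfl
  let F := P.map (frobenius (k × B) p)
  have hF : ∀ x ∈ P, x ^ p ∈ F := fun x hx => ⟨x, hx, rfl⟩
  let S : Set (Subring (k × B)) := {G | F ≤ G ∧ G ≤ P ∧ ∀ b, ((0 : k), b) ∈ G → b = 0}
  have hFS : F ∈ S := by
    refine ⟨le_rfl, ?_, ?_⟩
    · rintro _ ⟨x, hx, rfl⟩; exact pow_mem hx p
    · rintro b ⟨x, hx, hxb⟩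
      have h1 : x.1 ^ p = 0 := congrArg Prod.fst hxb
      have h2 : x.2 ^ p = b := congrArg Prod.snd hxb
      have h3 : x.1 = 0 := pow_eq_zero_iff hp.ne_zero |>.1 h1
      have h4 := (hP x).1 hx
      rw [h3, map_zero] at h4
      have h5 : x.2 ∈ J := Ideal.Quotient.eq_zero_iff_mem.1 h4.symm
      obtain ⟨m, rfl⟩ := Nat.exists_eq_add_of_le hp.two_le
      rw [← h2, pow_add, pow_two, hJ _ h5 _ h5, zero_mul]
  obtain ⟨G, hFG, hmax⟩ := zorn_le_nonempty₀ S (fun c hcS hc G hG => by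
    refine ⟨sSup c, ⟨?_, ?_, ?_⟩, fun z hz => le_sSup hz⟩
    · exact (hcS hG).1.trans (le_sSup hG)
    · exact sSup_le fun z hz => (hcS hz).2.1
    · intro b hb
      obtain ⟨z, hz, hbz⟩ := (Subring.mem_sSup_of_directedOn ⟨G, hG⟩ hc.directedOn).1 hb
      exact (hcS hz).2.2 b hbz) F hFS
  obtain ⟨hG1, hG2, hG3⟩ := hmax.prop
  have hlift : ∀ a, ∃ b, (a, b) ∈ P := fun a => by
    obtain ⟨b, hb⟩ := Ideal.Quotient.mk_surjective (φ a)
    exact ⟨b, hb.symm⟩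
  let M : Subfield k :=
    { G.map (RingHom.fst k B) with
      inv_mem' := by
        rintro _ ⟨x, hx, rfl⟩
        obtain ⟨b, hb⟩ := hlift x.1⁻¹
        refine ⟨x ^ (p - 1) * (x.1⁻¹, b) ^ p, G.mul_mem (pow_mem hx _) (hG1 (hF _ hb)), ?_⟩
        change x.1 ^ (p - 1) * x.1⁻¹ ^ p = x.1⁻¹
        by_cases h0 : x.1 = 0
        · simp [h0, hp.ne_zero]
        · obtain ⟨m, hm⟩ := Nat.exists_eq_add_of_lt hp.pos
          rw [show p - 1 = m by omega, show p = m + 1 by omega, pow_succ, ← mul_assoc, ← mul_pow,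
            mul_inv_cancel₀ h0, one_pow, one_mul] }
  have hM : ∀ x ∈ G, x.1 ∈ M := fun x hx => ⟨x, hx, rfl⟩
  have hsurj : ∀ a, ∃ b, (a, b) ∈ G := by
    intro a
    by_contra hcon
    have haM : a ∉ M := by
      rintro ⟨x, hx, rfl⟩
      exact hcon ⟨x.2, hx⟩
    obtain ⟨b, hb⟩ := hlift a
    let z : k × B := (a, b)
    have hzp : z ^ p ∈ G := hG1 (hF z hb)
    have hapM : a ^ p ∈ M := hM _ hzp
    have hirr : Irreducible (X ^ p - C (⟨a ^ p, hapM⟩ : M)) := by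
      refine X_pow_sub_C_irreducible_of_prime hp fun y hy => haM ?_
      have : (y : k) ^ p = a ^ p := congrArg Subtype.val hy
      rw [← frobenius_inj k p this]
      exact y.2
    let t : G →+* M := ((RingHom.fst k B).comp G.subtype).codRestrict M fun x => hM _ x.2
    let G' := (Algebra.adjoin G {z}).toSubring
    have hGG' : G ≤ G' := fun x hx => (Algebra.adjoin G {z}).algebraMap_mem ⟨x, hx⟩
    have hzG' : z ∈ G' := Algebra.subset_adjoin rfl
    have hG'S : G' ∈ S := by
      refine ⟨hG1.trans hGG', ?_, ?_⟩
      · intro x hx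
        refine Algebra.adjoin_induction (p := fun x _ => x ∈ P) ?_ ?_ ?_ ?_ hx
        · rintro _ rfl; exact hb
        · exact fun r => hG2 r.2
        · exact fun _ _ _ _ => P.add_mem
        · exact fun _ _ _ _ => P.mul_mem
      · intro b' hb'
        obtain ⟨f, hf⟩ : ∃ f : G[X], aeval z f = ((0 : k), b') := by
          have : ((0 : k), b') ∈ Algebra.adjoin G {z} := hb'
          rw [Algebra.adjoin_singleton_eq_range_aeval] at this
          exact this
        let q : G[X] := X ^ p - C ⟨z ^ p, hzp⟩
        have hq : q.Monic := monic_X_pow_sub_C _ hp.ne_zero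
        have hq0 : aeval z q = 0 := by
          simp only [q, map_sub, map_pow, aeval_X, aeval_C]
          exact sub_self _
        have hr : aeval z (f %ₘ q) = ((0 : k), b') := by
          rw [← hf, ← sub_eq_zero, ← map_sub]
          have : f %ₘ q - f = q * (- (f /ₘ q)) := by
            linear_combination modByMonic_add_div f q
          rw [this, map_mul, hq0, zero_mul]
        have hdeg : (f %ₘ q).degree < p := by
          have := degree_modByMonic_lt f hq
          rwa [degree_X_pow_sub_C hp.pos] at this
        have h1 : aeval a ((f %ₘ q).map t) = 0 := by
          have := congrArg (RingHom.fst k B) hr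
          rw [aeval_def, hom_eval₂] at this
          rw [aeval_def, eval₂_map]
          exact this
        have h2 : (f %ₘ q).map t = 0 := by
          by_contra h3
          have h4 : minpoly M a = X ^ p - C (⟨a ^ p, hapM⟩ : M) :=
            (minpoly.eq_of_irreducible_of_monic hirr (by
              simp only [map_sub, map_pow, aeval_X, aeval_C]; exact sub_self _)
              (monic_X_pow_sub_C _ hp.ne_zero)).symm
          have h5 := minpoly.degree_le_of_ne_zero M a h3 h1
          rw [h4, degree_X_pow_sub_C hp.pos] at h5
          exact absurd (h5.trans degree_map_le) (not_le.2 hdeg)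
        have h3 : f %ₘ q = 0 := by
          ext1 i
          have h4 : t ((f %ₘ q).coeff i) = 0 := by rw [← coeff_map, h2, coeff_zero]
          have h5 : ((f %ₘ q).coeff i : k × B).1 = 0 := congrArg Subtype.val h4
          rw [coeff_zero]
          refine Subtype.ext (Prod.ext h5 (hG3 _ ?_))
          rw [← h5]
          exact ((f %ₘ q).coeff i).2
        rw [h3, map_zero] at hr
        exact (congrArg Prod.snd hr).symm
    exact hcon ⟨b, hmax.le_of_ge hG'S hGG' hzG'⟩
  let e : G ≃+* k := RingEquiv.ofBijective ((RingHom.fst k B).comp G.subtype) ⟨by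
    rw [injective_iff_map_eq_zero]
    rintro ⟨⟨a, b⟩, hx⟩ (h : a = 0)
    subst h
    exact Subtype.ext (Prod.ext rfl (hG3 b hx)), fun a => by
    obtain ⟨b, hb⟩ := hsurj a
    exact ⟨⟨_, hb⟩, rfl⟩⟩
  refine ⟨((RingHom.snd k B).comp G.subtype).comp e.symm.toRingHom, RingHom.ext fun a => ?_⟩
  obtain ⟨x, rfl⟩ := e.surjective a
  have := (hP _).1 (hG2 x.2)
  simp only [RingHom.comp_apply, RingEquiv.toRingHom_eq_coe, RingHom.coe_coe, RingEquiv.symm_apply_apply]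
  exact this.symm

end

section

open IsLocalRing Polynomial

/-- Ring homomorphisms out of `Λ` lift along surjections whose kernel `J` satisfies `J² = 0`
and `p J = 0`, provided that the target has characteristic `p` if `Λ` does. -/
def SqZeroLift.{u} (p : ℕ) (Λ : Type u) [CommRing Λ] : Prop :=
  ∀ (B B₁ : Type u) [CommRing B] [CommRing B₁] (π : B →+* B₁), Function.Surjective π →
    (∀ a b, π a = 0 → π b = 0 → a * b = 0) → (∀ a, π a = 0 → (p : B) * a = 0) →
    ((p : Λ) = 0 → (p : B) = 0) → ∀ φ : Λ →+* B₁, ∃ ψ : Λ →+* B, π.comp ψ = φ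

universe u

theorem Field.exists_lift {p : ℕ} [Fact p.Prime] {k B B₁ : Type*} [Field k] [CharP k p]
    [CommRing B] [CommRing B₁] {π : B →+* B₁} (hπ : Function.Surjective π)
    (hJ : ∀ a b, π a = 0 → π b = 0 → a * b = 0) (hp : (p : B) = 0) (φ : k →+* B₁) :
    ∃ ψ : k →+* B, π.comp ψ = φ := by
  rcases subsingleton_or_nontrivial B with hB | hB
  · have : Subsingleton B₁ := hπ.subsingleton
    refine ⟨{ toFun := fun _ => 0, map_one' := Subsingleton.elim _ _, map_mul' := by simp,
              map_zero' := rfl, map_add' := by simp }, RingHom.ext fun a => Subsingleton.elim _ _⟩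
  have : CharP B p := 
    ringChar.of_eq (CharP.ringChar_of_prime_eq_zero (Fact.out : p.Prime) hp)
  obtain ⟨ψ, hψ⟩ := Field.exists_lift_of_mul_eq_zero (p := p) (RingHom.ker π)
    (fun a ha b hb => hJ a b ha hb)
    ((RingHom.quotientKerEquivOfSurjective hπ).symm.toRingHom.comp φ)
  refine ⟨ψ, RingHom.ext fun a => ?_⟩
  have := congrArg (RingHom.quotientKerEquivOfSurjective hπ) (RingHom.congr_fun hψ a)
  simpa using this

theorem Field.sqZeroLift (p : ℕ) [Fact p.Prime] (k : Type u) [Field k] [CharP k p] :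
    SqZeroLift p k :=
  fun _ _ _ _ _ hπ hJ _ hp φ => Field.exists_lift hπ hJ (hp (CharP.cast_eq_zero k p)) φ

theorem SqZeroLift.of_quotient {p : ℕ} [Fact p.Prime] {Λ k : Type u} [CommRing Λ] [Field k]
    [CharP k p] {r : Λ →+* k} (hr : Function.Surjective r)
    (hker : ∀ a, r a = 0 → ∃ b, a = p * b) (hreg : ∀ a : Λ, (p : Λ) * a = 0 → a = 0) :
    SqZeroLift p Λ := by
  intro B B₁ _ _ π hπ hJ hpJ _ φ
  have hrp : r p = 0 := by rw [map_natCast, CharP.cast_eq_zero]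
  let P : Subring (B × Λ) := RingHom.eqLocus (π.comp (RingHom.fst B Λ)) (φ.comp (RingHom.snd B Λ))
  have hP : ∀ x : P, π (x : B × Λ).1 = φ (x : B × Λ).2 := fun x => x.2
  let sn : P →+* Λ := (RingHom.snd B Λ).comp P.subtype
  have hsn : Function.Surjective sn := fun a => by
    obtain ⟨b, hb⟩ := hπ (φ a)
    exact ⟨⟨(b, a), hb⟩, rfl⟩
  have hsn0 : ∀ x : P, sn x = 0 → π (x : B × Λ).1 = 0 := fun x hx => by
    rw [hP]
    change φ (sn x) = 0
    rw [hx, map_zero]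
  have hext : ∀ x : P, sn x = 0 → (x : B × Λ).1 = 0 → x = 0 := fun x h1 h2 =>
    Subtype.ext (Prod.ext h2 h1)
  let Q := P ⧸ Ideal.span {(p : P)}
  let q : P →+* Q := Ideal.Quotient.mk _
  have hq : Function.Surjective q := Ideal.Quotient.mk_surjective
  have hq0 : ∀ x, q x = 0 ↔ ∃ y, x = p * y := fun x => by
    rw [Ideal.Quotient.eq_zero_iff_mem, Ideal.mem_span_singleton]; rfl
  have hqp : ∀ y, q (p * y) = 0 := fun y => (hq0 _).2 ⟨y, rfl⟩
  let π' : Q →+* k := Ideal.Quotient.lift _ (r.comp sn) fun a ha => by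
    obtain ⟨y, rfl⟩ := (hq0 a).1 (Ideal.Quotient.eq_zero_iff_mem.2 ha)
    rw [map_mul, map_natCast, CharP.cast_eq_zero, zero_mul]
  have hπ' : ∀ x, π' (q x) = r (sn x) := fun x => rfl
  have hred : ∀ x : P, r (sn x) = 0 → ∃ y, sn (x - p * y) = 0 := fun x hx => by
    obtain ⟨b, hb⟩ := hker _ hx
    obtain ⟨y, rfl⟩ := hsn b
    exact ⟨y, by rw [map_sub, hb, map_mul, map_natCast, sub_self]⟩
  obtain ⟨s, hs⟩ := Field.exists_lift (p := p) (π := π')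
    (fun a => by
      obtain ⟨b, rfl⟩ := hr a
      obtain ⟨x, rfl⟩ := hsn b
      exact ⟨q x, rfl⟩)
    (fun a b ha hb => by
      obtain ⟨x, rfl⟩ := hq a
      obtain ⟨y, rfl⟩ := hq b
      obtain ⟨u, hu⟩ := hred x ha
      obtain ⟨v, hv⟩ := hred y hb
      have h1 : (x - p * u) * (y - p * v) = 0 := hext _ (by rw [map_mul, hu, zero_mul])
        (hJ _ _ (hsn0 _ hu) (hsn0 _ hv))
      have h2 := congrArg q h1
      rwa [map_mul, map_sub, map_sub, hqp, hqp, sub_zero, sub_zero, map_zero] at h2)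
    (by rw [← map_natCast q]; exact (hq0 _).2 ⟨1, (mul_one _).symm⟩) (RingHom.id k)
  have hs' : ∀ c, π' (s c) = c := RingHom.congr_fun hs
  let D := s.range.comap q
  let e : D ≃+* Λ := RingEquiv.ofBijective (sn.comp D.subtype) ⟨by
    rw [injective_iff_map_eq_zero]
    rintro ⟨x, c, hc⟩ (hx : sn x = 0)
    have h1 : c = 0 := by rw [← hs' c, hc, hπ', hx, map_zero]
    rw [h1, map_zero] at hc
    obtain ⟨y, rfl⟩ := (hq0 _).1 hc.symm
    have hy : sn y = 0 := hreg _ (by rw [← map_natCast sn, ← map_mul, hx])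
    refine Subtype.ext (hext _ hx ?_)
    exact hpJ _ (hsn0 _ hy), fun a => by
    obtain ⟨x, rfl⟩ := hsn a
    obtain ⟨z, hz⟩ := hq (s (r (sn x)))
    have h1 : r (sn (x - z)) = 0 := by
      rw [map_sub, map_sub, ← hπ' z, hz, hs', sub_self]
    obtain ⟨w, hw⟩ := hred _ h1
    refine ⟨⟨z + p * w, r (sn x), ?_⟩, ?_⟩
    · rw [map_add, hqp, add_zero, hz]
    · change sn (z + p * w) = sn x
      rw [← sub_eq_zero, ← neg_sub, ← map_sub, ← neg_eq_zero, neg_neg, ← hw]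
      congr 1; ring⟩
  refine ⟨((RingHom.fst B Λ).comp (P.subtype.comp D.subtype)).comp e.symm.toRingHom,
    RingHom.ext fun a => ?_⟩
  obtain ⟨x, rfl⟩ := e.surjective a
  simp only [RingHom.comp_apply, RingEquiv.toRingHom_eq_coe, RingHom.coe_coe,
    RingEquiv.symm_apply_apply]
  exact hP _

/-- Lifting along a complete separated filtration. -/
theorem RingHom.exists_lift_of_filtration {Λ P : Type*} [CommRing Λ] [CommRing P]
    (I : ℕ → Ideal P) (hI : ∀ n, I (n + 1) ≤ I n)
    (hlim : ∀ y : ℕ → P, (∀ n, y (n + 1) - y n ∈ I n) → ∃ z, ∀ n, z - y n ∈ I n)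
    (hsep : ∀ x, (∀ n, x ∈ I n) → x = 0)
    (hstep : ∀ n (φ : Λ →+* P ⧸ I n), ∃ ψ : Λ →+* P ⧸ I (n + 1),
      (Ideal.Quotient.factor (hI n)).comp ψ = φ) (φ : Λ →+* P ⧸ I 0) :
    ∃ ψ : Λ →+* P, (Ideal.Quotient.mk (I 0)).comp ψ = φ := by
  choose s hs using hstep
  let ψ : ∀ n, Λ →+* P ⧸ I n := fun n => Nat.rec φ (fun n φ => s n φ) n
  have hψ : ∀ n, (Ideal.Quotient.factor (hI n)).comp (ψ (n + 1)) = ψ n := fun n => hs n (ψ n)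
  have hz : ∀ a, ∃ z, ∀ n, Ideal.Quotient.mk (I n) z = ψ n a := fun a => by
    choose y hy using fun n => Ideal.Quotient.mk_surjective (ψ n a)
    obtain ⟨z, hz⟩ := hlim y fun n => by
      rw [← Ideal.Quotient.eq, hy, ← hψ n, RingHom.comp_apply, ← hy (n + 1),
        Ideal.Quotient.factor_mk]
    exact ⟨z, fun n => by rw [← hy, Ideal.Quotient.eq]; exact hz n⟩
  choose z hz using hz
  have huniq : ∀ x y, (∀ n, Ideal.Quotient.mk (I n) x = Ideal.Quotient.mk (I n) y) → x = y :=
    fun x y h => sub_eq_zero.1 (hsep _ fun n => Ideal.Quotient.eq.1 (h n))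
  exact ⟨{ toFun := z
           map_one' := huniq _ _ fun n => by rw [hz, map_one, map_one]
           map_mul' := fun a b => huniq _ _ fun n => by simp only [hz, map_mul]
           map_zero' := huniq _ _ fun n => by rw [hz, map_zero, map_zero]
           map_add' := fun a b => huniq _ _ fun n => by simp only [hz, map_add] },
    RingHom.ext fun a => hz a 0⟩

theorem SqZeroLift.exists_lift {p : ℕ} {Λ P : Type u} [CommRing Λ] [CommRing P]
    (hΛ : SqZeroLift p Λ) (h0 : (p : Λ) = 0 → (p : P) = 0)
    (I : ℕ → Ideal P) (hI : ∀ n, I (n + 1) ≤ I n)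
    (hmul : ∀ n, I n * I n ≤ I (n + 1)) (hp : ∀ n, ∀ a ∈ I n, (p : P) * a ∈ I (n + 1))
    (hlim : ∀ y : ℕ → P, (∀ n, y (n + 1) - y n ∈ I n) → ∃ z, ∀ n, z - y n ∈ I n)
    (hsep : ∀ x, (∀ n, x ∈ I n) → x = 0) (φ : Λ →+* P ⧸ I 0) :
    ∃ ψ : Λ →+* P, (Ideal.Quotient.mk (I 0)).comp ψ = φ := by
  refine RingHom.exists_lift_of_filtration I hI hlim hsep (fun n φ => ?_) φ
  have hker : ∀ x : P, Ideal.Quotient.factor (hI n) (Ideal.Quotient.mk _ x) = 0 ↔ x ∈ I n :=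
    fun x => by rw [Ideal.Quotient.factor_mk, Ideal.Quotient.eq_zero_iff_mem]
  refine hΛ _ _ _ (Ideal.Quotient.factor_surjective (hI n)) ?_ ?_ (fun h => ?_) φ
  · intro a b ha hb
    obtain ⟨a, rfl⟩ := Ideal.Quotient.mk_surjective a
    obtain ⟨b, rfl⟩ := Ideal.Quotient.mk_surjective b
    rw [← map_mul, Ideal.Quotient.eq_zero_iff_mem]
    exact hmul n (Ideal.mul_mem_mul ((hker a).1 ha) ((hker b).1 hb))
  · intro a ha
    obtain ⟨a, rfl⟩ := Ideal.Quotient.mk_surjective a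
    rw [← map_natCast (Ideal.Quotient.mk (I (n + 1))), ← map_mul, Ideal.Quotient.eq_zero_iff_mem]
    exact hp n a ((hker a).1 ha)
  · rw [← map_natCast (Ideal.Quotient.mk (I (n + 1))), h0 h, map_zero]

end

section

open IsLocalRing Polynomial

universe u

theorem MonicRoot.integralClosure (Q L : Type*) [CommRing Q] [Field L] [Algebra Q L]
    [IsAlgClosed L] : MonicRoot (integralClosure Q L) := by
  intro P hP hd
  obtain ⟨x, hx⟩ := IsAlgClosed.exists_root (P.map (algebraMap (_root_.integralClosure Q L) L))
    (by rw [hP.degree_map]; exact hd.ne')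
  rw [IsRoot, eval_map] at hx
  have h1 : IsIntegral (_root_.integralClosure Q L) x := ⟨P, hP, hx⟩
  have h2 : IsIntegral Q x := isIntegral_trans (A := _root_.integralClosure Q L) x h1
  refine ⟨⟨x, h2⟩, ?_⟩
  have : algebraMap (_root_.integralClosure Q L) L (P.eval ⟨x, h2⟩) = 0 := by
    rw [← hx, ← eval₂_at_apply]; rfl
  exact (FaithfulSMul.algebraMap_injective (_root_.integralClosure Q L) L)
    (this.trans (map_zero _).symm)

theorem MonicRoot.exists_isIntegral (Q : Type u) [CommRing Q] [IsDomain Q] :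
    ∃ (D : Type u) (_ : CommRing D) (_ : IsDomain D) (b : Q →+* D), Function.Injective b ∧
      b.IsIntegral ∧ MonicRoot D := by
  let L := AlgebraicClosure (FractionRing Q)
  have hinj : Function.Injective (algebraMap Q L) := by
    rw [IsScalarTower.algebraMap_eq Q (FractionRing Q) L]
    exact (algebraMap (FractionRing Q) L).injective.comp (IsFractionRing.injective Q _)
  refine ⟨_root_.integralClosure Q L, inferInstance, inferInstance, algebraMap Q _, ?_, ?_,
    MonicRoot.integralClosure Q L⟩
  · intro a b hab
    exact hinj (congrArg (algebraMap (_root_.integralClosure Q L) L) hab)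
  · exact algebraMap_isIntegral_iff.2 inferInstance

/-- A domain integral over a complete noetherian local ring is local. -/
theorem IsLocalRing.of_isIntegral_of_dcomplete {Q D : Type*} [CommRing Q] [IsNoetherianRing Q]
    [IsLocalRing Q] (hdQ : ∀ a ∈ maximalIdeal Q, DComplete a Q) [CommRing D] [IsDomain D]
    [Algebra Q D] [Algebra.IsIntegral Q D] : IsLocalRing D := by
  refine .of_isUnit_or_isUnit_one_sub_self fun e => ?_
  let S := Algebra.adjoin Q {e}
  have : Module.Finite Q S :=
    Algebra.finite_adjoin_simple_of_isIntegral (Algebra.IsIntegral.isIntegral e)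
  have : IsLocalRing S := IsLocalRing.of_finite_of_dcomplete hdQ
  let e' : S := ⟨e, Algebra.subset_adjoin rfl⟩
  exact (IsLocalRing.isUnit_or_isUnit_one_sub_self e').imp (fun h => h.map S.val)
    fun h => by simpa using h.map S.val

theorem MonicRoot.exists_isRoot_of_eval₂_eq_zero {A F : Type*} [CommRing A] [Nontrivial A]
    [CommRing F] [IsDomain F] (h : MonicRoot A) (f : A →+* F) {P : A[X]} (hP : P.Monic) {z : F}
    (hz : P.eval₂ f z = 0) : ∃ a, P.IsRoot a ∧ f a = z := by
  obtain ⟨s, rfl⟩ := h.exists_prod hP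
  rw [eval₂_multiset_prod, Multiset.prod_eq_zero_iff] at hz
  simp only [Multiset.map_map, Multiset.mem_map, Function.comp_apply, eval₂_sub, eval₂_X,
    eval₂_C] at hz
  obtain ⟨a, has, ha⟩ := hz
  refine ⟨a, ?_, (sub_eq_zero.1 ha).symm⟩
  rw [IsRoot, eval_multiset_prod]
  refine Multiset.prod_eq_zero (Multiset.mem_map.2 ⟨X - C a, Multiset.mem_map.2 ⟨a, has, rfl⟩, ?_⟩)
  simp

set_option maxHeartbeats 400000 in
/-- A characteristic zero local domain with roots of all monic polynomials contains, for each
subfield of its residue field, a subring in which `p` generates a maximal ideal with this residue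
field. -/
theorem MonicRoot.exists_subring {p : ℕ} [Fact p.Prime] {V κ k : Type*} [CommRing V] [IsDomain V]
    [Field κ] [Field k] [CharP k p] (hV : MonicRoot V) (ρ : V →+* κ)
    (hloc : ∀ v, ρ v ≠ 0 → IsUnit v) (i : k →+* κ) (hρ : ∀ x, ∃ v, ρ v = i x) :
    ∃ (S : Subring V) (t : S →+* k), Function.Surjective t ∧ ∀ s, t s = 0 → ∃ s', s = p * s' := by
  have hp : p.Prime := Fact.out
  have hκ : (p : κ) = 0 := by rw [← map_natCast i, CharP.cast_eq_zero, map_zero]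
  let T : Set (Subring V) := {S | (∀ s ∈ S, ρ s = 0 → ∃ s' ∈ S, s = p * s') ∧
    ∀ s ∈ S, ∃ x, i x = ρ s}
  have hT0 : (Int.castRingHom V).range ∈ T := by
    refine ⟨?_, ?_⟩
    · rintro _ ⟨n, rfl⟩ hn
      have h1 : (n : k) = 0 := i.injective (by simpa using hn)
      rw [CharP.intCast_eq_zero_iff k p] at h1
      obtain ⟨m, rfl⟩ := h1
      exact ⟨m, ⟨m, rfl⟩, by simp⟩
    · rintro _ ⟨n, rfl⟩
      exact ⟨n, by simp⟩
  obtain ⟨S, -, hmax⟩ := zorn_le_nonempty₀ T (fun c hcT hc S hS => by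
    refine ⟨sSup c, ⟨?_, ?_⟩, fun z hz => le_sSup hz⟩
    · intro s hs h0
      obtain ⟨z, hz, hsz⟩ := (Subring.mem_sSup_of_directedOn ⟨S, hS⟩ hc.directedOn).1 hs
      obtain ⟨s', hs', e⟩ := (hcT hz).1 s hsz h0
      exact ⟨s', le_sSup hz hs', e⟩
    · intro s hs
      obtain ⟨z, hz, hsz⟩ := (Subring.mem_sSup_of_directedOn ⟨S, hS⟩ hc.directedOn).1 hs
      exact (hcT hz).2 s hsz) _ hT0
  obtain ⟨hS1, hS2⟩ := hmax.prop
  have hadj : ∀ x, (∃ a, i a = ρ x) → (∀ y ∈ Algebra.adjoin S {x}, ρ y = 0 →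
      ∃ y' ∈ Algebra.adjoin S {x}, y = p * y') → x ∈ S := by
    intro x hx h
    refine hmax.le_of_ge (y := (Algebra.adjoin S {x}).toSubring) ⟨h, fun y hy => ?_⟩
      (fun y hy => (Algebra.adjoin S {x}).algebraMap_mem ⟨y, hy⟩) (Algebra.subset_adjoin rfl)
    refine Algebra.adjoin_induction (p := fun y _ => ∃ a, i a = ρ y) ?_ ?_ ?_ ?_ hy
    · rintro _ rfl; exact hx
    · exact fun r => hS2 r r.2
    · rintro _ _ _ _ ⟨a, ha⟩ ⟨b, hb⟩; exact ⟨a + b, by simp [ha, hb]⟩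
    · rintro _ _ _ _ ⟨a, ha⟩ ⟨b, hb⟩; exact ⟨a * b, by simp [ha, hb]⟩
  have hinv : ∀ s ∈ S, ∀ x, s * x = 1 → x ∈ S := by
    intro s hs x hsx
    have hρsx : ρ s * ρ x = 1 := by rw [← map_mul, hsx, map_one]
    refine hadj x ?_ fun y hy hy0 => ?_
    · obtain ⟨a, ha⟩ := hS2 s hs
      refine ⟨a⁻¹, ?_⟩
      rw [map_inv₀, ha, inv_eq_of_mul_eq_one_right hρsx]
    · have h1 : ∃ n, s ^ n * y ∈ S := by
        refine Algebra.adjoin_induction (p := fun y _ => ∃ n, s ^ n * y ∈ S) ?_ ?_ ?_ ?_ hy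
        · rintro _ rfl; exact ⟨1, by rw [pow_one, hsx]; exact S.one_mem⟩
        · exact fun r => ⟨0, by rw [pow_zero, one_mul]; exact r.2⟩
        · rintro a b _ _ ⟨m, hm⟩ ⟨n, hn⟩
          refine ⟨m + n, ?_⟩
          have := S.add_mem (S.mul_mem (pow_mem hs n) hm) (S.mul_mem (pow_mem hs m) hn)
          convert this using 1; ring
        · rintro a b _ _ ⟨m, hm⟩ ⟨n, hn⟩
          refine ⟨m + n, ?_⟩
          convert S.mul_mem hm hn using 1; ring
      obtain ⟨n, hn⟩ := h1
      obtain ⟨s', hs', e⟩ := hS1 _ hn (by rw [map_mul, hy0, mul_zero])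
      have hx' : x ∈ Algebra.adjoin S {x} := Algebra.subset_adjoin rfl
      have hs'' : s' ∈ Algebra.adjoin S {x} := (Algebra.adjoin S {x}).algebraMap_mem ⟨s', hs'⟩
      refine ⟨s' * x ^ n, Subalgebra.mul_mem _ hs'' (Subalgebra.pow_mem _ hx' n), ?_⟩
      calc y = (s * x) ^ n * y := by rw [hsx, one_pow, one_mul]
        _ = (s ^ n * y) * x ^ n := by ring
        _ = _ := by rw [e]; ring
  let M : Subfield k :=
    { (S.map ρ).comap i with
      inv_mem' := by
        rintro a ⟨s, hs, h : ρ s = i a⟩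
        by_cases ha : a = 0
        · subst ha; rw [inv_zero]; exact ((S.map ρ).comap i).zero_mem
        · obtain ⟨x, hx⟩ := (hloc s (by rw [h]; exact (map_ne_zero i).2 ha)).exists_right_inv
          refine ⟨x, hinv s hs x hx, ?_⟩
          have : ρ s * ρ x = 1 := by rw [← map_mul, hx, map_one]
          rw [map_inv₀, ← h, inv_eq_of_mul_eq_one_right this] }
  choose t ht using fun s : S => hS2 s s.2
  let t' : S →+* k :=
    { toFun := t
      map_one' := i.injective ((ht 1).trans ((map_one ρ).trans (map_one i).symm))
      map_mul' := fun a b => i.injective ((ht (a * b)).trans ((map_mul ρ _ _).trans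
        (by rw [map_mul, ht, ht])))
      map_zero' := i.injective ((ht 0).trans ((map_zero ρ).trans (map_zero i).symm))
      map_add' := fun a b => i.injective ((ht (a + b)).trans ((map_add ρ _ _).trans
        (by rw [map_add, ht, ht]))) }
  have ht' : i.comp t' = ρ.comp S.subtype := RingHom.ext ht
  have hker : ∀ s, t' s = 0 → ∃ s', s = p * s' := fun s hs => by
    obtain ⟨s', hs', e⟩ := hS1 s s.2 (by rw [← ht]; change i (t' s) = 0; rw [hs, map_zero])
    exact ⟨⟨s', hs'⟩, Subtype.ext (by simpa using e)⟩
  let u : S →+* M := t'.codRestrict M fun s => ⟨s, s.2, (ht s).symm⟩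
  have hu : Function.Surjective u := by
    rintro ⟨a, s, hs, h⟩
    refine ⟨⟨s, hs⟩, Subtype.ext (i.injective ?_)⟩
    exact (ht _).trans h
  have hu0 : ∀ f : S[X], f.map u = 0 → ∃ g, f = C (p : S) * g := fun f hf => by
    have : ∀ n, ∃ s', f.coeff n = p * s' := fun n => hker _ (by
      have := congrArg Subtype.val (show u (f.coeff n) = 0 by rw [← coeff_map, hf, coeff_zero])
      exact this)
    exact (C_dvd_iff_dvd_coeff _ _).2 this
  have heval : ∀ (f : S[X]) (a : k) (x : V), ρ x = i a → i (aeval a (f.map u)) = ρ (aeval x f) := by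
    intro f a x hx
    rw [aeval_def, eval₂_map, hom_eval₂, aeval_def, hom_eval₂, hx]
    congr 1
  refine ⟨S, t', fun a => ?_, hker⟩
  suffices a ∈ M by
    obtain ⟨s, hs⟩ := hu ⟨a, this⟩
    exact ⟨s, congrArg Subtype.val hs⟩
  obtain ⟨x, hx, hred⟩ : ∃ x, ρ x = i a ∧ ∀ g : S[X], ∃ r, aeval x g = aeval x r ∧
      (aeval a (r.map u) = 0 → r.map u = 0) := by
    by_cases ha : IsAlgebraic M a
    · have ha' : IsIntegral M a := ha.isIntegral
      obtain ⟨f, hf, hfd, hfm⟩ := lifts_and_degree_eq_and_monic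
        ((mem_lifts (f := u) (minpoly M a)).2 (map_surjective u hu _)) (minpoly.monic ha')
      obtain ⟨x, hx0, hx⟩ := hV.exists_isRoot_of_eval₂_eq_zero ρ (P := f.map (algebraMap S V))
        (hfm.map _) (z := i a) (by
          have : i (aeval a (f.map u)) = 0 := by rw [hf, minpoly.aeval, map_zero]
          rw [aeval_def, eval₂_map, hom_eval₂] at this
          rw [eval₂_map, ← this]
          congr 1
          exact ht'.symm)
      refine ⟨x, hx, fun g => ⟨g %ₘ f, ?_, fun h0 => ?_⟩⟩
      · have h1 : aeval x f = 0 := by rwa [IsRoot, eval_map] at hx0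
        conv_lhs => rw [← modByMonic_add_div g f]
        rw [map_add, map_mul, h1, zero_mul, add_zero]
      · by_contra h1
        have h2 := minpoly.degree_le_of_ne_zero M a h1 h0
        have h3 := degree_modByMonic_lt g hfm
        rw [← hfd] at h2
        exact absurd (h2.trans degree_map_le) (not_le.2 h3)
    · obtain ⟨x, hx⟩ := hρ a
      refine ⟨x, hx, fun g => ⟨g, rfl, fun h0 => ?_⟩⟩
      by_contra h1
      exact ha ⟨_, h1, h0⟩
  refine ⟨x, hadj x ⟨a, hx.symm⟩ fun y hy hy0 => ?_, hx⟩
  rw [Algebra.adjoin_singleton_eq_range_aeval] at hy ⊢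
  obtain ⟨g, rfl⟩ := hy
  obtain ⟨r, hr, hr0⟩ := hred g
  change ρ (aeval x g) = 0 at hy0
  rw [hr, ← heval r a x hx, map_eq_zero] at hy0
  obtain ⟨g', hg'⟩ := hu0 r (hr0 hy0)
  refine ⟨aeval x g', ⟨g', rfl⟩, ?_⟩
  change aeval x g = _
  rw [hr, hg', map_mul, aeval_C]
  simp

end

section

open IsLocalRing Polynomial

universe u

section Uniformizer

variable {Λ k : Type*} [CommRing Λ] [Field k] {ϖ : Λ} {r : Λ →+* k}

theorem isUnit_of_dcomplete (hr : Function.Surjective r) (hker : ∀ a, r a = 0 → ∃ b, a = ϖ * b)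
    (hd : DComplete ϖ Λ) {a : Λ} (ha : r a ≠ 0) : IsUnit a := by
  obtain ⟨b, hb⟩ := hr (r a)⁻¹
  obtain ⟨c, hc⟩ := hker (1 - a * b) (by rw [map_sub, map_mul, hb, map_one, mul_inv_cancel₀ ha, sub_self])
  have h1 : IsUnit (1 - ϖ * c) := (hd.mul_right c).isUnit_one_sub
  rw [← hc, sub_sub_cancel] at h1
  exact isUnit_of_mul_isUnit_left h1

theorem exists_eq_pow_mul_of_dcomplete (hker : ∀ a, r a = 0 → ∃ b, a = ϖ * b)
    (hreg : ∀ a, ϖ * a = 0 → a = 0) (hd : DComplete ϖ Λ) {x : Λ} (hx : x ≠ 0) :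
    ∃ n y, x = ϖ ^ n * y ∧ r y ≠ 0 := by
  by_contra! h
  have key : ∀ n, ∃ y, x = ϖ ^ n * y := by
    intro n
    induction n with
    | zero => exact ⟨x, by simp⟩
    | succ n ih =>
      obtain ⟨y, hy⟩ := ih
      obtain ⟨b, hb⟩ := hker y (h n y hy)
      exact ⟨b, by rw [hy, hb]; ring⟩
  choose y hy using key
  have hregn : ∀ n a, ϖ ^ n * a = 0 → a = 0 := by
    intro n
    induction n with
    | zero => intro a ha; simpa using ha
    | succ n ih => intro a ha; exact hreg a (ih _ (by rw [← ha]; ring))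
  have hz := hd.eq_zero (e := y) (fun n => ?_) 0
  · exact hx (by rw [hy 0, hz, mul_zero])
  · refine sub_eq_zero.mp (hregn n _ ?_)
    have := (hy n).symm.trans (hy (n + 1))
    rw [smul_eq_mul]
    linear_combination this

theorem isDomain_of_dcomplete
    (hker : ∀ a, r a = 0 → ∃ b, a = ϖ * b) (hreg : ∀ a, ϖ * a = 0 → a = 0)
    (hd : DComplete ϖ Λ) : IsDomain Λ := by
  have hnt : Nontrivial Λ := r.domain_nontrivial
  have : NoZeroDivisors Λ := by
    refine ⟨fun {a b} hab => ?_⟩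
    by_contra! h
    obtain ⟨n, y, rfl, hy⟩ := exists_eq_pow_mul_of_dcomplete hker hreg hd h.1
    obtain ⟨m, z, rfl, hz⟩ := exists_eq_pow_mul_of_dcomplete hker hreg hd h.2
    have hregn : ∀ n a, ϖ ^ n * a = 0 → a = 0 := by
      intro n
      induction n with
      | zero => intro a ha; simpa using ha
      | succ n ih => intro a ha; exact hreg a (ih _ (by rw [← ha]; ring))
    have h1 := hregn (n + m) (y * z) (by rw [← hab]; ring)
    exact mul_ne_zero hy hz (by rw [← map_mul, h1, map_zero])
  exact NoZeroDivisors.to_isDomain Λ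

theorem isDiscreteValuationRing_of_dcomplete [IsDomain Λ] (hr : Function.Surjective r)
    (hker : ∀ a, r a = 0 → ∃ b, a = ϖ * b) (hϖ : r ϖ = 0) (hreg : ∀ a, ϖ * a = 0 → a = 0)
    (hd : DComplete ϖ Λ) : IsDiscreteValuationRing Λ := by
  have h0 : ϖ ≠ 0 := fun h => one_ne_zero (hreg 1 (by rw [h, zero_mul]))
  refine IsDiscreteValuationRing.ofHasUnitMulPowIrreducibleFactorization ⟨ϖ, ⟨?_, ?_⟩, ?_⟩
  · intro h
    exact (h.map r).ne_zero hϖ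
  · rintro a b rfl
    by_contra! h
    have ha : r a = 0 := by
      by_contra h'
      exact h.1 (isUnit_of_dcomplete hr hker hd h')
    have hb : r b = 0 := by
      by_contra h'
      exact h.2 (isUnit_of_dcomplete hr hker hd h')
    obtain ⟨c, hc⟩ := hker a ha
    have h1 : 1 - b * c = 0 := by
      have : a ≠ 0 := left_ne_zero_of_mul h0
      refine (mul_eq_zero.mp (?_ : a * (1 - b * c) = 0)).resolve_left this
      linear_combination hc
    have := congrArg r h1
    rw [map_sub, map_mul, hb, map_one, map_zero] at this
    simp at this
  · intro x hx
    obtain ⟨n, y, rfl, hy⟩ := exists_eq_pow_mul_of_dcomplete hker hreg hd hx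
    exact ⟨n, associated_mul_unit_right _ _ (isUnit_of_dcomplete hr hker hd hy)⟩

theorem IsRegularSystem.of_dcomplete [IsLocalRing Λ] (hr : Function.Surjective r)
    (hker : ∀ a, r a = 0 → ∃ b, a = ϖ * b) (hϖ : r ϖ = 0) (hreg : ∀ a, ϖ * a = 0 → a = 0)
    (hd : DComplete ϖ Λ) : IsRegularSystem [ϖ] := by
  have hm : maximalIdeal Λ = Ideal.span {ϖ} := by
    ext a
    rw [mem_maximalIdeal, mem_nonunits_iff, Ideal.mem_span_singleton]
    constructor
    · intro h
      obtain ⟨b, rfl⟩ := hker a (by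
        by_contra h'
        exact h (isUnit_of_dcomplete hr hker hd h'))
      exact dvd_mul_right _ _
    · rintro ⟨b, rfl⟩ h
      refine (h.map r).ne_zero ?_
      rw [map_mul, hϖ, zero_mul]
  refine ⟨?_, ⟨fun b hb => ?_, trivial⟩, ?_⟩
  · rw [Ideal.ofList_singleton, hm]
  · exact hreg b hb
  · intro a ha
    rw [hm, Ideal.mem_span_singleton] at ha
    obtain ⟨b, rfl⟩ := ha
    exact hd.mul_right b

end Uniformizer

theorem exists_uniformizer_completion {S : Type u} {k : Type u} [CommRing S] [IsDomain S] [Field k]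
    {p : ℕ} (hp0 : (p : S) ≠ 0) {t : S →+* k} (ht : Function.Surjective t) (hpk : (p : k) = 0)
    (hker : ∀ s, t s = 0 → ∃ s', s = p * s') :
    ∃ (Λ : Type u) (_ : CommRing Λ) (r : Λ →+* k), Function.Surjective r ∧
      (∀ a, r a = 0 → ∃ b, a = p * b) ∧ (∀ a : Λ, (p : Λ) * a = 0 → a = 0) ∧
      DComplete (p : Λ) Λ := by
  let P := PowerSeries S
  let x : P := PowerSeries.X - (p : P)
  have hx : Ideal.Quotient.mk (Ideal.span {x}) (PowerSeries.X : P) = Ideal.Quotient.mk (Ideal.span {x}) (p : P) :=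
    Ideal.Quotient.eq.mpr (Ideal.mem_span_singleton_self _)
  let r₀ : P →+* k := t.comp PowerSeries.constantCoeff
  have hr₀ : ∀ a ∈ Ideal.span {x}, r₀ a = 0 := by
    intro a ha
    obtain ⟨b, rfl⟩ := Ideal.mem_span_singleton.mp ha
    have : PowerSeries.constantCoeff (PowerSeries.X : P) = 0 := PowerSeries.constantCoeff_X
    simp [r₀, x, hpk, this]
  refine ⟨P ⧸ Ideal.span {x}, inferInstance, Ideal.Quotient.lift _ r₀ hr₀, ?_, ?_, ?_, ?_⟩
  · exact Ideal.Quotient.lift_surjective_of_surjective _ _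
      (ht.comp PowerSeries.constantCoeff_surj)
  · intro a ha
    obtain ⟨a, rfl⟩ := Ideal.Quotient.mk_surjective a
    rw [Ideal.Quotient.lift_mk] at ha
    obtain ⟨s, hs⟩ := hker _ ha
    obtain ⟨g, hg⟩ : (PowerSeries.X : P) ∣ a - PowerSeries.C (p * s) := by
      rw [PowerSeries.X_dvd_iff, map_sub, PowerSeries.constantCoeff_C, hs, sub_self]
    refine ⟨Ideal.Quotient.mk _ (PowerSeries.C s + g), ?_⟩
    rw [sub_eq_iff_eq_add.mp hg, map_add, map_mul, hx, map_mul, map_natCast, map_mul, map_natCast,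
      map_natCast, map_add]
    ring
  · intro a ha
    obtain ⟨a, rfl⟩ := Ideal.Quotient.mk_surjective a
    rw [← map_natCast (Ideal.Quotient.mk (Ideal.span {x})) p, ← map_mul,
      Ideal.Quotient.eq_zero_iff_mem, Ideal.mem_span_singleton] at ha
    obtain ⟨g, hg⟩ := ha
    have h0 : (PowerSeries.X : P) ∣ a + g := by
      rw [PowerSeries.X_dvd_iff]
      have := congrArg PowerSeries.constantCoeff hg
      simp only [map_mul, map_natCast, x, map_sub, PowerSeries.constantCoeff_X] at this
      refine (mul_eq_zero.mp (?_ : (p : S) * _ = 0)).resolve_left hp0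
      rw [map_add]
      linear_combination this
    obtain ⟨h, hh⟩ := h0
    rw [Ideal.Quotient.eq_zero_iff_mem, Ideal.mem_span_singleton]
    have h2 : g = p * h := by
      refine PowerSeries.X_mul_cancel ?_
      linear_combination (p : P) * hh - hg
    refine ⟨h, ?_⟩
    linear_combination hh - h2
  · have h1 := (PowerSeries.dcomplete_X (C := S)).quotient (I := Ideal.span {x}) ⟨{x}, by simp⟩
    rw [← map_natCast (Ideal.Quotient.mk (Ideal.span {x})) p, ← hx]
    rw [← DComplete.of_ringHom (Ideal.Quotient.mk (Ideal.span {x})) (PowerSeries.X : P) _ (fun r m => rfl)]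
    exact h1

/-- Existence of Cohen rings. -/
theorem exists_cohenRing (p : ℕ) [Fact p.Prime] (k : Type u) [Field k] [CharP k p] :
    ∃ (Λ : Type u) (_ : CommRing Λ) (_ : IsDomain Λ) (_ : IsNoetherianRing Λ) (_ : IsLocalRing Λ)
      (_ : IsIntegrallyClosed Λ), (p : Λ) ≠ 0 ∧ IsRegularSystem [(p : Λ)] ∧ SqZeroLift p Λ ∧
      ∃ r : Λ →+* k, Function.Surjective r := by
  have hp : p.Prime := Fact.out
  let K := AlgebraicClosure k
  have : CharP K p := charP_of_injective_algebraMap (algebraMap k K).injective p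
  let W := WittVector p K
  obtain ⟨V, _, _, b, hb, hbi, hV⟩ := MonicRoot.exists_isIntegral W
  algebraize [b]
  have hW : ∀ a ∈ maximalIdeal W, DComplete a W := (IsRegularSystem.wittVector p K).dcomplete
  have : IsLocalRing V := IsLocalRing.of_isIntegral_of_dcomplete hW
  have hloc : IsLocalHom b := hbi.isLocalHom hb
  let ρ : V →+* ResidueField V := residue V
  have hW0 : ∀ w : W, WittVector.constantCoeff w = 0 → (ρ.comp b) w = 0 := by
    intro w hw
    have h1 : w ∈ maximalIdeal W := by
      rw [IsRegularSystem.maximalIdeal_wittVector, ← Untilt.comap_constantCoeff_bot]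
      exact hw
    rw [RingHom.comp_apply, residue_eq_zero_iff]
    exact (map_mem_nonunits_iff b w).mpr h1
  let j : K →+* ResidueField V :=
    RingHom.liftOfSurjective WittVector.constantCoeff (Untilt.constantCoeff_surjective p)
      ⟨ρ.comp b, hW0⟩
  have hj : ∀ w : W, j (WittVector.constantCoeff w) = ρ (b w) := fun w =>
    RingHom.liftOfRightInverse_comp_apply _ _ _ _ w
  obtain ⟨S, t, ht, hker⟩ := hV.exists_subring (p := p) ρ
    (fun v hv => by
      by_contra h
      exact hv ((residue_eq_zero_iff v).mpr h)) (j.comp (algebraMap k K)) (fun x => by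
      obtain ⟨w, hw⟩ := Untilt.constantCoeff_surjective p (algebraMap k K x)
      exact ⟨b w, by rw [← hj, hw]; rfl⟩)
  have hpW : (p : W) ≠ 0 := fun h => one_ne_zero
    (Untilt.mul_p_injective p (1 : W) (by rw [h, zero_mul]))
  have hpS : (p : S) ≠ 0 := fun h => hpW (hb (by
    have := congrArg S.subtype h
    rw [map_natCast, map_zero] at this
    rw [map_natCast, map_zero, this]))
  obtain ⟨Λ, _, r, hr, hkerr, hreg, hd⟩ := exists_uniformizer_completion hpS ht
    (CharP.cast_eq_zero k p) hker
  have hrp : r p = 0 := by rw [map_natCast, CharP.cast_eq_zero]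
  have := isDomain_of_dcomplete hkerr hreg hd
  have := isDiscreteValuationRing_of_dcomplete hr hkerr hrp hreg hd
  exact ⟨Λ, inferInstance, inferInstance, inferInstance, inferInstance, inferInstance,
    fun h => one_ne_zero (hreg 1 (by rw [h, zero_mul])),
    IsRegularSystem.of_dcomplete hr hkerr hrp hreg hd, SqZeroLift.of_quotient hr hkerr hreg, r, hr⟩

end

section

open Polynomial

section Conjugates

variable {Q A : Type*} [CommRing Q] [IsDomain Q] [IsIntegrallyClosed Q] [CommRing A] [IsDomain A]
  [Algebra Q A] [Algebra.IsIntegral Q A]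

theorem MonicRoot.exists_algEquiv (hA : MonicRoot A)
    (hinj : Function.Injective (algebraMap Q A)) {a b : A} (hab : aeval b (minpoly Q a) = 0) :
    ∃ σ : A ≃ₐ[Q] A, σ a = b := by
  let K := FractionRing Q
  let L := AlgebraicClosure K
  have hL : MonicRoot L := fun P _ hP => IsAlgClosed.exists_root P hP.ne'
  obtain ⟨c, hc⟩ := hL.exists_extension (a := algebraMap Q A) (b := algebraMap Q L)
    Algebra.IsIntegral.isIntegral (by
      intro x hx
      rw [RingHom.mem_ker] at hx ⊢
      rw [hinj (hx.trans (map_zero _).symm), map_zero])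
  have hQL : Function.Injective (algebraMap Q L) :=
    (algebraMap K L).injective.comp (IsFractionRing.injective Q K)
  have hcinj : Function.Injective c := by
    rw [RingHom.injective_iff_ker_eq_bot]
    refine Ideal.eq_bot_of_comap_eq_bot (R := Q) ?_
    rw [RingHom.comap_ker, hc, ← RingHom.injective_iff_ker_eq_bot]
    exact hQL
  algebraize [c]
  have ht : IsScalarTower Q A L := IsScalarTower.of_algebraMap_eq' hc.symm
  have hIC : IsIntegralClosure A Q L := by
    refine ⟨hcinj, fun {x} => ⟨fun hx => ?_, ?_⟩⟩
    · exact hA.exists_eq_of_isIntegral c (hx.tower_top (A := A))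
    · rintro ⟨y, rfl⟩
      exact (Algebra.IsIntegral.isIntegral y).algebraMap
  have h1 : aeval (c b) (minpoly K (c a)) = 0 := by
    have h2 := minpoly.isIntegrallyClosed_eq_field_fractions K L (Algebra.IsIntegral.isIntegral (R := Q) a)
    rw [RingHom.algebraMap_toAlgebra] at h2
    rw [h2, aeval_map_algebraMap]
    have := congrArg c hab
    rw [map_zero] at this
    rw [← this]
    exact (aeval_algebraMap_apply L b (minpoly Q a))
  obtain ⟨σ, hσ⟩ := minpoly.exists_algEquiv_of_root' (Algebra.IsAlgebraic.isAlgebraic (R := K) (c a)) h1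
  refine ⟨galRestrict Q K L A σ, hcinj ?_⟩
  rw [← hσ]
  exact algebraMap_galRestrict_apply Q σ a

theorem MonicRoot.map_eq_of_forall_algEquiv (hA : MonicRoot A)
    (hinj : Function.Injective (algebraMap Q A)) {D : Type*} [CommRing D] [IsDomain D]
    {φ ψ : A →+* D} (h : φ.comp (algebraMap Q A) = ψ.comp (algebraMap Q A)) {a : A}
    (ha : ∀ σ : A ≃ₐ[Q] A, σ a = a) : φ a = ψ a := by
  have hm : (minpoly Q a).Monic := minpoly.monic (Algebra.IsIntegral.isIntegral a)
  obtain ⟨s, hs⟩ := hA.exists_prod (hm.map (algebraMap Q A))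
  have hsa : ∀ b ∈ s, b = a := by
    intro b hb
    obtain ⟨σ, rfl⟩ := hA.exists_algEquiv hinj (a := a) (b := b) (by
      rw [aeval_def, ← eval_map, hs, eval_multiset_prod, Multiset.map_map]
      exact Multiset.prod_eq_zero (Multiset.mem_map.mpr ⟨b, hb, by simp⟩))
    exact ha σ
  obtain ⟨n, hn⟩ : ∃ n, s = Multiset.replicate n a := ⟨_, Multiset.eq_replicate_card.mpr hsa⟩
  rw [hn, Multiset.map_replicate, Multiset.prod_replicate] at hs
  have h1 : (X - C (φ a)) ^ n = (X - C (ψ a) : D[X]) ^ n := by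
    have h2 := congrArg (Polynomial.map φ) hs
    have h3 := congrArg (Polynomial.map ψ) hs
    rw [map_map] at h2 h3
    rw [h] at h2
    simpa using h2.symm.trans h3
  have h4 := congrArg (Polynomial.eval (φ a)) h1
  rcases Nat.eq_zero_or_pos n with rfl | hn0
  · simp at hs
    have h5 := minpoly.aeval Q a
    rw [aeval_def, ← eval_map, hs] at h5
    simp at h5
  · simp [hn0.ne'] at h4
    exact sub_eq_zero.mp ((pow_eq_zero_iff hn0.ne').mp h4.symm)

theorem MonicRoot.exists_algEquiv_map_eq (hA : MonicRoot A)
    (hinj : Function.Injective (algebraMap Q A)) {D : Type*} [CommRing D] [IsDomain D]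
    {φ ψ : A →+* D} (h : φ.comp (algebraMap Q A) = ψ.comp (algebraMap Q A)) (g : A[X]) :
    ∃ σ : A ≃ₐ[Q] A, g.map (φ.comp (σ : A →+* A)) = g.map ψ := by
  classical
  let O : Set A[X] := Set.range fun σ : A ≃ₐ[Q] A => g.map (σ : A →+* A)
  have hO : O.Finite := by
    have hpi : (Set.univ.pi fun i : Fin (g.natDegree + 1) =>
        {b : A | b ∈ ((minpoly Q (g.coeff i)).map (algebraMap Q A)).roots}).Finite :=
      Set.Finite.pi fun i => Multiset.finite_toSet _
    refine Set.Finite.of_finite_image (f := fun h (i : Fin (g.natDegree + 1)) => h.coeff i)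
      (hpi.subset ?_) ?_
    · rintro _ ⟨_, ⟨σ, rfl⟩, rfl⟩ i -
      have hm : (minpoly Q (g.coeff i)).Monic := minpoly.monic (Algebra.IsIntegral.isIntegral _)
      change _ ∈ Polynomial.roots _
      rw [mem_roots (hm.map _).ne_zero, IsRoot, eval_map, ← aeval_def]
      change aeval ((g.map (σ : A →+* A)).coeff i) _ = 0
      rw [coeff_map]
      change aeval (σ (g.coeff i)) _ = 0
      rw [aeval_algHom_apply, minpoly.aeval, map_zero]
    · rintro _ ⟨σ, rfl⟩ _ ⟨τ, rfl⟩ hστ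
      ext i
      by_cases hi : i < g.natDegree + 1
      · exact congrFun hστ ⟨i, hi⟩
      · have : g.coeff i = 0 := coeff_eq_zero_of_natDegree_lt (by omega)
        simp [this]
  let F : A[X][X] := ∏ h ∈ hO.toFinset, (X - C h)
  have hF : ∀ σ : A ≃ₐ[Q] A, F.map (mapRingHom (σ : A →+* A)) = F := by
    intro σ
    simp only [F, Polynomial.map_prod, Polynomial.map_sub, map_X, map_C, coe_mapRingHom]
    refine Finset.prod_bij' (fun h _ => h.map (σ : A →+* A)) (fun h _ => h.map (σ.symm : A →+* A))
      ?_ ?_ ?_ ?_ ?_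
    · intro h hh
      obtain ⟨τ, rfl⟩ := hO.mem_toFinset.mp hh
      exact hO.mem_toFinset.mpr ⟨τ.trans σ, by rw [map_map]; rfl⟩
    · intro h hh
      obtain ⟨τ, rfl⟩ := hO.mem_toFinset.mp hh
      exact hO.mem_toFinset.mpr ⟨τ.trans σ.symm, by rw [map_map]; rfl⟩
    · intro h _
      ext i
      simp
    · intro h _
      ext i
      simp
    · intro h _
      rfl
  have hφψ : F.map (mapRingHom φ) = F.map (mapRingHom ψ) := by
    ext i j
    simp only [coeff_map, coe_mapRingHom]
    refine hA.map_eq_of_forall_algEquiv hinj h fun σ => ?_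
    have := congrArg (fun P : A[X][X] => (P.coeff i).coeff j) (hF σ)
    simp only [coeff_map, coe_mapRingHom] at this
    exact this
  have h0 : (F.map (mapRingHom φ)).eval (g.map ψ) = 0 := by
    rw [hφψ, ← coe_mapRingHom, eval_map_apply]
    have : F.eval g = 0 := by
      simp only [F, eval_prod]
      refine Finset.prod_eq_zero (i := g) (hO.mem_toFinset.mpr ⟨AlgEquiv.refl, ?_⟩) (by simp)
      exact Polynomial.map_id
    rw [this, map_zero]
  simp only [F, Polynomial.map_prod, Polynomial.map_sub, map_X, map_C, coe_mapRingHom, eval_prod,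
    eval_sub, eval_X, eval_C, Finset.prod_eq_zero_iff] at h0
  obtain ⟨_, hh, h1⟩ := h0
  obtain ⟨σ, rfl⟩ := hO.mem_toFinset.mp hh
  exact ⟨σ, by rw [← map_map]; exact (sub_eq_zero.mp h1).symm⟩

/-- Two homomorphisms from an absolute integral closure of a normal domain `Q` to a domain which
agree on `Q` differ by an endomorphism over `Q`. -/
theorem MonicRoot.exists_comp_eq (hA : MonicRoot A)
    (hinj : Function.Injective (algebraMap Q A)) {D : Type*} [CommRing D] [IsDomain D]
    {φ ψ : A →+* D} (h : φ.comp (algebraMap Q A) = ψ.comp (algebraMap Q A)) :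
    ∃ σ : A →+* A, σ.comp (algebraMap Q A) = algebraMap Q A ∧ φ.comp σ = ψ := by
  classical
  have key : ∀ s : Finset A, ∃ σ : A ≃ₐ[Q] A, ∀ a ∈ s, φ (σ a) = ψ a := by
    intro s
    let e := s.equivFin
    obtain ⟨σ, hσ⟩ := hA.exists_algEquiv_map_eq hinj h
      (∑ i : Fin s.card, monomial (i : ℕ) (e.symm i : A))
    refine ⟨σ, fun a ha => ?_⟩
    have := congrArg (fun P => P.coeff (e ⟨a, ha⟩ : ℕ)) hσ
    simp only [coeff_map, finsetSum_coeff, coeff_monomial, Fin.val_inj] at this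
    simpa using this
  choose σ hσ using key
  let U : Ultrafilter (Finset A) := Ultrafilter.of Filter.atTop
  have hU : (U : Filter (Finset A)) ≤ Filter.atTop := Ultrafilter.of_le _
  have hex : ∀ a : A, ∃ b, ∀ᶠ s in (U : Filter (Finset A)), σ s a = b := by
    intro a
    have hfin : {b : A | b ∈ ((minpoly Q a).map (algebraMap Q A)).roots}.Finite :=
      Multiset.finite_toSet _
    obtain ⟨b, -, hb⟩ := (Ultrafilter.eventually_exists_mem_iff (f := U)
      (P := fun b s => σ s a = b) hfin).mp (Filter.Eventually.of_forall fun s =>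
        ⟨σ s a, by
          have hm : (minpoly Q a).Monic := minpoly.monic (Algebra.IsIntegral.isIntegral _)
          change _ ∈ Polynomial.roots _
          rw [mem_roots (hm.map _).ne_zero, IsRoot, eval_map, ← aeval_def, aeval_algHom_apply,
            minpoly.aeval, map_zero], rfl⟩)
    exact ⟨b, hb⟩
  choose τ hτ using hex
  have huniq : ∀ {a b : A}, (∀ᶠ s in (U : Filter (Finset A)), σ s a = b) → τ a = b := by
    intro a b hb
    obtain ⟨s, h1, h2⟩ := ((hτ a).and hb).exists
    exact h1.symm.trans h2
  refine ⟨{ toFun := τ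
            map_one' := huniq (Filter.Eventually.of_forall fun s => map_one _)
            map_zero' := huniq (Filter.Eventually.of_forall fun s => map_zero _)
            map_mul' := fun a b => huniq (by
              filter_upwards [hτ a, hτ b] with s h1 h2
              rw [map_mul, h1, h2])
            map_add' := fun a b => huniq (by
              filter_upwards [hτ a, hτ b] with s h1 h2
              rw [map_add, h1, h2]) }, ?_, ?_⟩
  · ext q
    exact huniq (Filter.Eventually.of_forall fun s => (σ s).commutes q)
  · ext a
    have h1 : ∀ᶠ s : Finset A in (U : Filter (Finset A)), a ∈ s :=
      hU ((Filter.eventually_ge_atTop {a}).mono fun s hs => hs (Finset.mem_singleton_self a))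
    obtain ⟨s, h2, h3⟩ := ((hτ a).and h1).exists
    change φ (τ a) = ψ a
    rw [← h2, hσ s a h3]

end Conjugates

end

section

open IsLocalRing

universe u

theorem IsAdicComplete.exists_limit {R : Type*} [CommRing R] (I : Ideal R) [IsAdicComplete I R]
    (y : ℕ → R) (hy : ∀ n, y (n + 1) - y n ∈ I ^ (n + 1)) :
    ∃ z, ∀ n, z - y n ∈ I ^ (n + 1) := by
  have hmn : ∀ m n, m ≤ n → y n - y m ∈ I ^ m := by
    intro m n h
    induction n, h using Nat.le_induction with
    | base => simp
    | succ n hmn ih =>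
      have := add_mem (Ideal.pow_le_pow_right (by omega) (hy n)) ih
      rwa [sub_add_sub_cancel] at this
  obtain ⟨z, hz⟩ := IsPrecomplete.prec' (I := I) (M := R) y (fun {m n} h => by
    rw [SModEq.comm, SModEq.sub_mem, smul_eq_mul, Ideal.mul_top]
    exact hmn m n h)
  refine ⟨z, fun n => ?_⟩
  have h1 := hz (n + 1)
  rw [SModEq.comm, SModEq.sub_mem, smul_eq_mul, Ideal.mul_top] at h1
  have := add_mem h1 (hy n)
  rwa [sub_add_sub_cancel] at this

theorem IsLocalRing.eq_zero_of_forall_mem_pow {E : Type*} [CommRing E] [IsNoetherianRing E]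
    [IsLocalRing E] {x : E} (hx : ∀ n, x ∈ maximalIdeal E ^ (n + 1)) : x = 0 := by
  have h := Ideal.iInf_pow_eq_bot_of_isLocalRing (maximalIdeal E) (Ideal.IsPrime.ne_top')
  have : x ∈ (⨅ i : ℕ, maximalIdeal E ^ i) := by
    rw [Ideal.mem_iInf]
    exact fun i => Ideal.pow_le_pow_right (Nat.le_succ i) (hx i)
  rwa [h, Ideal.mem_bot] at this

set_option maxHeartbeats 400000 in
/-- Compatible coefficient rings for a local homomorphism `φ` and a surjection onto its target. -/
theorem SqZeroLift.exists_lift_pair {p : ℕ} {Λ R Q E : Type u} [CommRing Λ] [CommRing R]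
    [IsNoetherianRing R] [IsLocalRing R] [CommRing Q] [IsNoetherianRing Q] [IsLocalRing Q]
    [CommRing E] [IsNoetherianRing E] [IsLocalRing E] (hΛ : SqZeroLift p Λ)
    (h0 : (p : Λ) = 0 → (p : R) = 0 ∧ (p : Q) = 0)
    (hdR : ∀ a ∈ maximalIdeal R, DComplete a R) (hdQ : ∀ a ∈ maximalIdeal Q, DComplete a Q)
    (hpR : (p : R) ∈ maximalIdeal R) (hpQ : (p : Q) ∈ maximalIdeal Q)
    (φ : R →+* E) [IsLocalHom φ] {π : Q →+* E} (hπ : Function.Surjective π)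
    (r : Λ →+* ResidueField R) :
    ∃ (a : Λ →+* R) (b : Λ →+* Q), φ.comp a = π.comp b ∧ (residue R).comp a = r := by
  have : IsAdicComplete (maximalIdeal R) R := DComplete.isAdicComplete hdR
  have : IsAdicComplete (maximalIdeal Q) Q := DComplete.isAdicComplete hdQ
  have hπl : IsLocalHom π := hπ.isLocalHom
  have hπm : ∀ n, ∀ x ∈ maximalIdeal Q ^ n, π x ∈ maximalIdeal E ^ n := fun n x hx => by
    have := Ideal.mem_map_of_mem π hx
    rw [Ideal.map_pow] at this
    exact Ideal.pow_right_mono (((local_hom_TFAE π).out 0 2).mp hπl) n this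
  have hφm : ∀ n, ∀ x ∈ maximalIdeal R ^ n, φ x ∈ maximalIdeal E ^ n := fun n x hx => by
    have := Ideal.mem_map_of_mem φ hx
    rw [Ideal.map_pow] at this
    exact Ideal.pow_right_mono (((local_hom_TFAE φ).out 0 2).mp ‹_›) n this
  let P : Subring (R × Q) := RingHom.eqLocus (φ.comp (RingHom.fst R Q)) (π.comp (RingHom.snd R Q))
  have hP : ∀ x : P, φ (x : R × Q).1 = π (x : R × Q).2 := fun x => x.2
  let f₁ : P →+* R := (RingHom.fst R Q).comp P.subtype
  let f₂ : P →+* Q := (RingHom.snd R Q).comp P.subtype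
  have hf₁ : Function.Surjective f₁ := fun a => by
    obtain ⟨b, hb⟩ := hπ (φ a)
    exact ⟨⟨(a, b), hb.symm⟩, rfl⟩
  let I : ℕ → Ideal P := fun n =>
    (maximalIdeal R ^ (n + 1)).comap f₁ ⊓ (maximalIdeal Q ^ (n + 1)).comap f₂
  have hmem : ∀ n x, x ∈ I n ↔ f₁ x ∈ maximalIdeal R ^ (n + 1) ∧ f₂ x ∈ maximalIdeal Q ^ (n + 1) :=
    fun n x => Iff.rfl
  have hker : RingHom.ker ((residue R).comp f₁) = I 0 := by
    ext x
    rw [RingHom.mem_ker, RingHom.comp_apply, residue_eq_zero_iff, hmem, zero_add, pow_one, pow_one]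
    refine ⟨fun h => ⟨h, ?_⟩, fun h => h.1⟩
    rw [← maximalIdeal_comap π, Ideal.mem_comap]
    have : π (f₂ x) = φ (f₁ x) := (hP x).symm
    rw [this]
    exact (map_mem_nonunits_iff φ _).mpr h
  let e := (Ideal.quotEquivOfEq hker.symm).trans (RingHom.quotientKerEquivOfSurjective
    (f := (residue R).comp f₁) (residue_surjective.comp hf₁))
  obtain ⟨ψ, hψ⟩ := hΛ.exists_lift (P := P) (fun h => Subtype.ext (Prod.ext (h0 h).1 (h0 h).2)) I
    (fun n x hx => ⟨Ideal.pow_le_pow_right (Nat.le_succ _) hx.1,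
      Ideal.pow_le_pow_right (Nat.le_succ _) hx.2⟩)
    (fun n => Ideal.mul_le.mpr fun x hx y hy => by
      rw [hmem] at hx hy ⊢
      rw [map_mul, map_mul]
      constructor
      · have := Ideal.mul_mem_mul hx.1 hy.1
        rw [← pow_add] at this
        exact Ideal.pow_le_pow_right (by omega) this
      · have := Ideal.mul_mem_mul hx.2 hy.2
        rw [← pow_add] at this
        exact Ideal.pow_le_pow_right (by omega) this)
    (fun n x hx => by
      rw [hmem] at hx ⊢
      rw [map_mul, map_mul, map_natCast, map_natCast, pow_succ', pow_succ' _ (n + 1)]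
      exact ⟨Ideal.mul_mem_mul hpR hx.1, Ideal.mul_mem_mul hpQ hx.2⟩)
    (fun y hy => by
      obtain ⟨z₁, h₁⟩ := IsAdicComplete.exists_limit (maximalIdeal R) (fun n => f₁ (y n))
        (fun n => by rw [← map_sub]; exact ((hmem _ _).mp (hy n)).1)
      obtain ⟨z₂, h₂⟩ := IsAdicComplete.exists_limit (maximalIdeal Q) (fun n => f₂ (y n))
        (fun n => by rw [← map_sub]; exact ((hmem _ _).mp (hy n)).2)
      have hz : φ z₁ = π z₂ := by
        rw [← sub_eq_zero]
        refine IsLocalRing.eq_zero_of_forall_mem_pow fun n => ?_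
        have h3 := sub_mem (hφm _ _ (h₁ n)) (hπm _ _ (h₂ n))
        have h4 : π (f₂ (y n)) = φ (f₁ (y n)) := (hP (y n)).symm
        rw [map_sub, map_sub, h4, sub_sub_sub_cancel_right] at h3
        exact h3
      exact ⟨⟨(z₁, z₂), hz⟩, fun n => (hmem _ _).mpr ⟨h₁ n, h₂ n⟩⟩)
    (fun x hx => Subtype.ext (Prod.ext
      (IsLocalRing.eq_zero_of_forall_mem_pow fun n => (hx n).1)
      (IsLocalRing.eq_zero_of_forall_mem_pow fun n => (hx n).2)))
    (e.symm.toRingHom.comp r)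
  refine ⟨f₁.comp ψ, f₂.comp ψ, ?_, ?_⟩
  · ext x
    exact hP (ψ x)
  · ext x
    have h1 := congrArg e (RingHom.congr_fun hψ x)
    have h2 : e (e.symm (r x)) = r x := e.apply_symm_apply _
    exact h1.trans h2

end

section

open IsLocalRing

universe u

/-- Coefficient rings for the source and the target of a local homomorphism `R → E` to a ring with
perfect coefficient field. -/
theorem exists_coefficients {p : ℕ} [Fact p.Prime] {K : Type u} [Field K] [CharP K p]
    [PerfectRing K p] {R E : Type u} [CommRing R] [IsDomain R] [IsNoetherianRing R] [IsLocalRing R]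
    [CommRing E] [IsLocalRing E] (hpR : (p : R) ∈ maximalIdeal R) (φ : R →+* E)
    (c : WittVector p K →+* E) :
    ∃ (Λ : Type u) (_ : CommRing Λ) (_ : IsDomain Λ) (_ : IsNoetherianRing Λ) (_ : IsLocalRing Λ)
      (_ : IsIntegrallyClosed Λ) (Λ' : Type u) (_ : CommRing Λ') (_ : IsDomain Λ')
      (_ : IsNoetherianRing Λ') (_ : IsLocalRing Λ') (_ : IsIntegrallyClosed Λ') (l : List Λ)
      (l' : List Λ') (r : Λ →+* ResidueField R) (y : List R) (d : WittVector p K →+* Λ')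
      (c' : Λ' →+* E), IsRegularSystem l ∧ IsRegularSystem l' ∧ SqZeroLift p Λ ∧
      Function.Surjective r ∧ (∀ (B : Type u) [CommRing B] (a : Λ →+* B) (b : Λ' →+* B),
        l.map a = l'.map b) ∧ (∀ a : Λ →+* R, IsParam R (l.map a ++ y)) ∧ c'.comp d = c ∧
      ((p : Λ) = 0 → (p : R) = 0 ∧ (p : Λ') = 0) ∧ ((p : R) ≠ 0 → l' = [(p : Λ')]) := by
  have hp : p.Prime := Fact.out
  have hk : (p : ResidueField R) = 0 := by
    rw [← map_natCast (residue R), residue_eq_zero_iff]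
    exact hpR
  have : CharP (ResidueField R) p := ringChar.of_eq (CharP.ringChar_of_prime_eq_zero hp hk)
  by_cases h0 : (p : R) = 0
  · have hE : (p : E) = 0 := by rw [← map_natCast φ, h0, map_zero]
    have hker : RingHom.ker (WittVector.constantCoeff : WittVector p K →+* K) ≤ RingHom.ker c := by
      rw [RingHom.ker_eq_comap_bot, Untilt.comap_constantCoeff_bot,
        Ideal.span_singleton_le_iff_mem, RingHom.mem_ker, map_natCast, hE]
    let c' := (WittVector.constantCoeff : WittVector p K →+* K).liftOfSurjective
      (Untilt.constantCoeff_surjective p) ⟨c, hker⟩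
    have hc' : ∀ a, c' (WittVector.constantCoeff a) = c a := fun a =>
      RingHom.liftOfRightInverse_comp_apply _ _ _ _ _
    obtain ⟨y, hy⟩ := IsParam.exists_param R
    refine ⟨ResidueField R, inferInstance, inferInstance, inferInstance, inferInstance,
      inferInstance, K, inferInstance, inferInstance, inferInstance, inferInstance, inferInstance,
      [], [], RingHom.id _, y, WittVector.constantCoeff, c', IsRegularSystem.nil _,
      IsRegularSystem.nil K, Field.sqZeroLift p _, fun x => ⟨x, rfl⟩, fun _ _ _ _ => rfl,
      fun _ => hy, ?_, fun _ => ⟨h0, CharP.cast_eq_zero K p⟩, fun h => absurd h0 h⟩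
    exact RingHom.ext hc'
  · obtain ⟨Λ, _, _, _, _, _, hpΛ, hl, hΛ, r, hr⟩ := exists_cohenRing p (ResidueField R)
    obtain ⟨y, hy⟩ := IsParam.exists_cons hpR h0
    refine ⟨Λ, inferInstance, inferInstance, inferInstance, inferInstance,
      inferInstance, WittVector p K, inferInstance, inferInstance, inferInstance, inferInstance,
      inferInstance, [(p : Λ)], [(p : WittVector p K)], r, y, RingHom.id _, c, hl,
      IsRegularSystem.wittVector p K, hΛ, hr, fun _ _ a b => ?_, fun a => ?_, RingHom.comp_id c,
      fun h => absurd h hpΛ, fun _ => rfl⟩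
    · simp
    · simpa using hy

theorem RingHom.eq_of_comp_eq_of_map_eq {Λ Q E : Type*} [CommRing Λ] [CommRing Q] [CommRing E]
    [IsNoetherianRing E] [IsLocalRing E] {c : Λ →+* Q} {x : List Q}
    (hc : ∀ q, ∃ a, q - c a ∈ Ideal.ofList x) {f g : Q →+* E} (h : f.comp c = g.comp c)
    (hx : x.map f = x.map g) (hm : ∀ a ∈ x, f a ∈ maximalIdeal E) : f = g := by
  ext q
  rw [← sub_eq_zero]
  have hxa : ∀ a ∈ x, f a = g a := List.map_inj_left.mp hx
  have key : ∀ n q, f q - g q ∈ maximalIdeal E ^ n := by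
    intro n
    induction n with
    | zero => simp
    | succ n ih =>
      intro q
      obtain ⟨a, ha⟩ := hc q
      have h1 : ∀ b ∈ Ideal.ofList x, f b - g b ∈ maximalIdeal E ^ (n + 1) ∧ g b ∈ maximalIdeal E := by
        intro b hb
        refine Submodule.span_induction ?_ ?_ ?_ ?_ hb
        · intro b hb
          rw [hxa b hb, sub_self, ← hxa b hb]
          exact ⟨zero_mem _, hm b hb⟩
        · simp
        · intro b b' _ _ h h'
          rw [map_add, map_add, add_sub_add_comm]
          exact ⟨add_mem h.1 h'.1, add_mem h.2 h'.2⟩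
        · intro a b _ h
          rw [smul_eq_mul, map_mul, map_mul]
          refine ⟨?_, Ideal.mul_mem_left _ _ h.2⟩
          have h3 := add_mem (Ideal.mul_mem_left _ (f a) h.1)
            (pow_succ (maximalIdeal E) n ▸ Ideal.mul_mem_mul (ih a) h.2)
          convert h3 using 1
          ring
      have h2 := (h1 _ ha).1
      have h3 : f (c a) = g (c a) := RingHom.congr_fun h a
      rwa [map_sub, map_sub, h3, sub_sub_sub_cancel_right] at h2
  exact IsLocalRing.eq_zero_of_forall_mem_pow fun n => key (n + 1) q

theorem IsRegularSystem.surjective_of_mem_map {Q E : Type*} [CommRing Q] [IsNoetherianRing Q]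
    [IsLocalRing Q] [CommRing E] [IsNoetherianRing E] [IsLocalRing E] {x : List Q}
    (hx : IsRegularSystem x) (hdE : ∀ a ∈ maximalIdeal E, DComplete a E) (f : Q →+* E)
    (hm : Ideal.ofList (x.map f) = maximalIdeal E)
    (hres : ∀ e, ∃ q, e - f q ∈ maximalIdeal E) : Function.Surjective f := by
  algebraize [f]
  have hfin : Module.Finite Q E := Module.Finite.of_radical_ofList_eq (x := x)
    (fun a ha => hx.dcomplete a (by
      rw [← hx.span_eq]
      exact Ideal.subset_span (s := {r | r ∈ x}) ha))
    (fun a ha => hdE _ (by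
      rw [← hm]
      exact Ideal.subset_span (s := {r | r ∈ x.map f}) (List.mem_map_of_mem ha)))
    (by
      rw [RingHom.algebraMap_toAlgebra, hm]
      exact (inferInstance : (maximalIdeal E).IsPrime).radical) hres
  have h1 : (⊤ : Submodule Q E) ≤ LinearMap.range (Algebra.linearMap Q E) := by
    refine Submodule.le_of_le_smul_of_le_jacobson_bot (I := maximalIdeal Q) hfin.fg_top
      (IsLocalRing.maximalIdeal_le_jacobson _) fun e _ => ?_
    obtain ⟨q, hq⟩ := hres e
    rw [← sub_add_cancel e (f q)]
    refine add_mem (Submodule.mem_sup_right ?_) (Submodule.mem_sup_left ⟨q, rfl⟩)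
    rw [← hm, ← Ideal.map_ofList, hx.span_eq] at hq
    rw [Ideal.smul_top_eq_map]
    exact hq
  intro e
  obtain ⟨q, hq⟩ := h1 (Submodule.mem_top (x := e))
  exact ⟨q, hq⟩

end

section

open IsLocalRing

universe u

theorem exists_finite_subring {Q Q' R : Type*} {D : Type u} [CommRing Q] [CommRing Q'] [CommRing R]
    [CommRing D] [IsDomain D] [IsNoetherianRing Q'] [IsLocalRing Q']
    (hd : ∀ a ∈ maximalIdeal Q', DComplete a Q') {b : Q' →+* D} (hb : b.IsIntegral)
    {ψ : Q →+* R} (hψ : ψ.Finite) {χ : Q →+* Q'} {k : R →+* D} (hk : k.comp ψ = b.comp χ) :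
    ∃ (E : Type u) (_ : CommRing E) (_ : IsDomain E) (_ : IsNoetherianRing E) (_ : IsLocalRing E)
      (b' : Q' →+* E) (h : R →+* E) (i : E →+* D), b'.Finite ∧ Function.Injective i ∧ i.IsIntegral ∧
      i.comp b' = b ∧ i.comp h = k ∧ (∀ a ∈ maximalIdeal E, DComplete a E) ∧
      ∀ S : Subring D, (∀ q, b q ∈ S) → (∀ r, k r ∈ S) → ∀ e, i e ∈ S := by
  algebraize [ψ, b]
  obtain ⟨s, hs⟩ := (Module.Finite.fg_top : (⊤ : Submodule Q R).FG)
  let E : Subalgebra Q' D := Algebra.adjoin Q' (k '' s)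
  have hbE : ∀ q, b q ∈ E := fun q => E.algebraMap_mem q
  have hkE : ∀ r, k r ∈ E := by
    intro r
    have hr : r ∈ Submodule.span Q (s : Set R) := hs ▸ Submodule.mem_top
    refine Submodule.span_induction ?_ ?_ ?_ ?_ hr
    · exact fun x hx => Algebra.subset_adjoin ⟨x, hx, rfl⟩
    · rw [map_zero]
      exact E.zero_mem
    · intro x y _ _ hx hy
      rw [map_add]
      exact E.add_mem hx hy
    · intro q x _ hx
      rw [Algebra.smul_def, map_mul]
      refine E.mul_mem ?_ hx
      have : k (ψ q) = b (χ q) := RingHom.congr_fun hk q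
      rw [RingHom.algebraMap_toAlgebra, this]
      exact hbE _
  have hfin : Module.Finite Q' E := by
    refine (Module.Finite.iff_fg (N := Subalgebra.toSubmodule E)).mpr ?_
    exact fg_adjoin_of_finite (s.finite_toSet.image k) fun x _ => hb x
  have hloc : IsLocalRing E := IsLocalRing.of_finite_of_dcomplete hd
  refine ⟨E, inferInstance, inferInstance, IsNoetherianRing.of_finite Q' E, hloc,
    algebraMap Q' E, k.codRestrict E hkE, E.val, ?_, Subtype.val_injective, ?_, rfl, rfl,
    DComplete.of_mem_maximalIdeal_of_finite hd, ?_⟩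
  · exact RingHom.finite_algebraMap.mpr hfin
  · intro x
    exact (show IsIntegral Q' x from hb x).tower_top (A := E)
  · rintro S hb hk ⟨e, he⟩
    change e ∈ S
    refine Algebra.adjoin_induction ?_ ?_ ?_ ?_ he
    · rintro _ ⟨x, -, rfl⟩
      exact hk x
    · exact hb
    · exact fun _ _ _ _ => S.add_mem
    · exact fun _ _ _ _ => S.mul_mem

theorem RingHom.exists_comp_eq_of_mem_range {X E D : Type*} [CommRing X] [CommRing E] [CommRing D]
    {i : E →+* D} (hi : Function.Injective i) (f : X →+* D) (h : ∀ x, f x ∈ i.range) :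
    ∃ g : X →+* E, i.comp g = f := by
  let e : E ≃+* i.range := RingEquiv.ofBijective i.rangeRestrict
    ⟨fun a b hab => hi (congrArg Subtype.val hab), i.rangeRestrict_surjective⟩
  refine ⟨(e.symm : i.range →+* E).comp (f.codRestrict i.range h), RingHom.ext fun x => ?_⟩
  exact congrArg Subtype.val (e.apply_symm_apply (f.codRestrict i.range h x))

/-- Parameters of `R` extend to parameters of `E`, when `E` is finite over a regular ring and
receives a map from `R` carrying a regular system of parameters of a Noether normalization of `R`
to part of the regular system of parameters. -/
theorem IsParam.exists_append {Q Q' R E : Type u} [CommRing Q] [CommRing Q'] [CommRing R]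
    [CommRing E] [IsLocalRing Q'] [IsLocalRing R] [IsNoetherianRing E] [IsLocalRing E]
    {x : List Q} {x' z' : List Q'} (hx : IsRegularSystem (x' ++ z')) {ψ : Q →+* R} {χ : Q →+* Q'}
    (hχ : x.map χ = x') (hψ : IsParam R (x.map ψ)) {b : Q' →+* E} (hb : b.Finite)
    (hbi : Function.Injective b) {h : R →+* E} (hh : h.comp ψ = b.comp χ)
    (hhm : ∀ a ∈ maximalIdeal R, h a ∈ maximalIdeal E) {u : List R} (hu : IsParam R u) :
    IsParam E (u.map h ++ z'.map b) := by
  have hbint : b.IsIntegral := hb.to_isIntegral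
  have hbl : IsLocalHom b := hbint.isLocalHom hbi
  have hrad : (Ideal.ofList (u.map h ++ z'.map b)).radical = maximalIdeal E := by
    refine le_antisymm ?_ ?_
    · refine (Ideal.radical_le_radical_iff.mpr ?_).trans
        (inferInstance : (maximalIdeal E).IsPrime).radical.le
      rw [(inferInstance : (maximalIdeal E).IsPrime).radical]
      refine Ideal.span_le.mpr fun a ha => ?_
      rcases List.mem_append.mp ha with ha | ha
      · obtain ⟨w, hw, rfl⟩ := List.mem_map.mp ha
        exact hhm w (hu.mem hw)
      · obtain ⟨w, hw, rfl⟩ := List.mem_map.mp ha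
        refine (map_mem_nonunits_iff b w).mpr ?_
        change w ∈ maximalIdeal Q'
        rw [← hx.span_eq]
        exact Ideal.subset_span (s := {r | r ∈ x' ++ z'}) (List.mem_append_right _ hw)
    · rw [Ideal.radical_eq_sInf]
      refine le_sInf fun P hP => ?_
      have hPp : P.IsPrime := hP.2
      have h1 : maximalIdeal Q' ≤ P.comap b := by
        rw [← hx.span_eq]
        refine Ideal.span_le.mpr fun a ha => ?_
        change b a ∈ P
        rcases List.mem_append.mp ha with ha | ha
        · rw [← hχ] at ha
          obtain ⟨q, hq, rfl⟩ := List.mem_map.mp ha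
          have h2 : h (ψ q) = b (χ q) := RingHom.congr_fun hh q
          rw [← h2]
          have h3 : ψ q ∈ (Ideal.ofList u).radical := by
            rw [hu.radical_eq]
            exact hψ.mem (List.mem_map_of_mem hq)
          obtain ⟨n, hn⟩ := h3
          refine hPp.mem_of_pow_mem n ?_
          rw [← map_pow]
          have h4 := Ideal.mem_map_of_mem h hn
          rw [Ideal.map_ofList] at h4
          exact hP.1 (Ideal.span_mono (fun a ha => List.mem_append_left _ ha) h4)
        · exact hP.1 (Ideal.subset_span (s := {r | r ∈ u.map h ++ z'.map b})
            (List.mem_append_right _ (List.mem_map_of_mem ha)))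
      have h2 : P.comap b = maximalIdeal Q' :=
        ((maximalIdeal.isMaximal Q').eq_of_le (Ideal.comap_ne_top b hPp.ne_top) h1).symm
      algebraize [b]
      have h3 : P.IsMaximal := Ideal.isMaximal_of_isIntegral_of_isMaximal_comap (R := Q') P
        (by rw [RingHom.algebraMap_toAlgebra, h2]; exact maximalIdeal.isMaximal Q')
      exact (IsLocalRing.eq_maximalIdeal h3).ge
  refine ⟨le_antisymm ?_ (ringKrullDim_le_length hrad), hrad⟩
  have h1 : ((x' ++ z').length : WithBot ℕ∞) ≤ ringKrullDim Q' :=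
    RegMod.length_le_ringKrullDim (RingHom.id Q') _ (by simpa using hx.regMod) (by
      have h0 : (x' ++ z').map (RingHom.id Q') = x' ++ z' := by simp
      rw [h0, hx.span_eq]
      exact fun h => (Ideal.ne_top_iff_one _).mp (maximalIdeal.isMaximal Q').ne_top h)
  have h2 : ringKrullDim Q' ≤ ringKrullDim E := by
    algebraize [b]
    exact ringKrullDim_le_of_isIntegral hbi
  have h3 : u.length = x.length := by
    have := hu.length_eq.trans hψ.length_eq.symm
    rw [List.length_map] at this
    exact_mod_cast this
  refine le_trans (le_of_eq ?_) (h1.trans h2)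
  rw [← hχ]
  simp [h3]

end

section

open IsLocalRing

universe u

/-- `E → D` is an absolute integral closure up to isomorphism of the complete local ring `E`,
whose residue field is covered by the perfect field `K`. -/
structure IsCover {p : ℕ} [Fact p.Prime] {K : Type*} [Field K] [CharP K p] {E D : Type*}
    [CommRing E] [IsLocalRing E] [CommRing D] (c : WittVector p K →+* E) (i : E →+* D) : Prop where
  injective : Function.Injective i
  isIntegral : i.IsIntegral
  monicRoot : MonicRoot D
  dcomplete : ∀ a ∈ maximalIdeal E, DComplete a E
  residue : ∀ e, ∃ w, e - c w ∈ maximalIdeal E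

theorem IsCover.exists_step {p : ℕ} [Fact p.Prime] {K : Type u} [Field K] [CharP K p]
    [PerfectRing K p] {E' D' R A : Type u} [CommRing E'] [IsNoetherianRing E']
    [IsLocalRing E'] [CommRing D'] [IsDomain D'] {c' : WittVector p K →+* E'} {i' : E' →+* D'}
    (hc' : IsCover c' i') [CommRing R] [IsDomain R] [IsNoetherianRing R] [IsLocalRing R]
    (hdR : ∀ a ∈ maximalIdeal R, DComplete a R) (hpR : (p : R) ∈ maximalIdeal R) [CommRing A]
    [IsDomain A] {j : R →+* A} (hj : Function.Injective j) (hjint : j.IsIntegral)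
    (hA : MonicRoot A) (φ : R →+* E') [IsLocalHom φ] {φp : A →+* D'}
    (hφ : φp.comp j = i'.comp φ) :
    ∃ (E : Type u) (_ : CommRing E) (_ : IsDomain E) (_ : IsNoetherianRing E) (_ : IsLocalRing E)
      (D : Type u) (_ : CommRing D) (_ : IsDomain D) (c : WittVector p K →+* E) (i : E →+* D)
      (g : E →+* E') (π : D →+* D') (h : R →+* E) (hp : A →+* D), IsCover c i ∧
      Function.Surjective g ∧ Function.Surjective π ∧ π.comp i = i'.comp g ∧
      i.comp h = hp.comp j ∧ g.comp h = φ ∧ π.comp hp = φp ∧ ((p : R) ≠ 0 → (p : E) ≠ 0) ∧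
      ∀ u, IsParam R u → ∃ z, IsParam E (u.map h ++ z) := by
  obtain ⟨Λ, _, _, _, _, _, Λ', _, _, _, _, _, l, l', r, y, d, c'', hl, hl', hΛ, hr, hll, hpar, hd,
    hp0, hp1⟩ := exists_coefficients hpR φ c'
  have hφm : ∀ a ∈ maximalIdeal R, φ a ∈ maximalIdeal E' := fun a ha =>
    (map_mem_nonunits_iff φ a).mpr ha
  obtain ⟨a₀, -, -, -⟩ := hΛ.exists_lift_pair (fun h => ⟨(hp0 h).1, (hp0 h).1⟩) hdR hdR hpR hpR
    (RingHom.id R) (π := RingHom.id R) Function.surjective_id r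
  have hy : ∀ a ∈ y, a ∈ maximalIdeal R := fun a ha =>
    (hpar a₀).mem (List.mem_append_right _ ha)
  obtain ⟨zE, hzE⟩ := Ideal.exists_ofList_eq (maximalIdeal E')
  have hs : ∀ a ∈ y.map φ ++ zE, a ∈ maximalIdeal E' := by
    intro a ha
    rcases List.mem_append.mp ha with ha | ha
    · obtain ⟨w, hw, rfl⟩ := List.mem_map.mp ha
      exact hφm _ (hy _ hw)
    · rw [← hzE]
      exact Ideal.subset_span (s := {r | r ∈ zE}) ha
  obtain ⟨Q', _, _, _, _, _, cΛ', xs, hxs, hreg', -, hlift'⟩ :=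
    hl'.exists_powerSeries (y.length + zE.length)
  obtain ⟨ψ', hψ'c, hψ'x⟩ := hlift' E' c'' (y.map φ ++ zE) (by simp)
    fun a ha => hc'.dcomplete a (hs a ha)
  obtain ⟨y', z', rfl, hy'len⟩ : ∃ y' z', xs = y' ++ z' ∧ y'.length = y.length :=
    ⟨xs.take y.length, xs.drop y.length, (List.take_append_drop _ _).symm, by simp [hxs]⟩
  rw [List.map_append] at hψ'x
  obtain ⟨hψ'y, -⟩ := List.append_inj hψ'x (by simp [hy'len])
  have hψ'surj : Function.Surjective ψ' := by
    refine hreg'.surjective_of_mem_map hc'.dcomplete ψ' (le_antisymm ?_ ?_) fun e => ?_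
    · refine Ideal.span_le.mpr fun a ha => ?_
      rw [List.map_append, List.map_append, hψ'x, List.map_map] at ha
      rcases List.mem_append.mp ha with ha | ha
      · have h1 : l'.map (ψ' ∘ cΛ') = l.map (φ.comp a₀) := (hll E' (φ.comp a₀) (ψ'.comp cΛ')).symm
        rw [h1] at ha
        obtain ⟨w, hw, rfl⟩ := List.mem_map.mp ha
        exact hφm _ ((hpar a₀).mem (List.mem_append_left _ (List.mem_map_of_mem hw)))
      · exact hs a ha
    · rw [← hzE, List.map_append, List.map_append, hψ'x]
      exact Ideal.span_mono fun a ha => List.mem_append_right _ (List.mem_append_right _ ha)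
    · obtain ⟨w, hw⟩ := hc'.residue e
      refine ⟨cΛ' (d w), ?_⟩
      have h1 : ψ' (cΛ' (d w)) = c' w := by
        rw [← hd, ← hψ'c]
        rfl
      rwa [h1]
  have hψ'loc : IsLocalHom ψ' := hψ'surj.isLocalHom
  have hpQ' : (p : Q') ∈ maximalIdeal Q' := by
    refine (map_mem_nonunits_iff ψ' _).mp ?_
    rw [map_natCast, ← map_natCast φ]
    exact hφm _ hpR
  obtain ⟨a, b, hab, har⟩ := hΛ.exists_lift_pair
    (fun h => ⟨(hp0 h).1, by rw [← map_natCast cΛ', (hp0 h).2, map_zero]⟩) hdR hreg'.dcomplete hpR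
    hpQ' φ hψ'surj r
  obtain ⟨Q, _, _, _, _, _, cΛ, xQ, hxQ, hreg, hapx, hlift⟩ := hl.exists_powerSeries y.length
  obtain ⟨ψ, hψc, hψx⟩ := hlift R a y rfl fun w hw => hdR w (hy w hw)
  have hψpar : IsParam R ((l.map cΛ ++ xQ).map ψ) := by
    rw [List.map_append, hψx, List.map_map]
    have h1 : l.map (ψ ∘ cΛ) = l.map a := by rw [← hψc]; rfl
    rw [h1]
    exact hpar a
  obtain ⟨hψfin, hψinj⟩ := hreg.finite_injective hdR ψ hψpar fun e => by
    obtain ⟨w, hw⟩ := hr (IsLocalRing.residue R e)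
    refine ⟨cΛ w, ?_⟩
    rw [← residue_eq_zero_iff, map_sub, sub_eq_zero, ← hw, ← har, ← hψc]
    rfl
  have hy'mem : ∀ w ∈ y', w ∈ maximalIdeal Q' := by
    intro w hw
    rw [← hreg'.span_eq]
    exact Ideal.subset_span (s := {r | r ∈ l'.map cΛ' ++ (y' ++ z')})
      (List.mem_append_right _ (List.mem_append_left _ hw))
  obtain ⟨χ, hχc, hχx⟩ := hlift Q' b y' hy'len fun w hw => hreg'.dcomplete w (hy'mem w hw)
  have hχψ : ψ'.comp χ = φ.comp ψ := by
    refine RingHom.eq_of_comp_eq_of_map_eq hapx ?_ ?_ fun w hw => ?_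
    · rw [RingHom.comp_assoc, hχc, RingHom.comp_assoc, hψc, hab]
    · have h1 : xQ.map (ψ'.comp χ) = (xQ.map χ).map ψ' := by rw [List.map_map]; rfl
      have h2 : xQ.map (φ.comp ψ) = (xQ.map ψ).map φ := by rw [List.map_map]; rfl
      rw [h1, h2, hχx, hψx, hψ'y]
    · refine (map_mem_nonunits_iff ψ' _).mpr (hy'mem _ ?_)
      rw [← hχx]
      exact List.mem_map_of_mem hw
  obtain ⟨D, _, _, bD, hbD, hbDint, hD⟩ := MonicRoot.exists_isIntegral Q'
  obtain ⟨π, hπ⟩ := hc'.monicRoot.exists_extension hbDint (b := i'.comp ψ')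
    (by rw [(RingHom.injective_iff_ker_eq_bot bD).mp hbD]; exact bot_le)
  have hπsurj : Function.Surjective π := by
    intro z
    have h1 : (π.comp bD).IsIntegral := by
      rw [hπ]
      exact (RingHom.isIntegral_of_surjective ψ' hψ'surj).trans _ _ hc'.isIntegral
    exact hD.exists_eq_of_isIntegral π (h1.tower_top _ _ z)
  have hjψ : Function.Injective (j.comp ψ) := hj.comp hψinj
  have hjψint : (j.comp ψ).IsIntegral := hψfin.to_isIntegral.trans _ _ hjint
  obtain ⟨θ, hθ⟩ := hD.exists_extension hjψint (b := bD.comp χ)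
    (by rw [(RingHom.injective_iff_ker_eq_bot _).mp hjψ]; exact bot_le)
  obtain ⟨σ, hσ, hσφ⟩ : ∃ σ : A →+* A, σ.comp (j.comp ψ) = j.comp ψ ∧ (π.comp θ).comp σ = φp := by
    let _ := (j.comp ψ).toAlgebra
    have : Algebra.IsIntegral Q A := algebraMap_isIntegral_iff.1 hjψint
    refine hA.exists_comp_eq hjψ ?_
    change (π.comp θ).comp (j.comp ψ) = φp.comp (j.comp ψ)
    rw [RingHom.comp_assoc, hθ, ← RingHom.comp_assoc, hπ, RingHom.comp_assoc, hχψ,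
      ← RingHom.comp_assoc, ← RingHom.comp_assoc, hφ]
  have hk : ((θ.comp σ).comp j).comp ψ = bD.comp χ := by
    rw [RingHom.comp_assoc, RingHom.comp_assoc, hσ, hθ]
  obtain ⟨E, _, _, _, _, b', h, i, hb', hi, hiint, hib, hih, hdE, hsub⟩ :=
    exists_finite_subring hreg'.dcomplete hbDint hψfin hk
  have hπk : π.comp ((θ.comp σ).comp j) = i'.comp φ := by
    rw [← hφ, ← hσφ]
    rfl
  obtain ⟨g, hg⟩ := RingHom.exists_comp_eq_of_mem_range hc'.injective (π.comp i)
    (hsub (i'.range.comap π)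
      (fun q => ⟨ψ' q, (RingHom.congr_fun hπ q).symm⟩)
      (fun x => ⟨φ x, (RingHom.congr_fun hπk x).symm⟩))
  have hgb : g.comp b' = ψ' := RingHom.ext fun q => hc'.injective <| by
    have h1 : i' (g (b' q)) = π (i (b' q)) := RingHom.congr_fun hg _
    have h2 : i (b' q) = bD q := RingHom.congr_fun hib q
    have h3 : π (bD q) = i' (ψ' q) := RingHom.congr_fun hπ q
    exact h1.trans ((congrArg π h2).trans h3)
  have hgh : g.comp h = φ := RingHom.ext fun q => hc'.injective <| by
    have h1 : i' (g (h q)) = π (i (h q)) := RingHom.congr_fun hg _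
    have h2 : i (h q) = ((θ.comp σ).comp j) q := RingHom.congr_fun hih q
    exact h1.trans ((congrArg π h2).trans (RingHom.congr_fun hπk q))
  have hgsurj : Function.Surjective g := by
    intro e
    obtain ⟨q, rfl⟩ := hψ'surj e
    exact ⟨b' q, RingHom.congr_fun hgb q⟩
  have hgloc : IsLocalHom g := hgsurj.isLocalHom
  have hbinj : Function.Injective b' := by
    have : Function.Injective (i.comp b') := by rwa [hib]
    exact Function.Injective.of_comp (f := i) (g := b') this
  refine ⟨E, inferInstance, inferInstance, inferInstance, inferInstance, D, inferInstance,
    inferInstance, (b'.comp cΛ').comp d, i, g, π, h, θ.comp σ,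
    ⟨hi, hiint, hD, hdE, fun e => ?_⟩, hgsurj, hπsurj, hg.symm, hih, hgh,
    by rw [← RingHom.comp_assoc, hσφ], fun hp => ?_, fun u hu => ?_⟩
  · obtain ⟨w, hw⟩ := hc'.residue (g e)
    refine ⟨w, (map_mem_nonunits_iff g _).mp ?_⟩
    have h1 : g (b' (cΛ' (d w))) = c' w := by
      have h2 : g (b' (cΛ' (d w))) = ψ' (cΛ' (d w)) := RingHom.congr_fun hgb _
      rw [h2, ← hd, ← hψ'c]
      rfl
    rw [map_sub]
    change g e - g (b' (cΛ' (d w))) ∈ _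
    rwa [h1]
  · have h1 := hreg'.regMod
    rw [hp1 hp] at h1
    intro h2
    have h3 : (p : Q') = 0 := hbinj (by rw [map_natCast, h2, map_zero])
    have h4 := h1.1 1 (by rw [map_natCast, h3, zero_mul]; exact zero_mem _)
    exact one_ne_zero (Ideal.mem_bot.mp h4)
  · refine ⟨z'.map b', ?_⟩
    refine IsParam.exists_append (x' := l'.map cΛ' ++ y') (x := l.map cΛ ++ xQ)
      (by rwa [List.append_assoc]) (χ := χ) ?_ hψpar hb' hbinj ?_ (fun w hw => ?_) hu
    · rw [List.map_append, hχx, List.map_map]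
      congr 1
      have h1 : l.map (χ ∘ cΛ) = l.map b := by rw [← hχc]; rfl
      rw [h1]
      exact hll Q' b cΛ'
    · refine RingHom.ext fun q => hi ?_
      have h1 : i (h (ψ q)) = ((θ.comp σ).comp j) (ψ q) := RingHom.congr_fun hih _
      have h2 : i (b' (χ q)) = bD (χ q) := RingHom.congr_fun hib _
      exact h1.trans ((RingHom.congr_fun hk q).trans h2.symm)
    · refine (map_mem_nonunits_iff g _).mp ?_
      have h1 : g (h w) = φ w := RingHom.congr_fun hgh w
      rw [h1]
      exact hφm w hw

end

section

open IsLocalRing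

universe u

theorem CMHom.comp_of_append {R E C : Type*} [CommRing R] [IsLocalRing R] [CommRing E]
    [IsLocalRing E] [CommRing C] {ρ : E →+* C} (hρ : CMHom ρ) {h : R →+* E}
    (H : ∀ u, IsParam R u → ∃ z, IsParam E (u.map h ++ z)) : CMHom (ρ.comp h) := by
  intro u hu
  obtain ⟨z, hz⟩ := H u hu
  obtain ⟨h1, h2⟩ := hρ _ hz
  have h3 : (u.map h ++ z).map ρ = u.map (ρ.comp h) ++ z.map ρ := by
    rw [List.map_append, List.map_map]
    rfl
  rw [h3] at h1 h2
  exact ⟨(RegMod.append.mp h1).1, fun h => h2 (Ideal.span_mono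
    (fun a ha => List.mem_append_left _ ha) h)⟩

theorem CMHom.exists_perfect {p : ℕ} [Fact p.Prime] {R B C : Type u} [CommRing R] [IsDomain R]
    [IsNoetherianRing R] [IsLocalRing R] [CommRing B] [CommRing C] {ρ : R →+* B} (hρ : CMHom ρ)
    (κ : B →+* C) (hC : (p : R) = 0 → Function.Bijective fun c : C => c ^ p) :
    ∃ (B' : Type u) (_ : CommRing B') (α : B →+* B') (κ' : B' →+* C), κ'.comp α = κ ∧
      CMHom (α.comp ρ) ∧ ((p : R) = 0 → Function.Bijective fun c : B' => c ^ p) := by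
  by_cases hp : (p : R) = 0
  · have hB : Nontrivial B := by
      obtain ⟨u, hu⟩ := IsParam.exists_param R
      by_contra h
      rw [not_nontrivial_iff_subsingleton] at h
      exact (hρ u hu).2 (by rw [Subsingleton.elim (1 : B) 0]; exact zero_mem _)
    have : CharP B p := by
      rw [CharP.charP_iff_prime_eq_zero (Fact.out : p.Prime), ← map_natCast ρ, hp, map_zero]
    let i : B →+* PerfectClosure B p := PerfectClosure.of B p
    have : IsPRadical i p := PerfectClosure.isPRadical B p
    obtain ⟨κ', hκ'⟩ : ∃ κ' : PerfectClosure B p →+* C, κ'.comp i = κ := by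
      cases subsingleton_or_nontrivial C
      · exact ⟨⟨⟨⟨fun _ => 0, Subsingleton.elim _ _⟩, fun _ _ => Subsingleton.elim _ _⟩,
          Subsingleton.elim _ _, fun _ _ => Subsingleton.elim _ _⟩,
          RingHom.ext fun _ => Subsingleton.elim _ _⟩
      · have : CharP C p := by
          rw [CharP.charP_iff_prime_eq_zero (Fact.out : p.Prime), ← map_natCast (κ.comp ρ), hp,
            map_zero]
        have : PerfectRing C p := ⟨hC hp⟩
        exact ⟨PerfectClosure.lift B p C κ, (PerfectClosure.lift B p C).symm_apply_apply κ⟩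
    refine ⟨PerfectClosure B p, inferInstance, i, κ', hκ', fun u hu => ?_, fun _ => ?_⟩
    · obtain ⟨h1, h2⟩ := hρ u hu
      have h3 : u.map (i.comp ρ) = (u.map ρ).map i := by rw [List.map_map]; rfl
      rw [h3]
      refine ⟨?_, fun h => h2 (PerfectedRegular.one_mem p i h)⟩
      have h4 := PerfectedRegular.regMod p i (l₀ := []) h1
      simpa [Ideal.ofList] using h4
    · exact PerfectRing.bijective_frobenius
  · exact ⟨B, inferInstance, RingHom.id B, κ, rfl, hρ, fun h => absurd h hp⟩

/-- A chain of local homomorphisms is dominated at its source by a local ring `E` with residue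
field covered by `K`, such that every Cohen-Macaulay algebra over `E` yields a ladder. -/
theorem exists_cover_ladder {p : ℕ} [Fact p.Prime] {K : Type u} [Field K] [CharP K p]
    [PerfectRing K p] (hK : MonicRoot K) (n : ℕ) : ∀ (R : Fin (n + 1) → Type u)
    [∀ i, CommRing (R i)] [∀ i, IsDomain (R i)] [∀ i, IsNoetherianRing (R i)]
    [∀ i, IsLocalRing (R i)] (_ : ∀ i, ∀ a ∈ maximalIdeal (R i), DComplete a (R i))
    (_ : ∀ i, (p : R i) ∈ maximalIdeal (R i)) (A : Fin (n + 1) → Type u) [∀ i, CommRing (A i)]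
    [∀ i, IsDomain (A i)] (j : ∀ i, R i →+* A i) (_ : ∀ i, Function.Injective (j i))
    (_ : ∀ i, (j i).IsIntegral) (_ : ∀ i, MonicRoot (A i))
    (f : ∀ i : Fin n, R i.castSucc →+* R i.succ) (_ : ∀ i, IsLocalHom (f i))
    (fp : ∀ i : Fin n, A i.castSucc →+* A i.succ)
    (_ : ∀ i, (fp i).comp (j i.castSucc) = (j i.succ).comp (f i))
    (φ : R (Fin.last n) →+* K) [IsLocalHom φ],
    ∃ (E : Type u) (_ : CommRing E) (_ : IsDomain E) (_ : IsNoetherianRing E) (_ : IsLocalRing E)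
      (D : Type u) (_ : CommRing D) (_ : IsDomain D) (c : WittVector p K →+* E) (i : E →+* D)
      (h : R 0 →+* E) (hp : A 0 →+* D), IsCover c i ∧ IsLocalHom h ∧ i.comp h = hp.comp (j 0) ∧
      ((p : R 0) ≠ 0 → (p : E) ≠ 0) ∧
      ∀ (B : Type u) [CommRing B] (k : D →+* B), CMHom (k.comp i) →
        (∀ a ∈ maximalIdeal E, DComplete (k (i a)) B) →
        ∃ (C : Fin (n + 1) → Type u) (_ : ∀ i, CommRing (C i)) (ι : ∀ i, A i →+* C i)
          (g : ∀ i : Fin n, C i.castSucc →+* C i.succ) (κ : B →+* C 0),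
          (∀ i, CMHom ((ι i).comp (j i))) ∧
          (∀ i, (g i).comp (ι i.castSucc) = (ι i.succ).comp (fp i)) ∧
          (∀ i, (p : R i) = 0 → Function.Bijective fun c : C i => c ^ p) ∧
          κ.comp (k.comp hp) = ι 0 := by
  induction n with
  | zero =>
    intro R _ _ _ _ hdR hpR A _ _ j hj hjint hA f hf fp hfp φ _
    have hcov : IsCover (WittVector.constantCoeff : WittVector p K →+* K) (RingHom.id K) :=
      ⟨Function.injective_id, RingHom.isIntegral_of_surjective _ Function.surjective_id, hK,
        fun a ha => by
          have : a = 0 := by simpa [IsLocalRing.maximalIdeal_eq_bot] using ha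
          rw [this]
          exact DComplete.zero, fun e => by
          obtain ⟨w, hw⟩ := Untilt.constantCoeff_surjective p e
          exact ⟨w, by rw [hw, sub_self]; exact zero_mem _⟩⟩
    obtain ⟨φp, hφp⟩ := hK.exists_extension (hjint 0) (b := (φ : R 0 →+* K))
      (by rw [(RingHom.injective_iff_ker_eq_bot _).mp (hj 0)]; exact bot_le)
    obtain ⟨E, _, _, _, _, D, _, _, c, i, g, π, h, hp, hc, -, -, -, hih, hgh, -, hpE, hpar⟩ :=
      hcov.exists_step (hdR 0) (hpR 0) (hj 0) (hjint 0) (hA 0) (φ : R 0 →+* K) (φp := φp) hφp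
    have hgl : IsLocalHom (g.comp h) := by rw [hgh]; infer_instance
    refine ⟨E, inferInstance, inferInstance, inferInstance, inferInstance, D, inferInstance,
      inferInstance, c, i, h, hp, hc, _root_.isLocalHom_of_comp h g, hih, hpE,
      fun B _ k hk _ => ?_⟩
    obtain ⟨B', _, α, -, -, hα, hB'⟩ := (hk.comp_of_append hpar).exists_perfect (p := p)
      (C := PUnit.{u + 1}) ⟨⟨⟨fun _ => ⟨⟩, rfl⟩, fun _ _ => rfl⟩, rfl, fun _ _ => rfl⟩
      fun _ => ⟨fun _ _ _ => rfl, fun _ => ⟨⟨⟩, rfl⟩⟩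
    refine ⟨fun _ => B', fun _ => inferInstance,
      Fin.cases ((α.comp k).comp hp) fun i => i.elim0, fun i => i.elim0, α,
      Fin.cases ?_ fun i => i.elim0, fun i => i.elim0, Fin.cases hB' fun i => i.elim0, rfl⟩
    change CMHom (((α.comp k).comp hp).comp (j 0))
    rw [RingHom.comp_assoc, ← hih]
    exact hα
  | succ n ih =>
    intro R _ _ _ _ hdR hpR A _ _ j hj hjint hA f hf fp hfp φ _
    obtain ⟨E', _, _, _, _, D', _, _, c', i', h', hp', hc', hh', hih', -, hlad⟩ :=
      ih (fun i => R i.succ) (fun i => hdR i.succ) (fun i => hpR i.succ) (fun i => A i.succ)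
        (fun i => j i.succ) (fun i => hj i.succ) (fun i => hjint i.succ) (fun i => hA i.succ)
        (fun i => f i.succ) (fun i => hf i.succ) (fun i => fp i.succ) (fun i => hfp i.succ) φ
    let f₀ : R 0 →+* R (Fin.succ 0) := f 0
    let fp₀ : A 0 →+* A (Fin.succ 0) := fp 0
    have hf₀ : IsLocalHom f₀ := hf 0
    have hfp₀ : fp₀.comp (j 0) = (j (Fin.succ 0)).comp f₀ := hfp 0
    obtain ⟨E, _, _, _, _, D, _, _, c, i, g, π, h, hp, hc, hg, hπ, hπi, hih, hgh, hπh, hpE,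
      hpar⟩ := hc'.exists_step (hdR 0) (hpR 0) (hj 0) (hjint 0) (hA 0) (h'.comp f₀)
        (φp := hp'.comp fp₀) (by
          rw [RingHom.comp_assoc, hfp₀, ← RingHom.comp_assoc, ← hih', RingHom.comp_assoc])
    have hgl : IsLocalHom (g.comp h) := by rw [hgh]; infer_instance
    refine ⟨E, inferInstance, inferInstance, inferInstance, inferInstance, D, inferInstance,
      inferInstance, c, i, h, hp, hc, _root_.isLocalHom_of_comp h g, hih, hpE,
      fun B _ k hk hdB => ?_⟩
    obtain ⟨u, hu⟩ := IsParam.exists_param E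
    obtain ⟨B₁, _, θ, k', hk', hkc', hdB₁⟩ := CMHom.exists_descend hc'.injective u.length c
      hc.residue hc.dcomplete hc.injective hc.isIntegral hc.monicRoot hk hdB hg hπ hπi hu rfl
    obtain ⟨C', _, ι', g', κ, hι', hg', hC', hκ⟩ := hlad B₁ k' hkc' hdB₁
    obtain ⟨B', _, α, κ', hκ', hα, hB'⟩ := (hk.comp_of_append hpar).exists_perfect (p := p)
      (κ.comp θ) fun h0 => hC' 0 (by
        rw [← map_natCast f₀, h0, map_zero])
    let C : Fin (n + 2) → Type u := Fin.cases B' C'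
    let _ : ∀ i, CommRing (C i) := Fin.cases ‹CommRing B'› ‹∀ i, CommRing (C' i)›
    refine ⟨C, inferInstance, Fin.cases ((α.comp k).comp hp) ι', Fin.cases κ' g', α,
      Fin.cases ?_ hι', Fin.cases ?_ hg', Fin.cases hB' hC', rfl⟩
    · change CMHom (((α.comp k).comp hp).comp (j 0))
      rw [RingHom.comp_assoc, ← hih]
      exact hα
    · change κ'.comp ((α.comp k).comp hp) = (ι' 0).comp fp₀
      rw [← hκ, ← RingHom.comp_assoc, ← RingHom.comp_assoc, hκ', RingHom.comp_assoc,
        RingHom.comp_assoc, RingHom.comp_assoc, RingHom.comp_assoc, ← hπh,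
        ← RingHom.comp_assoc _ π k', hk', RingHom.comp_assoc]

end

/-- **Theorem 4.4**: a finite sequence of local homomorphisms of complete noetherian local
domains, with `R 0` of mixed characteristic `(0,p)`, together with given liftings
`fplus i` to absolute integral closures, fits into a commutative ladder with big
Cohen-Macaulay algebras `C i` (each an `Rplus i`-algebra); moreover each `C i` may be
taken perfect whenever `R i` has characteristic `p`. -/
theorem weak_functoriality_ladder
    (p : ℕ) (hp : p.Prime) (n : ℕ)
    (R : Fin (n + 1) → Type) [∀ i, CommRing (R i)] [∀ i, IsDomain (R i)]
    [∀ i, IsNoetherianRing (R i)] [∀ i, IsLocalRing (R i)]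
    [∀ i, IsAdicComplete (IsLocalRing.maximalIdeal (R i)) (R i)]
    [CharZero (R 0)] [CharP (IsLocalRing.ResidueField (R 0)) p]
    (Rplus : Fin (n + 1) → Type) [∀ i, CommRing (Rplus i)] [∀ i, Algebra (R i) (Rplus i)]
    (hRplus : ∀ i, IsAbsIntClosure (R i) (Rplus i))
    (f : ∀ i : Fin n, R i.castSucc →+* R i.succ)
    (hloc : ∀ (i : Fin n), ∀ a ∈ IsLocalRing.maximalIdeal (R i.castSucc),
      f i a ∈ IsLocalRing.maximalIdeal (R i.succ))
    (fplus : ∀ i : Fin n, Rplus i.castSucc →+* Rplus i.succ)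
    (hfplus : ∀ (i : Fin n) (r : R i.castSucc),
      fplus i (algebraMap (R i.castSucc) (Rplus i.castSucc) r) =
        algebraMap (R i.succ) (Rplus i.succ) (f i r)) :
    ∃ (C : Fin (n + 1) → Type) (_ : ∀ i, CommRing (C i))
      (ι : ∀ i, Rplus i →+* C i) (g : ∀ i : Fin n, C i.castSucc →+* C i.succ),
      (∀ i, IsBigCM ((ι i).comp (algebraMap (R i) (Rplus i)))) ∧
      (∀ i : Fin n, (g i).comp (ι i.castSucc) = (ι i.succ).comp (fplus i)) ∧
      (∀ i : Fin (n + 1), CharP (R i) p → Function.Bijective fun c : C i => c ^ p) := by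
  have : Fact p.Prime := ⟨hp⟩
  have hpR : ∀ i, (p : R i) ∈ IsLocalRing.maximalIdeal (R i) := by
    intro i
    induction i using Fin.induction with
    | zero => rw [← IsLocalRing.residue_eq_zero_iff, map_natCast, CharP.cast_eq_zero]
    | succ i ih =>
      rw [← map_natCast (f i)]
      exact hloc i _ ih
  have : ∀ i, IsDomain (Rplus i) := fun i => (hRplus i).isDomain
  let k := IsLocalRing.ResidueField (R (Fin.last n))
  have : CharP k p := by
    rw [CharP.charP_iff_prime_eq_zero hp, ← map_natCast (IsLocalRing.residue (R (Fin.last n))),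
      IsLocalRing.residue_eq_zero_iff]
    exact hpR _
  let K := AlgebraicClosure k
  have : CharP K p := charP_of_injective_algebraMap (algebraMap k K).injective p
  have hK : MonicRoot K := fun P _ hd => IsAlgClosed.exists_root P hd.ne'
  obtain ⟨E, _, _, _, _, D, _, _, c, i, h, hD, hc, -, -, hpE, hlad⟩ := exists_cover_ladder hK n R
    (fun i a ha => DComplete.of_isAdicComplete _ ha) hpR Rplus (fun i => algebraMap _ _)
    (fun i => (hRplus i).injective) (fun i => algebraMap_isIntegral_iff.mpr (hRplus i).isIntegral)
    (fun i => (hRplus i).monic_root) f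
    (fun i => ((IsLocalRing.local_hom_TFAE (f i)).out 0 2).mpr (Ideal.map_le_iff_le_comap.mpr (hloc i)))
    fplus (fun i => RingHom.ext (hfplus i))
    ((algebraMap k K).comp (IsLocalRing.residue (R (Fin.last n))))
  obtain ⟨B, _, j, hj, hdB⟩ := exists_cmHom hc.dcomplete (hpE (Nat.cast_ne_zero.mpr hp.ne_zero)) c
    hc.residue hc.isIntegral hc.injective
  obtain ⟨C, hC, ι, g, -, hι, hg, hperf, -⟩ := hlad B j hj hdB
  exact ⟨C, hC, ι, g, fun i => (hι i).isBigCM, hg, fun i _ => hperf i (CharP.cast_eq_zero _ _)⟩
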